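/- There exists a constant c > 0 such that the following holds. Let n be a positive integer and let A ⊆ 𝔽₂ⁿ × 𝔽₂ⁿ be corner-free. Then, with N = 2ⁿ, one has |A| ≤ N² · exp(−c·(log N)^{1/178}). -/

import Mathlib

namespace CF
open Finset
open scoped Classical
set_option linter.unusedSectionVars false

section basics

theorem wpm {ι : Type*} (s : Finset ι) (w f : ι → ℝ) (hw : ∀ i ∈ s, 0 ≤ w i)
    (hf : ∀ i ∈ s, 0 ≤ f i) (p : ℕ) :
    (∑ i ∈ s, w i * f i) ^ (p+1) ≤ (∑ i ∈ s, w i) ^ p * ∑ i ∈ s, w i * f i ^ (p+1) := by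
  rcases (sum_nonneg hw).eq_or_lt with h | h
  · have h0 : ∀ i ∈ s, w i = 0 := (sum_eq_zero_iff_of_nonneg hw).1 h.symm
    rw [sum_congr rfl (fun i hi => by rw [h0 i hi, zero_mul] : ∀ i ∈ s, w i * f i = 0)]
    simp only [sum_const_zero]
    rw [zero_pow (by omega)]
    apply mul_nonneg (pow_nonneg (sum_nonneg hw) _)
    exact sum_nonneg fun i hi => mul_nonneg (hw i hi) (pow_nonneg (hf i hi) _)
  · set W := ∑ i ∈ s, w i with hW
    have := Real.pow_arith_mean_le_arith_mean_pow s (fun i => w i / W) f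
      (fun i hi => div_nonneg (hw i hi) h.le) (by rw [← sum_div]; exact div_self h.ne') hf (p+1)
    have e1 : ∑ i ∈ s, w i / W * f i = (∑ i ∈ s, w i * f i) / W := by
      rw [sum_div]; exact sum_congr rfl fun i _ => by ring
    have e2 : ∑ i ∈ s, w i / W * f i ^ (p+1) = (∑ i ∈ s, w i * f i ^ (p+1)) / W := by
      rw [sum_div]; exact sum_congr rfl fun i _ => by ring
    rw [e1, e2, div_pow, div_le_div_iff₀ (by positivity) h] at this
    have h3 : (∑ i ∈ s, w i * f i) ^ (p+1) * W ≤ (W ^ p * ∑ i ∈ s, w i * f i ^ (p+1)) * W := by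
      calc _ ≤ _ := this
        _ = _ := by ring
    exact le_of_mul_le_mul_right h3 h

end basics

variable {G : Type} [AddCommGroup G] [Module (ZMod 2) G] [Fintype G]

/-- real character -/
noncomputable def ch (φ : Module.Dual (ZMod 2) G) (x : G) : ℝ := if φ x = 0 then 1 else -1

theorem ch_add (φ : Module.Dual (ZMod 2) G) (x y : G) : ch φ (x+y) = ch φ x * ch φ y := by
  unfold ch
  rw [map_add]
  generalize φ x = a
  generalize φ y = b
  have ha : a = 0 ∨ a = 1 := by revert a; decide
  have hb : b = 0 ∨ b = 1 := by revert b; decide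
  have h2 : (1:ZMod 2) + 1 = 0 := by decide
  rcases ha with rfl | rfl <;> rcases hb with rfl | rfl <;> simp [h2]

theorem ch_add' (φ ψ : Module.Dual (ZMod 2) G) (x : G) : ch (φ+ψ) x = ch φ x * ch ψ x := by
  unfold ch
  rw [LinearMap.add_apply]
  generalize φ x = a
  generalize ψ x = b
  have ha : a = 0 ∨ a = 1 := by revert a; decide
  have hb : b = 0 ∨ b = 1 := by revert b; decide
  have h2 : (1:ZMod 2) + 1 = 0 := by decide
  rcases ha with rfl | rfl <;> rcases hb with rfl | rfl <;> simp [h2]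

theorem ch_zero (φ : Module.Dual (ZMod 2) G) : ch φ 0 = 1 := by simp [ch]

theorem ch_zero' (x : G) : ch (0 : Module.Dual (ZMod 2) G) x = 1 := by simp [ch]

theorem ch_sq (φ : Module.Dual (ZMod 2) G) (x : G) : ch φ x * ch φ x = 1 := by
  unfold ch; split_ifs <;> norm_num

theorem ch_abs (φ : Module.Dual (ZMod 2) G) (x : G) : |ch φ x| = 1 := by
  unfold ch; split_ifs <;> norm_num

theorem ch_sum {ι : Type*} (φ : Module.Dual (ZMod 2) G) (s : Finset ι) (f : ι → G) :
    ch φ (∑ i ∈ s, f i) = ∏ i ∈ s, ch φ (f i) := by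
  induction s using Finset.induction_on with
  | empty => simp [ch_zero]
  | insert a s ha ih => rw [sum_insert ha, prod_insert ha, ch_add, ih]

theorem ch_sum' {ι : Type*} (x : G) (s : Finset ι) (f : ι → Module.Dual (ZMod 2) G) :
    ch (∑ i ∈ s, f i) x = ∏ i ∈ s, ch (f i) x := by
  induction s using Finset.induction_on with
  | empty => simp [ch_zero']
  | insert a s ha ih => rw [sum_insert ha, prod_insert ha, ch_add', ih]

noncomputable instance : Fintype (Module.Dual (ZMod 2) G) :=
  haveI : Finite (Module.Dual (ZMod 2) G) := Module.finite_of_finite (ZMod 2)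
  Fintype.ofFinite _

theorem card_dual : Fintype.card (Module.Dual (ZMod 2) G) = Fintype.card G := by
  rw [Module.card_eq_pow_finrank (K := ZMod 2), Module.card_eq_pow_finrank (K := ZMod 2) (V := G),
    Subspace.dual_finrank_eq]

theorem sum_ch (x : G) : ∑ φ : Module.Dual (ZMod 2) G, ch φ x = if x = 0 then (Fintype.card G : ℝ) else 0 := by
  split_ifs with h
  · subst h
    simp [ch_zero, card_dual]
  · have : ∃ φ : Module.Dual (ZMod 2) G, φ x ≠ 0 := by
      by_contra hh
      push Not at hh
      exact h ((Module.forall_dual_apply_eq_zero_iff (ZMod 2) x).1 hh)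
    obtain ⟨φ0, h0⟩ := this
    have e : ∑ φ : Module.Dual (ZMod 2) G, ch φ x = ∑ φ : Module.Dual (ZMod 2) G, ch (φ0 + φ) x :=
      (Equiv.sum_comp (Equiv.addLeft φ0) (fun φ => ch φ x)).symm
    have e2 : ch φ0 x = -1 := by simp [ch, h0]
    simp only [ch_add', e2] at e
    rw [← mul_sum] at e
    linarith

theorem sum_ch' (φ : Module.Dual (ZMod 2) G) (h : φ ≠ 0) : ∑ x : G, ch φ x = 0 := by
  have : ∃ x, φ x ≠ 0 := by
    by_contra hh
    push Not at hh
    exact h (LinearMap.ext hh)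
  obtain ⟨x0, h0⟩ := this
  have e : ∑ x : G, ch φ x = ∑ x : G, ch φ (x0 + x) :=
    (Equiv.sum_comp (Equiv.addLeft x0) (fun x => ch φ x)).symm
  have e2 : ch φ x0 = -1 := by simp [ch, h0]
  simp only [ch_add, e2] at e
  rw [← mul_sum] at e
  linarith

/-- Fourier coefficient of a set -/
noncomputable def fc (A : Finset G) (φ : Module.Dual (ZMod 2) G) : ℝ := ∑ a ∈ A, ch φ a

theorem fc_abs (A : Finset G) (φ : Module.Dual (ZMod 2) G) : |fc A φ| ≤ #A := by
  unfold fc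
  refine (abs_sum_le_sum_abs _ _).trans ?_
  simp [ch_abs]

theorem add_eq_zero_iff' (x y : G) : x + y = 0 ↔ x = y := by
  constructor
  · intro h
    have : x + y + y = y := by rw [h, zero_add]
    rwa [add_assoc, ZModModule.add_self, add_zero] at this
  · rintro rfl; exact ZModModule.add_self _

theorem parseval (A : Finset G) : ∑ φ, fc A φ ^ 2 = Fintype.card G * #A := by
  unfold fc
  simp only [sq, sum_mul_sum, ← ch_add]
  rw [sum_comm]
  have : ∀ a ∈ A, ∑ φ : Module.Dual (ZMod 2) G, ∑ b ∈ A, ch φ (a+b) = Fintype.card G := by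
    intro a ha
    rw [sum_comm]
    simp only [sum_ch, add_eq_zero_iff']
    rw [sum_ite_eq]
    simp [ha]
  rw [sum_congr rfl this]
  simp [mul_comm]

/-- cardinality of a subspace -/
noncomputable def cd (V : Submodule (ZMod 2) G) : ℕ := #{x : G | x ∈ V}

theorem cd_pos (V : Submodule (ZMod 2) G) : 0 < cd V :=
  card_pos.2 ⟨0, by simp⟩

theorem cd_eq (V : Submodule (ZMod 2) G) : cd V = 2 ^ Module.finrank (ZMod 2) V := by
  have := Module.card_eq_pow_finrank (K := ZMod 2) (V := V)
  rw [ZMod.card] at this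
  rw [← this, cd, Fintype.card_subtype]

theorem chang (T : Finset G) (t : ℕ) (h : (Fintype.card G : ℝ) ≤ #T * 2 ^ t) :
    ∃ V : Submodule (ZMod 2) G, Fintype.card G ≤ cd V * 2 ^ (8*t) ∧
      ∀ φ : Module.Dual (ZMod 2) G, (#T : ℝ) / 2 ≤ |fc T φ| → ∀ v ∈ V, ch φ v = 1 := by
  obtain ⟨b, hb, hspan, hli⟩ := exists_linearIndependent (ZMod 2)
    {φ : Module.Dual (ZMod 2) G | (#T : ℝ) / 2 ≤ |fc T φ|}
  set B : Finset (Module.Dual (ZMod 2) G) := b.toFinset with hB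
  set V := Submodule.dualCoannihilator (Submodule.span (ZMod 2) b) with hV
  refine ⟨V, ?_, ?_⟩
  swap
  · intro φ hφ v hv
    have h1 : φ ∈ Submodule.span (ZMod 2) b := by
      rw [hspan]; exact Submodule.subset_span hφ
    rw [hV, Submodule.mem_dualCoannihilator] at hv
    simp [ch, hv φ h1]
  have hN : 0 < Fintype.card G := Fintype.card_pos
  have hT : (0:ℝ) < #T := by
    by_contra hh
    have : (#T:ℝ) = 0 := le_antisymm (not_lt.1 hh) (by positivity)
    rw [this, zero_mul] at h
    have : (0:ℝ) < Fintype.card G := by exact_mod_cast hN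
    linarith
  set D := #B with hD
  have key : Real.exp ((D:ℝ)/8) * #T ≤ Fintype.card G := by
    set σ : Module.Dual (ZMod 2) G → ℝ := fun φ => if 0 ≤ fc T φ then 1 else -1 with hσ
    have hσ2 : ∀ φ, σ φ = 1 ∨ σ φ = -1 := by intro φ; simp only [hσ]; split_ifs <;> simp
    have hσfc : ∀ φ, σ φ * fc T φ = |fc T φ| := by
      intro φ; simp only [hσ]; split_ifs with h
      · rw [abs_of_nonneg h, one_mul]
      · rw [abs_of_neg (not_le.1 h)]; ring
    have low : (D:ℝ) * (#T / 2) ≤ ∑ x ∈ T, ∑ φ ∈ B, σ φ * ch φ x := by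
      rw [sum_comm]
      have : ∀ φ ∈ B, (#T:ℝ)/2 ≤ ∑ x ∈ T, σ φ * ch φ x := by
        intro φ hφ
        rw [← mul_sum]
        change _ ≤ σ φ * fc T φ
        rw [hσfc]
        exact hb (by simpa [hB] using hφ)
      have := sum_le_sum this
      simpa using this
    have jen : (#T:ℝ) * Real.exp ((D:ℝ)/4) ≤ ∑ x ∈ T, Real.exp (1/2 * ∑ φ ∈ B, σ φ * ch φ x) := by
      have h1 := convexOn_exp.map_sum_le (t := T) (w := fun _ => (1:ℝ)/#T)
        (p := fun x => 1/2 * ∑ φ ∈ B, σ φ * ch φ x) (fun _ _ => by positivity)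
        (by simp [hT.ne']) (fun _ _ => Set.mem_univ _)
      simp only [smul_eq_mul] at h1
      rw [← mul_sum, ← mul_sum, ← mul_sum] at h1
      have h2 : Real.exp ((D:ℝ)/4) ≤ Real.exp (1 / (#T:ℝ) * (1/2 * ∑ x ∈ T, ∑ φ ∈ B, σ φ * ch φ x)) := by
        apply Real.exp_le_exp.2
        have : 1 / (#T:ℝ) * (1/2 * ((D:ℝ) * (#T / 2))) ≤ 1 / (#T:ℝ) * (1/2 * ∑ x ∈ T, ∑ φ ∈ B, σ φ * ch φ x) := by
          gcongr
        refine le_trans (le_of_eq ?_) this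
        field_simp; norm_num
      have h3 := h2.trans h1
      have := mul_le_mul_of_nonneg_left h3 hT.le
      rwa [← mul_assoc, mul_one_div_cancel hT.ne', one_mul] at this
    have up : ∑ x ∈ T, Real.exp (1/2 * ∑ φ ∈ B, σ φ * ch φ x) ≤ Fintype.card G * Real.cosh (1/2) ^ D := by
      have e1 : ∀ x : G, Real.exp (1/2 * ∑ φ ∈ B, σ φ * ch φ x) =
          ∏ φ ∈ B, (σ φ * Real.sinh (1/2) * ch φ x + Real.cosh (1/2)) := by
        intro x
        rw [mul_sum, Real.exp_sum]
        apply prod_congr rfl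
        intro φ _
        have hc : ch φ x = 1 ∨ ch φ x = -1 := by unfold ch; split_ifs <;> simp
        have e3 := Real.cosh_add_sinh (1/2)
        have e4 := Real.cosh_sub_sinh (1/2)
        rcases hσ2 φ with h1 | h1 <;> rcases hc with h2 | h2 <;> rw [h1, h2]
        · rw [show (1:ℝ)/2*(1*1) = 1/2 by norm_num]; linarith
        · rw [show (1:ℝ)/2*(1*(-1)) = -(1/2) by norm_num]; linarith
        · rw [show (1:ℝ)/2*((-1)*(1)) = -(1/2) by norm_num]; linarith
        · rw [show (1:ℝ)/2*((-1)*(-1)) = (1/2) by norm_num]; linarith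
      calc _ ≤ ∑ x : G, Real.exp (1/2 * ∑ φ ∈ B, σ φ * ch φ x) :=
            sum_le_sum_of_subset_of_nonneg (subset_univ _) (fun _ _ _ => (Real.exp_pos _).le)
        _ = ∑ x : G, ∏ φ ∈ B, (σ φ * Real.sinh (1/2) * ch φ x + Real.cosh (1/2)) := by
            simp only [e1]
        _ = ∑ x : G, ∑ s ∈ B.powerset, (∏ φ ∈ s, (σ φ * Real.sinh (1/2))) * (∏ φ ∈ B \ s, Real.cosh (1/2)) * ch (∑ φ ∈ s, φ) x := by
            refine sum_congr rfl fun x _ => ?_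
            rw [prod_add]
            refine sum_congr rfl fun s _ => ?_
            rw [prod_mul_distrib, ch_sum']; ring
        _ = ∑ s ∈ B.powerset, (∏ φ ∈ s, (σ φ * Real.sinh (1/2))) * (∏ φ ∈ B \ s, Real.cosh (1/2)) * ∑ x : G, ch (∑ φ ∈ s, φ) x := by
            rw [sum_comm]; simp only [mul_sum]
        _ = (Fintype.card G * Real.cosh (1/2) ^ D) := by
            rw [sum_eq_single ∅]
            · simp [ch_zero', hD]; ring
            · intro s hs hne
              rw [sum_ch', mul_zero]
              intro h0
              apply hne
              rw [eq_empty_iff_forall_notMem]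
              intro φ hφ
              have hsub : s ⊆ B := mem_powerset.1 hs
              have hli0 : LinearIndepOn (ZMod 2) (id : Module.Dual (ZMod 2) G → Module.Dual (ZMod 2) G) b := hli
              have hli1 : LinearIndepOn (ZMod 2) (id : Module.Dual (ZMod 2) G → Module.Dual (ZMod 2) G) (s : Set (Module.Dual (ZMod 2) G)) := hli0.mono (by
                intro y hy; have := hsub hy; simpa [hB] using this)
              have hli' := linearIndepOn_finset_iff.1 hli1 (fun _ => 1) (by simpa using h0) φ hφ
              exact one_ne_zero hli'
            · simp
        _ ≤ _ := le_rfl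
    have hc := Real.cosh_le_exp_half_sq (1/2)
    have h5 : (#T:ℝ) * Real.exp ((D:ℝ)/4) ≤ Fintype.card G * Real.exp ((D:ℝ)/8) := by
      refine (jen.trans up).trans ?_
      gcongr
      calc Real.cosh (1/2) ^ D ≤ Real.exp ((1/2)^2/2) ^ D := by
            gcongr
        _ = _ := by rw [← Real.exp_nat_mul]; congr 1; ring
    have h6 : Real.exp ((D:ℝ)/4) = Real.exp ((D:ℝ)/8) * Real.exp ((D:ℝ)/8) := by
      rw [← Real.exp_add]; congr 1; ring
    rw [h6] at h5
    have h7 := Real.exp_pos ((D:ℝ)/8)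
    have h8 : (Real.exp ((D:ℝ)/8) * #T) * Real.exp ((D:ℝ)/8) ≤ Fintype.card G * Real.exp ((D:ℝ)/8) := by
      linarith
    exact le_of_mul_le_mul_right h8 h7
  have hD8 : D ≤ 8 * t := by
    have h1 : Real.exp ((D:ℝ)/8) ≤ 2 ^ t := by
      have : Real.exp ((D:ℝ)/8) * #T ≤ 2^t * #T := by linarith
      exact le_of_mul_le_mul_right this hT
    have h2 : (2:ℝ)^t ≤ Real.exp t := by
      rw [← Real.exp_one_pow]
      gcongr
      have := Real.add_one_le_exp (1:ℝ); linarith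
    have h3 := Real.exp_le_exp.1 (h1.trans h2)
    have : (D:ℝ) ≤ 8 * t := by linarith
    exact_mod_cast this
  have hfr : Module.finrank (ZMod 2) (Submodule.span (ZMod 2) b) = D := by
    rw [finrank_span_set_eq_card hli]
  have hsum := Subspace.finrank_add_finrank_dualCoannihilator_eq (Submodule.span (ZMod 2) b)
  rw [cd_eq, Module.card_eq_pow_finrank (K := ZMod 2) (V := G), ZMod.card, ← pow_add]
  apply Nat.pow_le_pow_right (by norm_num)
  rw [hfr, ← hV] at hsum
  omega

end CF

namespace CF
open Finset
open scoped Classical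
set_option linter.unusedSectionVars false

variable {G : Type} [AddCommGroup G] [Module (ZMod 2) G] [Fintype G]

theorem hoeff1 (A : Finset G) (φ : G → ℝ) (hφ : ∀ a ∈ A, |φ a| ≤ 1) (h0 : ∑ a ∈ A, φ a = 0)
    (m : ℕ) (η : ℝ) (hη : 0 ≤ η) (hη1 : η ≤ 1) :
    (#{a ∈ Fintype.piFinset (fun _ : Fin m => A) | m * η ≤ ∑ i, φ (a i)} : ℝ) ≤
      #A ^ m * Real.exp (-(m * η^2/4)) := by
  set P := Fintype.piFinset (fun _ : Fin m => A) with hP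
  have h1 : ∑ a ∈ P, Real.exp (η/2 * ∑ i, φ (a i)) ≤ #A ^ m * Real.exp (m * η^2/4) := by
    have e : ∀ a : Fin m → G, Real.exp (η/2 * ∑ i, φ (a i)) = ∏ i, Real.exp (η/2 * φ (a i)) := by
      intro a; rw [mul_sum, Real.exp_sum]
    simp only [e]
    rw [hP, ← Finset.sum_pow' A (fun a => Real.exp (η/2 * φ a)) m]
    have h2 : ∑ a ∈ A, Real.exp (η/2 * φ a) ≤ #A * Real.exp (η^2/4) := by
      have : ∀ a ∈ A, Real.exp (η/2 * φ a) ≤ 1 + η/2 * φ a + η^2/4 := by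
        intro a ha
        have h3 : |η/2 * φ a| ≤ η/2 := by
          rw [abs_mul, abs_of_nonneg (by linarith : 0 ≤ η/2)]
          have := hφ a ha
          nlinarith
        have h4 := Real.abs_exp_sub_one_sub_id_le (x := η/2 * φ a) (by linarith)
        have h5 := (abs_le.1 h4).2
        have h6 : (η/2 * φ a)^2 ≤ (η/2)^2 := by
          rw [← sq_abs]; gcongr
        nlinarith
      refine (sum_le_sum this).trans ?_
      rw [sum_add_distrib, sum_add_distrib, ← mul_sum, h0]
      simp only [sum_const, nsmul_eq_mul, mul_one, mul_zero, add_zero]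
      have := Real.add_one_le_exp (η^2/4)
      have h7 : (0:ℝ) ≤ #A := by positivity
      nlinarith
    calc _ ≤ (#A * Real.exp (η^2/4))^m := by
          gcongr
      _ = _ := by rw [mul_pow, ← Real.exp_nat_mul]; congr 2; ring
  have h2 : (#{a ∈ P | m * η ≤ ∑ i, φ (a i)} : ℝ) * Real.exp (m*η^2/2) ≤
      ∑ a ∈ P, Real.exp (η/2 * ∑ i, φ (a i)) := by
    calc _ = ∑ a ∈ {a ∈ P | m * η ≤ ∑ i, φ (a i)}, Real.exp (m*η^2/2) := by simp
      _ ≤ ∑ a ∈ {a ∈ P | m * η ≤ ∑ i, φ (a i)}, Real.exp (η/2 * ∑ i, φ (a i)) := by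
          apply sum_le_sum
          intro a ha
          apply Real.exp_le_exp.2
          have := (mem_filter.1 ha).2
          nlinarith
      _ ≤ _ := sum_le_sum_of_subset_of_nonneg (filter_subset _ _) (fun _ _ _ => (Real.exp_pos _).le)
  have h3 := h2.trans h1
  have e1 : Real.exp (m*η^2/4) = Real.exp (-(m*η^2/4)) * Real.exp (m*η^2/2) := by
    rw [← Real.exp_add]; congr 1; ring
  rw [e1, ← mul_assoc] at h3
  exact le_of_mul_le_mul_right h3 (Real.exp_pos _)

theorem hoeff (A : Finset G) (φ : G → ℝ) (hφ : ∀ a ∈ A, |φ a| ≤ 1) (h0 : ∑ a ∈ A, φ a = 0)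
    (m : ℕ) (η : ℝ) (hη : 0 ≤ η) (hη1 : η ≤ 1) :
    (#{a ∈ Fintype.piFinset (fun _ : Fin m => A) | m * η ≤ |∑ i, φ (a i)|} : ℝ) ≤
      2 * (#A ^ m * Real.exp (-(m * η^2/4))) := by
  have a1 := hoeff1 A φ hφ h0 m η hη hη1
  have a2 := hoeff1 A (fun x => - φ x) (fun a ha => by rw [abs_neg]; exact hφ a ha)
    (by rw [sum_neg_distrib, h0, neg_zero]) m η hη hη1
  have : #{a ∈ Fintype.piFinset (fun _ : Fin m => A) | m * η ≤ |∑ i, φ (a i)|} ≤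
      #{a ∈ Fintype.piFinset (fun _ : Fin m => A) | m * η ≤ ∑ i, φ (a i)} +
      #{a ∈ Fintype.piFinset (fun _ : Fin m => A) | m * η ≤ ∑ i, -φ (a i)} := by
    refine le_trans (card_le_card ?_) (card_union_le _ _)
    intro a ha
    rw [mem_filter] at ha
    rw [mem_union, mem_filter, mem_filter]
    rcases le_abs.1 ha.2 with h | h
    · exact Or.inl ⟨ha.1, h⟩
    · exact Or.inr ⟨ha.1, by rw [sum_neg_distrib]; exact h⟩
  have : (#{a ∈ Fintype.piFinset (fun _ : Fin m => A) | m * η ≤ |∑ i, φ (a i)|} : ℝ) ≤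
      #{a ∈ Fintype.piFinset (fun _ : Fin m => A) | m * η ≤ ∑ i, φ (a i)} +
      #{a ∈ Fintype.piFinset (fun _ : Fin m => A) | m * η ≤ ∑ i, -φ (a i)} := by exact_mod_cast this
  linarith

/-- proportion of a in A with a+x in S -/
noncomputable def FF (A S : Finset G) (x : G) : ℝ := (∑ a ∈ A, if a + x ∈ S then (1:ℝ) else 0) / #A

theorem card_shift (p : G → Prop) (t : G) : #{x : G | p (x + t)} = #{x : G | p x} := by
  apply card_bij (fun x _ => x + t)
  · intro x hx; simpa using hx
  · intro x _ y _ h; exact add_right_cancel h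
  · intro y hy
    refine ⟨y + t, ?_, ?_⟩
    · simp only [mem_filter, mem_univ, true_and] at hy ⊢
      rwa [add_assoc, ZModModule.add_self, add_zero]
    · rw [add_assoc, ZModModule.add_self, add_zero]

theorem croot_sisask (A S : Finset G) (hA : A.Nonempty) (m : ℕ) (hm : 0 < m) (η ε : ℝ) (hη : 0 ≤ η) (hη1 : η ≤ 1)
    (hε : 0 < ε) (h : 4 * Real.exp (-(m*η^2/4)) ≤ ε) :
    ∃ T : Finset G, (Fintype.card G : ℝ) * #A ^ m ≤ 2 * (#T * Fintype.card G ^ m) ∧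
      ∀ t ∈ T, ∀ t' ∈ T, (#{x : G | 2 * η < |FF A S (x + (t+t')) - FF A S x|} : ℝ) ≤ 2 * ε * Fintype.card G := by
  set P := Fintype.piFinset (fun _ : Fin m => A) with hP
  set N : ℝ := ((Fintype.card G : ℕ) : ℝ) with hN
  have hN0 : 0 < N := by rw [hN]; exact_mod_cast Fintype.card_pos
  have hA0 : (0:ℝ) < #A := by exact_mod_cast card_pos.2 hA
  set F := FF A S with hF
  let is : G → ℝ := fun x => if x ∈ S then (1:ℝ) else 0
  let bad : (Fin m → G) → G → Prop := fun a x => m * η ≤ |∑ i, (is (a i + x) - F x)|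
  have hFs : ∀ x, F x * #A = ∑ a ∈ A, is (a + x) := by
    intro x; simp only [hF, FF, is]; field_simp
  have hF01 : ∀ x, 0 ≤ F x ∧ F x ≤ 1 := by
    intro x
    constructor
    · simp only [hF, FF]; apply div_nonneg _ hA0.le
      exact sum_nonneg fun i _ => by split_ifs <;> norm_num
    · simp only [hF, FF]; rw [div_le_one hA0]
      calc _ ≤ ∑ a ∈ A, (1:ℝ) := sum_le_sum fun i _ => by split_ifs <;> norm_num
        _ = _ := by simp
  have hbad : ∀ x, (#{a ∈ P | bad a x} : ℝ) ≤ ε/2 * #A^m := by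
    intro x
    have := hoeff A (fun a => is (a + x) - F x) (fun a _ => by
      have := hF01 x
      simp only [is]; split_ifs <;> rw [abs_le] <;> constructor <;> linarith)
      (by rw [sum_sub_distrib, ← hFs]; simp [mul_comm]) m η hη hη1
    refine this.trans ?_
    have : (0:ℝ) < #A^m := by positivity
    nlinarith
  have hdc : ∑ a ∈ P, (#{x : G | bad a x} : ℝ) ≤ N * (ε/2 * #A^m) := by
    have : ∑ a ∈ P, (#{x : G | bad a x} : ℝ) = ∑ x : G, (#{a ∈ P | bad a x} : ℝ) := by
      simp only [card_filter, Nat.cast_sum]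
      rw [sum_comm]
    rw [this]
    refine (sum_le_sum fun x _ => hbad x).trans ?_
    simp [hN]
  set L := {a ∈ P | (#{x : G | bad a x} : ℝ) ≤ ε * N} with hL
  have hPc : (#P : ℝ) = #A^m := by simp [hP]
  have hLc : (#A:ℝ)^m ≤ 2 * #L := by
    have h1 : (#{a ∈ P | ¬ (#{x : G | bad a x} : ℝ) ≤ ε * N} : ℝ) * (ε * N) ≤ N * (ε/2 * #A^m) := by
      refine le_trans ?_ hdc
      calc _ = ∑ a ∈ {a ∈ P | ¬ (#{x : G | bad a x} : ℝ) ≤ ε * N}, (ε * N) := by simp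
        _ ≤ ∑ a ∈ {a ∈ P | ¬ (#{x : G | bad a x} : ℝ) ≤ ε * N}, (#{x : G | bad a x} : ℝ) := by
          apply sum_le_sum; intro a ha; exact (not_le.1 (mem_filter.1 ha).2).le
        _ ≤ _ := sum_le_sum_of_subset_of_nonneg (filter_subset _ _) (fun _ _ _ => by positivity)
    have h2 : (#{a ∈ P | ¬ (#{x : G | bad a x} : ℝ) ≤ ε * N} : ℝ) ≤ #A^m/2 := by
      have : (#{a ∈ P | ¬ (#{x : G | bad a x} : ℝ) ≤ ε * N} : ℝ) * (ε * N) ≤ #A^m/2 * (ε*N) := by linarith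
      exact le_of_mul_le_mul_right this (by positivity)
    have h3 := card_filter_add_card_filter_not (s := P) (fun a => (#{x : G | bad a x} : ℝ) ≤ ε * N)
    have h4 : (#L : ℝ) + (#{a ∈ P | ¬ (#{x : G | bad a x} : ℝ) ≤ ε * N} : ℝ) = #P := by exact_mod_cast h3
    linarith
  -- averaging
  have hav : ∑ a : Fin m → G, (#{t : G | (fun i => a i + t) ∈ L} : ℝ) = N * #L := by
    have h1 : ∑ a : Fin m → G, (#{t : G | (fun i => a i + t) ∈ L} : ℝ) =
        ∑ t : G, ∑ a : Fin m → G, if (fun i => a i + t) ∈ L then (1:ℝ) else 0 := by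
      rw [sum_comm]; simp only [card_filter, Nat.cast_sum, Nat.cast_ite, Nat.cast_one, Nat.cast_zero]
    rw [h1]
    have h2 : ∀ t : G, (∑ a : Fin m → G, if (fun i => a i + t) ∈ L then (1:ℝ) else 0) = #L := by
      intro t
      rw [show (∑ a : Fin m → G, if (fun i => a i + t) ∈ L then (1:ℝ) else 0) =
        ∑ a : Fin m → G, if a ∈ L then (1:ℝ) else 0 from
        Equiv.sum_comp (Equiv.addRight (fun _ : Fin m => t)) (fun a => if a ∈ L then (1:ℝ) else 0)]
      simp
    simp only [h2]
    simp [hN]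
  have : ∃ a : Fin m → G, N * #A^m ≤ 2 * (#{t : G | (fun i => a i + t) ∈ L} * N^m) := by
    by_contra hcon
    push Not at hcon
    have h1 : ∑ a : Fin m → G, 2 * ((#{t : G | (fun i => a i + t) ∈ L} : ℝ) * N^m) < ∑ a : Fin m → G, N * #A^m :=
      sum_lt_sum_of_nonempty ⟨fun _ => 0, mem_univ _⟩ (fun a _ => hcon a)
    rw [← mul_sum, ← sum_mul, hav] at h1
    simp at h1
    rw [← hN] at h1
    have : N^m * (N * #A^m) ≤ N^m * (N * (2 * #L)) := by gcongr
    linarith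
  obtain ⟨a, ha⟩ := this
  refine ⟨Finset.univ.filter (fun t : G => (fun i => a i + t) ∈ L), ha, ?_⟩
  have hgood : ∀ t, (fun i => a i + t) ∈ L → (#{x : G | m * η ≤ |∑ i, is (a i + x) - m * F (x + t)|} : ℝ) ≤ ε * N := by
    intro t ht
    have h1 := (mem_filter.1 ht).2
    rw [← card_shift _ t] at h1
    refine le_trans ?_ h1
    norm_cast
    apply card_le_card
    intro x hx
    simp only [mem_filter, mem_univ, true_and, bad] at hx ⊢
    rw [sum_sub_distrib]
    simp only [sum_const, card_univ, Fintype.card_fin, nsmul_eq_mul]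
    have : ∀ i, a i + t + (x + t) = a i + x := by
      intro i
      rw [show a i + t + (x + t) = a i + x + (t + t) by abel, ZModModule.add_self, add_zero]
    simpa only [this] using hx
  intro t ht t' ht'
  have g1 := hgood t (by simpa using ht)
  have g2 := hgood t' (by simpa using ht')
  rw [← card_shift _ t]
  have hsub : #{x : G | 2 * η < |F (x + t + (t+t')) - F (x+t)|} ≤
     #{x : G | m * η ≤ |∑ i, is (a i + x) - m * F (x + t)|} + #{x : G | m * η ≤ |∑ i, is (a i + x) - m * F (x + t')|} := by
    refine le_trans (card_le_card ?_) (card_union_le _ _)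
    intro x hx
    simp only [mem_filter, mem_univ, true_and, mem_union] at hx ⊢
    by_contra hcon
    push Not at hcon
    rw [show x + t + (t + t') = x + t' + (t + t) by abel, ZModModule.add_self, add_zero] at hx
    have hm' : (0:ℝ) < m := by exact_mod_cast hm
    have h3 : |(m:ℝ) * (F (x+t') - F (x+t))| < m * (2 * η) := by
      have e : (m:ℝ) * (F (x+t') - F (x+t)) = (∑ i, is (a i + x) - m * F (x + t)) - (∑ i, is (a i + x) - m * F (x + t')) := by ring
      rw [e]
      have := abs_sub (∑ i, is (a i + x) - m * F (x + t)) (∑ i, is (a i + x) - m * F (x + t'))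
      linarith [hcon.1, hcon.2]
    rw [abs_mul, abs_of_pos hm'] at h3
    have := lt_of_mul_lt_mul_left h3 hm'.le
    linarith
  have hsub' : (#{x : G | 2 * η < |F (x + t + (t+t')) - F (x+t)|} : ℝ) ≤
     #{x : G | m * η ≤ |∑ i, is (a i + x) - m * F (x + t)|} + #{x : G | m * η ≤ |∑ i, is (a i + x) - m * F (x + t')|} := by
    exact_mod_cast hsub
  linarith

end CF

namespace CF
open Finset
open scoped Classical
set_option linter.unusedSectionVars false

variable {G : Type} [AddCommGroup G] [Module (ZMod 2) G] [Fintype G]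

theorem near_sum (F : G → ℝ) (η ε : ℝ) (_hη : 0 ≤ η) {ι : Type} (s : Finset ι) (y : ι → G)
    (h : ∀ i ∈ s, (#{x : G | η < |F (x + y i) - F x|} : ℝ) ≤ ε) :
    (#{x : G | η * #s < |F (x + ∑ i ∈ s, y i) - F x|} : ℝ) ≤ ε * #s := by
  induction s using Finset.induction_on with
  | empty => simp
  | insert a s ha ih =>
    have ih' := ih (fun i hi => h i (mem_insert_of_mem hi))
    have ha' := h a (mem_insert_self _ _)
    rw [← card_shift _ (∑ i ∈ s, y i)] at ha'
    rw [sum_insert ha, card_insert_of_notMem ha]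
    have : #{x : G | η * ((#s + 1 : ℕ):ℝ) < |F (x + (y a + ∑ i ∈ s, y i)) - F x|} ≤
      #{x : G | η < |F (x + ∑ i ∈ s, y i + y a) - F (x + ∑ i ∈ s, y i)|} + #{x : G | η * #s < |F (x + ∑ i ∈ s, y i) - F x|} := by
      refine le_trans (card_le_card ?_) (card_union_le _ _)
      intro x hx
      simp only [mem_filter, mem_univ, true_and, mem_union] at hx ⊢
      by_contra hcon
      push Not at hcon
      rw [show x + (y a + ∑ i ∈ s, y i) = x + ∑ i ∈ s, y i + y a by abel] at hx
      have := abs_sub_le (F (x + ∑ i ∈ s, y i + y a)) (F (x + ∑ i ∈ s, y i)) (F x)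
      push_cast at hx
      linarith [hcon.1, hcon.2]
    have : (#{x : G | η * ((#s + 1 : ℕ):ℝ) < |F (x + (y a + ∑ i ∈ s, y i)) - F x|} : ℝ) ≤
      #{x : G | η < |F (x + ∑ i ∈ s, y i + y a) - F (x + ∑ i ∈ s, y i)|} + #{x : G | η * #s < |F (x + ∑ i ∈ s, y i) - F x|} := by
      exact_mod_cast this
    push_cast at this ⊢
    linarith

theorem ind_fourier (S : Finset G) (w : G) :
    (Fintype.card G : ℝ) * (if w ∈ S then (1:ℝ) else 0) = ∑ φ, fc S φ * ch φ w := by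
  unfold fc
  simp only [sum_mul, ← ch_add]
  rw [sum_comm]
  simp only [sum_ch, add_eq_zero_iff']
  rw [sum_ite_eq']
  simp

def mAP (ℓ e : ℕ) : ℕ := 64 * (ℓ+e)^2 * 4^e * (2*(ℓ+e)+4)
def dAP (ℓ e : ℕ) : ℕ := 8 * (mAP ℓ e * ℓ + 1)

set_option maxHeartbeats 2000000 in
theorem ap (A1 A2 S : Finset G) (ℓ e : ℕ) (he : 1 ≤ e)
    (h1 : (Fintype.card G : ℝ) ≤ #A1 * 2^ℓ) (h2 : (Fintype.card G : ℝ) ≤ #A2 * 2^ℓ)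
    (hbad : (#{p ∈ A1 ×ˢ A2 | p.1 + p.2 ∉ S} : ℝ) * 2^e ≤ 2 * (#A1 * #A2)) :
    ∃ (V : Submodule (ZMod 2) G) (y : G), Fintype.card G ≤ cd V * 2 ^ dAP ℓ e ∧
      (1 - 4 / 2^e) * (cd V : ℝ) ≤ #{v : G | v ∈ V ∧ y + v ∈ S} := by
  set N : ℝ := ((Fintype.card G : ℕ) : ℝ) with hN
  have hN0 : 0 < N := by rw [hN]; exact_mod_cast Fintype.card_pos
  have hpos : ∀ A : Finset G, N ≤ #A * 2^ℓ → (0:ℝ) < #A := by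
    intro A h
    by_contra hh
    have : (#A:ℝ) = 0 := le_antisymm (not_lt.1 hh) (by positivity)
    rw [this, zero_mul] at h; linarith
  have hA1 := hpos A1 h1
  have hA2 := hpos A2 h2
  have hA1N : (#A1 : ℝ) ≤ N := by rw [hN]; exact_mod_cast card_le_univ A1
  have hA2N : (#A2 : ℝ) ≤ N := by rw [hN]; exact_mod_cast card_le_univ A2
  have hSN : (#S : ℝ) ≤ N := by rw [hN]; exact_mod_cast card_le_univ S
  set k := ℓ + e with hk
  have hk1 : 1 ≤ k := by omega
  have hk1' : (1:ℝ) ≤ k := by exact_mod_cast hk1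
  set η : ℝ := 1/2^e with hη
  have hη0 : 0 < η := by positivity
  have hη1 : η ≤ 1 := by rw [hη, div_le_one (by positivity)]; exact one_le_pow₀ (by norm_num)
  set η' : ℝ := η / (4 * k) with hη'
  have hη'0 : 0 < η' := by positivity
  have hη'1 : η' ≤ 1 := by rw [hη', div_le_one (by positivity)]; linarith
  set ε : ℝ := 1 / (2^k * (4 * k)) with hε
  have hε0 : 0 < ε := by positivity
  set m := mAP ℓ e with hm
  have hm0 : 0 < m := by rw [hm, mAP]; positivity
  have hexp : 4 * Real.exp (-(m*η'^2/4)) ≤ ε := by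
    have e1 : (m:ℝ) * η'^2/4 = 2*k+4 := by
      rw [hη', hη, hm, mAP, ← hk]; push_cast
      rw [show (4:ℝ)^e = (2^e)^2 by rw [← pow_mul, mul_comm, pow_mul]; norm_num]
      field_simp
      ring
    rw [e1, Real.exp_neg]
    have h3 : (16:ℝ) * 4^k ≤ Real.exp (2*k+4) := by
      have h4 : (2:ℝ) ≤ Real.exp 1 := by have := Real.add_one_le_exp (1:ℝ); linarith
      calc (16:ℝ) * 4^k = 2^(2*k+4) := by rw [pow_add 2 (2*k) 4, pow_mul 2 2 k]; norm_num; ring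
        _ ≤ Real.exp 1 ^ (2*k+4) := by gcongr
        _ = _ := by rw [Real.exp_one_pow]; push_cast; ring_nf
    have h5 : (16:ℝ) * (2^k * k) ≤ 16 * 4^k := by
      have : (k:ℝ) ≤ 2^k := by exact_mod_cast (Nat.lt_two_pow_self (n := k)).le
      have e4 : (4:ℝ)^k = 2^k * 2^k := by rw [← mul_pow]; norm_num
      rw [e4]; gcongr
    rw [hε, ← div_eq_mul_inv, div_le_div_iff₀ (Real.exp_pos _) (by positivity)]
    linarith
  obtain ⟨T, hT1, hT2⟩ := croot_sisask A1 S (card_pos.1 (by exact_mod_cast hA1)) m hm0 η' ε hη'0.le hη'1 hε0 hexp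
  rw [← hN] at hT1 hT2
  have hTN : N ≤ #T * 2^(m*ℓ+1) := by
    have h3 : N ^ m ≤ #A1^m * 2^(m*ℓ) := by
      calc N^m ≤ (#A1 * 2^ℓ)^m := by gcongr
        _ = _ := by rw [mul_pow, ← pow_mul, mul_comm ℓ]
    have h4 : N * #A1^m ≤ #T * 2^(m*ℓ+1) * #A1^m := by
      calc _ ≤ _ := hT1
        _ ≤ 2 * (#T * (#A1^m * 2^(m*ℓ))) := by gcongr
        _ = _ := by ring
    exact le_of_mul_le_mul_right h4 (by positivity)
  obtain ⟨V, hV1, hV2⟩ := chang T (m*ℓ+1) hTN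
  set F := FF A1 S with hF
  let is : G → ℝ := fun x => if x ∈ S then (1:ℝ) else 0
  have hFs : ∀ x, F x * #A1 = ∑ a ∈ A1, is (a + x) := by
    intro x; simp only [hF, FF, is]; field_simp
  have hF01 : ∀ x, 0 ≤ F x ∧ F x ≤ 1 := by
    intro x
    constructor
    · simp only [hF, FF]; apply div_nonneg _ hA1.le
      exact sum_nonneg fun i _ => by split_ifs <;> norm_num
    · simp only [hF, FF]; rw [div_le_one hA1]
      calc _ ≤ ∑ a ∈ A1, (1:ℝ) := sum_le_sum fun i _ => by split_ifs <;> norm_num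
        _ = _ := by simp
  set Q := Fintype.piFinset (fun _ : Fin k => T ×ˢ T) with hQ
  let y : (Fin k → G × G) → G := fun t => ∑ i, ((t i).1 + (t i).2)
  let H : G → ℝ := fun v => ∑ t ∈ Q, ∑ b ∈ A2, ∑ a ∈ A1, is (a + b + y t + v)
  have hQc : (#Q : ℝ) = (#T^2)^k := by simp [hQ, sq]
  have hT0 : (0:ℝ) < #T := by
    by_contra hh
    have : (#T:ℝ) = 0 := le_antisymm (not_lt.1 hh) (by positivity)
    rw [this, zero_mul] at hTN; linarith
  -- lower bound for H 0
  have hF2 : (1 - 2*η) * #A2 ≤ ∑ b ∈ A2, F b := by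
    have e1 : (∑ b ∈ A2, F b) * #A1 = #A1 * #A2 - #{p ∈ A1 ×ˢ A2 | p.1 + p.2 ∉ S} := by
      rw [sum_mul]
      simp only [hFs]
      have h3 := card_filter_add_card_filter_not (s := A1 ×ˢ A2) (fun p => p.1 + p.2 ∈ S)
      have h4 : (#{p ∈ A1 ×ˢ A2 | p.1 + p.2 ∈ S} : ℝ) + #{p ∈ A1 ×ˢ A2 | p.1 + p.2 ∉ S} = #A1 * #A2 := by
        rw [card_product] at h3; exact_mod_cast h3
      have h5 : (#{p ∈ A1 ×ˢ A2 | p.1 + p.2 ∈ S} : ℝ) = ∑ b ∈ A2, ∑ a ∈ A1, is (a + b) := by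
        rw [card_filter, sum_product_right]; push_cast; rfl
      linarith
    have h3 : (#{p ∈ A1 ×ˢ A2 | p.1 + p.2 ∉ S} : ℝ) ≤ 2 * η * (#A1 * #A2) := by
      rw [hη]
      rw [show 2 * (1/2^e) * ((#A1:ℝ) * #A2) = 2 * (#A1 * #A2) / 2^e by ring, le_div_iff₀ (by positivity)]
      exact hbad
    have h4 : (1 - 2*η) * #A2 * #A1 ≤ (∑ b ∈ A2, F b) * #A1 := by rw [e1]; linarith
    exact le_of_mul_le_mul_right h4 hA1
  have hH0 : (1 - 3*η) * (#A1 * #A2 * (#T^2)^k) ≤ H 0 := by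
    have h3 : ∀ t ∈ Q, (1 - 3*η) * (#A1 * #A2) ≤ ∑ b ∈ A2, ∑ a ∈ A1, is (a + b + y t + 0) := by
      intro t ht
      have ht' : ∀ i, (t i).1 ∈ T ∧ (t i).2 ∈ T := by
        intro i; have := Fintype.mem_piFinset.1 ht i; simpa using this
      have hn := near_sum F (2*η') (2*ε*N) (by positivity) univ (fun i => (t i).1 + (t i).2)
        (fun i _ => hT2 _ (ht' i).1 _ (ht' i).2)
      simp only [card_univ, Fintype.card_fin] at hn
      have e1 : 2 * η' * k = η/2 := by rw [hη']; field_simp; norm_num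
      have e2 : 2 * ε * N * k ≤ η/2 * #A2 := by
        have : 2 * ε * k = η/2 / 2^ℓ := by rw [hε, hη, hk, pow_add]; field_simp; norm_num
        calc 2 * ε * N * k = 2 * ε * k * N := by ring
          _ = η/2/2^ℓ * N := by rw [this]
          _ ≤ η/2/2^ℓ * (#A2 * 2^ℓ) := by gcongr
          _ = _ := by field_simp
      rw [e1] at hn
      change (#{x : G | η/2 < |F (x + y t) - F x|} : ℝ) ≤ _ at hn
      have h5 : ∑ b ∈ A2, F b - η * #A2 ≤ ∑ b ∈ A2, F (b + y t) := by
        have : ∀ b ∈ A2, F b - η/2 - (if η/2 < |F (b + y t) - F b| then (1:ℝ) else 0) ≤ F (b + y t) := by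
          intro b _
          split_ifs with hc
          · have := hF01 b; have := hF01 (b + y t); linarith
          · have := abs_le.1 (not_lt.1 hc); linarith
        have h6 := sum_le_sum this
        rw [sum_sub_distrib, sum_sub_distrib] at h6
        have h7 : (∑ b ∈ A2, if η/2 < |F (b + y t) - F b| then (1:ℝ) else 0) ≤ η/2 * #A2 := by
          refine le_trans ?_ (hn.trans e2)
          rw [sum_boole]
          norm_cast
          apply card_le_card
          intro x hx; simp only [mem_filter, mem_univ, true_and] at hx ⊢; exact hx.2
        simp only [sum_const, nsmul_eq_mul] at h6
        linarith
      have h8 : ∑ b ∈ A2, ∑ a ∈ A1, is (a + b + y t + 0) = (∑ b ∈ A2, F (b + y t)) * #A1 := by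
        rw [sum_mul]; refine sum_congr rfl fun b _ => ?_
        rw [hFs]; refine sum_congr rfl fun a _ => ?_
        rw [add_zero, add_assoc]
      rw [h8]
      calc (1 - 3*η) * (#A1 * #A2) = ((1 - 2*η)* #A2 - η * #A2) * #A1 := by ring
        _ ≤ (∑ b ∈ A2, F (b + y t)) * #A1 := by gcongr; linarith
    have := sum_le_sum h3
    rw [sum_const, nsmul_eq_mul, hQc] at this
    calc _ = (#T^2)^k * ((1 - 3*η) * (#A1 * #A2)) := by ring
      _ ≤ _ := this
  -- Fourier
  have hHf : ∀ v, N * H v = ∑ φ, fc S φ * fc A1 φ * fc A2 φ * (fc T φ^2)^k * ch φ v := by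
    intro v
    have e1 : ∀ φ : Module.Dual (ZMod 2) G, (fc T φ^2)^k = ∑ t ∈ Q, ch φ (y t) := by
      intro φ
      have : fc T φ ^ 2 = ∑ p ∈ T ×ˢ T, ch φ (p.1 + p.2) := by
        rw [sq, fc, sum_mul_sum, sum_product]; simp only [ch_add]
      rw [this, Finset.sum_pow' (T ×ˢ T) (fun p => ch φ (p.1+p.2)) k]
      refine sum_congr rfl fun t _ => ?_
      simp only [y]; rw [ch_sum]
    have e2 : N * H v = ∑ t ∈ Q, ∑ b ∈ A2, ∑ a ∈ A1, ∑ φ, fc S φ * ch φ (a + b + y t + v) := by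
      simp only [H, mul_sum]
      refine sum_congr rfl fun t _ => sum_congr rfl fun b _ => sum_congr rfl fun a _ => ?_
      exact ind_fourier S _
    rw [e2]
    have e3 : ∀ φ : Module.Dual (ZMod 2) G, fc S φ * fc A1 φ * fc A2 φ * (fc T φ^2)^k * ch φ v =
       ∑ t ∈ Q, ∑ b ∈ A2, ∑ a ∈ A1, fc S φ * ch φ (a + b + y t + v) := by
      intro φ
      rw [e1]
      simp only [ch_add]
      rw [fc, fc, fc]
      simp only [← mul_sum, ← sum_mul]
      ring
    simp only [e3]
    symm
    rw [sum_comm]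
    refine (sum_congr rfl fun t _ => ?_)
    rw [sum_comm]
    refine (sum_congr rfl fun b _ => ?_)
    rw [sum_comm]
  have hHv : ∀ v ∈ V, (1 - 4*η) * (#A1 * #A2 * (#T^2)^k) ≤ H v := by
    intro v hv
    have h3 : N * H 0 - N * H v ≤ N * (#T^2/4)^k * (2 * N^2) := by
      rw [hHf, hHf, ← sum_sub_distrib]
      have : ∀ φ : Module.Dual (ZMod 2) G, fc S φ * fc A1 φ * fc A2 φ * (fc T φ^2)^k * ch φ 0 -
          fc S φ * fc A1 φ * fc A2 φ * (fc T φ^2)^k * ch φ v ≤ N * (#T^2/4)^k * (fc A1 φ ^2 + fc A2 φ^2) := by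
        intro φ
        rw [ch_zero, ← mul_sub]
        by_cases hc : (#T:ℝ)/2 ≤ |fc T φ|
        · rw [hV2 φ hc v hv]; simp; positivity
        · have g1 : fc T φ ^ 2 ≤ #T^2/4 := by
            rw [← sq_abs, show (#T:ℝ)^2/4 = (#T/2)^2 by ring]
            exact pow_le_pow_left₀ (abs_nonneg _) (not_le.1 hc).le 2
          have g2 : |1 - ch φ v| ≤ 2 := by
            have := ch_abs φ v
            have h4 := abs_sub 1 (ch φ v)
            rw [abs_one, this] at h4; linarith
          have g3 : |fc A1 φ| * |fc A2 φ| * 2 ≤ fc A1 φ ^2 + fc A2 φ^2 := by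
            have := sq_nonneg (|fc A1 φ| - |fc A2 φ|)
            rw [← sq_abs (fc A1 φ), ← sq_abs (fc A2 φ)]; nlinarith
          refine (le_abs_self _).trans ?_
          rw [abs_mul, abs_mul, abs_mul, abs_mul, abs_pow, abs_pow, sq_abs]
          calc |fc S φ| * |fc A1 φ| * |fc A2 φ| * (fc T φ ^ 2) ^ k * |1 - ch φ v|
              ≤ N * |fc A1 φ| * |fc A2 φ| * (#T^2/4) ^ k * 2 := by
                gcongr
                exact (fc_abs S φ).trans hSN
            _ = N * (#T^2/4)^k * (|fc A1 φ| * |fc A2 φ| * 2) := by ring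
            _ ≤ _ := by gcongr
      refine (sum_le_sum fun φ _ => this φ).trans ?_
      rw [← mul_sum, sum_add_distrib, parseval, parseval, ← hN]
      gcongr
      nlinarith
    have h4 : H 0 - H v ≤ (#T^2/4)^k * (2 * N^2) := by
      have : N * (H 0 - H v) ≤ N * ((#T^2/4)^k * (2 * N^2)) := by linarith
      exact le_of_mul_le_mul_left this hN0
    have h5 : ((#T:ℝ)^2/4)^k * (2 * N^2) ≤ η * (#A1 * #A2 * (#T^2)^k) := by
      have g1 : N^2 ≤ #A1 * #A2 * 4^ℓ := by
        rw [sq]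
        calc N * N ≤ (#A1 * 2^ℓ) * (#A2 * 2^ℓ) := by gcongr
          _ = _ := by rw [show (4:ℝ)^ℓ = 2^ℓ * 2^ℓ by rw [← mul_pow]; norm_num]; ring
      have g2 : (2:ℝ) * 4^ℓ / 4^k ≤ η := by
        rw [hη, hk, pow_add, div_le_div_iff₀ (by positivity) (by positivity)]
        have : (2:ℝ)*2^e ≤ 4^e := by
          rw [show (4:ℝ)^e = 2^e * 2^e by rw [← mul_pow]; norm_num]
          gcongr
          calc (2:ℝ) = 2^1 := by norm_num
            _ ≤ 2^e := pow_le_pow_right₀ (by norm_num) he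
        have g : (0:ℝ) < 4^ℓ := by positivity
        nlinarith
      rw [div_pow]
      calc (#T^2:ℝ)^k / 4^k * (2 * N^2) ≤ (#T^2:ℝ)^k / 4^k * (2 * (#A1 * #A2 * 4^ℓ)) := by gcongr
        _ = (2 * 4^ℓ/4^k) * (#A1 * #A2 * (#T^2)^k) := by ring
        _ ≤ _ := by gcongr
    linarith
  -- averaging over V
  have hav : ∑ v ∈ {v : G | v ∈ V}, ((1 - 4*η) * (#A1 * #A2 * (#T^2)^k)) ≤ ∑ v ∈ {v : G | v ∈ V}, H v :=
    sum_le_sum fun v hv => hHv v (by simpa using hv)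
  have e5 : ∑ v ∈ {v : G | v ∈ V}, H v = ∑ q ∈ (Q ×ˢ A2) ×ˢ A1, (#{v : G | v ∈ V ∧ (q.2 + q.1.2 + y q.1.1) + v ∈ S} : ℝ) := by
    simp only [H]
    rw [sum_product, sum_product, sum_comm]
    refine sum_congr rfl fun t _ => ?_
    rw [sum_comm]
    refine sum_congr rfl fun b _ => ?_
    rw [sum_comm]
    refine sum_congr rfl fun a _ => ?_
    rw [← filter_filter, card_filter]
    push_cast; rfl
  have e6 : ∑ v ∈ {v : G | v ∈ V}, ((1 - 4*η) * (#A1 * #A2 * (#T^2)^k)) = ∑ q ∈ (Q ×ˢ A2) ×ˢ A1, (1 - 4*η) * cd V := by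
    rw [sum_const, sum_const, card_product, card_product, nsmul_eq_mul, nsmul_eq_mul]
    push_cast
    rw [hQc, cd]; ring
  rw [e5, e6] at hav
  have hne : ((Q ×ˢ A2) ×ˢ A1).Nonempty := by
    rw [← card_pos, card_product, card_product]
    have : (0:ℝ) < #Q := by rw [hQc]; positivity
    have g1 : 0 < #Q := by exact_mod_cast this
    have g2 : 0 < #A1 := by exact_mod_cast hA1
    have g3 : 0 < #A2 := by exact_mod_cast hA2
    positivity
  obtain ⟨q, _, hq⟩ := exists_le_of_sum_le hne hav
  refine ⟨V, _, hV1, le_trans (le_of_eq ?_) hq⟩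
  rw [hη]; ring

end CF

namespace CF
open Finset
open scoped Classical
set_option linter.unusedSectionVars false

variable {G : Type} [AddCommGroup G] [Module (ZMod 2) G] [Fintype G]

/-- Y has no large density increment on cosets of codimension at most d -/
def spr (d : ℕ) (ε : ℝ) (Y : Finset G) : Prop :=
  ∀ (V : Submodule (ZMod 2) G) (a : G), Fintype.card G ≤ cd V * 2 ^ d →
    (#{y ∈ Y | a + y ∈ V} : ℝ) * Fintype.card G ≤ (1 + ε) * (#Y * cd V)

/-- number of representations -/
noncomputable def rr (Y Z : Finset G) (x : G) : ℝ := ∑ y ∈ Y, ∑ z ∈ Z, if y + z = x then (1:ℝ) else 0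

theorem add_eq_iff (x y z : G) : x + y = z ↔ y = x + z := by
  constructor
  · rintro rfl; rw [← add_assoc, ZModModule.add_self, zero_add]
  · rintro rfl; rw [← add_assoc, ZModModule.add_self, zero_add]

theorem rr_nonneg (Y Z : Finset G) (x : G) : 0 ≤ rr Y Z x :=
  sum_nonneg fun _ _ => sum_nonneg fun _ _ => by split_ifs <;> norm_num

theorem rr_eq (Y Z : Finset G) (x : G) : rr Y Z x = #{y ∈ Y | y + x ∈ Z} := by
  unfold rr
  rw [card_filter]; push_cast
  refine sum_congr rfl fun y _ => ?_
  simp only [add_eq_iff]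
  rw [sum_ite_eq']

theorem rr_count (Y Z : Finset G) (a b : G) : (#{u : G | a + u ∈ Y ∧ b + u ∈ Z} : ℝ) = rr Y Z (a+b) := by
  rw [rr_eq]
  norm_cast
  apply card_bij (fun u _ => a + u)
  · intro u hu
    simp only [mem_filter, mem_univ, true_and] at hu ⊢
    refine ⟨hu.1, ?_⟩
    rw [show a + u + (a + b) = b + u + (a + a) by abel, ZModModule.add_self, add_zero]
    exact hu.2
  · intro x _ y _ h; exact add_left_cancel h
  · intro y hy
    simp only [mem_filter, mem_univ, true_and] at hy
    refine ⟨a + y, ?_, ?_⟩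
    · simp only [mem_filter, mem_univ, true_and]
      rw [← add_assoc, ZModModule.add_self, zero_add]
      refine ⟨hy.1, ?_⟩
      rw [show b + (a + y) = y + (a + b) by abel]; exact hy.2
    · rw [← add_assoc, ZModModule.add_self, zero_add]

theorem sift (Y Z : Finset G) (s : ℕ) (φ : G → ℝ) :
    ∑ u : Fin s → G, ∑ a ∈ {a : G | ∀ i, a + u i ∈ Y}, ∑ b ∈ {b : G | ∀ i, b + u i ∈ Z}, φ (a + b)
      = Fintype.card G * ∑ x : G, φ x * rr Y Z x ^ s := by
  have h1 : ∀ u : Fin s → G, ∑ a ∈ {a : G | ∀ i, a + u i ∈ Y}, ∑ b ∈ {b : G | ∀ i, b + u i ∈ Z}, φ (a + b)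
     = ∑ a : G, ∑ b : G, φ (a+b) * ∏ i, (if a + u i ∈ Y ∧ b + u i ∈ Z then (1:ℝ) else 0) := by
    intro u
    rw [sum_filter]
    refine sum_congr rfl fun a _ => ?_
    rw [sum_filter, ite_sum_zero]
    refine sum_congr rfl fun b _ => ?_
    rw [prod_boole]
    simp only [mem_univ, true_implies, forall_and]
    by_cases h1 : ∀ i, a + u i ∈ Y <;> by_cases h2 : ∀ i, b + u i ∈ Z <;> simp [h1, h2]
  simp only [h1]
  rw [sum_comm]
  have h2 : ∀ a b : G, ∑ u : Fin s → G, φ (a+b) * ∏ i, (if a + u i ∈ Y ∧ b + u i ∈ Z then (1:ℝ) else 0)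
      = φ (a+b) * rr Y Z (a+b) ^ s := by
    intro a b
    rw [← mul_sum, ← rr_count, card_filter]
    push_cast
    rw [Fintype.sum_pow]
  have h3 : ∀ a : G, ∑ u : Fin s → G, ∑ b : G, φ (a+b) * ∏ i, (if a + u i ∈ Y ∧ b + u i ∈ Z then (1:ℝ) else 0)
     = ∑ x : G, φ x * rr Y Z x ^ s := by
    intro a
    rw [sum_comm]
    simp only [h2]
    exact Equiv.sum_comp (Equiv.addLeft a) (fun x => φ x * rr Y Z x ^ s)
  simp only [h3]
  simp

theorem sum_rr_coset (Y Z : Finset G) (V : Submodule (ZMod 2) G) (y0 : G) :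
    ∑ v ∈ {v : G | v ∈ V}, rr Y Z (y0 + v) = ∑ z ∈ Z, (#{y ∈ Y | (y0 + z) + y ∈ V} : ℝ) := by
  unfold rr
  rw [sum_comm]
  have : ∀ z ∈ Z, (#{y ∈ Y | (y0 + z) + y ∈ V} : ℝ) = ∑ y ∈ Y, if (y0 + z) + y ∈ V then (1:ℝ) else 0 := by
    intro z _; rw [card_filter]; push_cast; rfl
  rw [sum_congr rfl this, sum_comm]
  rw [sum_comm (s := Z)]
  rw [sum_comm]
  refine sum_congr rfl fun y _ => ?_
  rw [sum_comm]
  refine sum_congr rfl fun z _ => ?_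
  have : ∀ v : G, (y + z = y0 + v) ↔ v = y0 + z + y := by
    intro v
    rw [eq_comm, add_eq_iff, show y0 + (y + z) = y0 + z + y by abel]
  simp only [this]
  rw [sum_ite_eq']
  simp

set_option maxHeartbeats 1000000 in
theorem lemU (Y Z : Finset G) (d s ℓA : ℕ) (hspr : spr d (1/2^21) Y) (hs : 2^25 ≤ s)
    (hsize : 2 * (Fintype.card G : ℝ)^(2*s) ≤ (#Y * #Z : ℝ)^s * 2^ℓA) (hd : dAP ℓA 23 ≤ d) :
    ∑ x : G, rr Y Z x ^ s ≤ Fintype.card G * ((1 + 1/2^18) * (#Y * #Z / Fintype.card G))^s := by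
  set N : ℝ := ((Fintype.card G : ℕ) : ℝ) with hN
  have hN0 : 0 < N := by rw [hN]; exact_mod_cast Fintype.card_pos
  set ρ : ℝ := #Y * #Z / N with hρ
  have hs0 : s ≠ 0 := by
    have : 0 < 2^25 := by norm_num
    omega
  have hYZ : (0:ℝ) < #Y * #Z := by
    by_contra hh
    have : (#Y * #Z:ℝ) = 0 := le_antisymm (not_lt.1 hh) (by positivity)
    rw [this, zero_pow hs0, zero_mul] at hsize
    have : 0 < 2 * N^(2*s) := by positivity
    linarith
  have hρ0 : 0 < ρ := by positivity
  by_contra hcon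
  push Not at hcon
  set M := ∑ x : G, rr Y Z x ^ s with hM
  set S : Finset G := {x : G | (1 + 1/2^19) * ρ ≤ rr Y Z x} with hS
  let A1 : (Fin s → G) → Finset G := fun u => {a : G | ∀ i, a + u i ∈ Y}
  let A2 : (Fin s → G) → Finset G := fun u => {b : G | ∀ i, b + u i ∈ Z}
  let bad : (Fin s → G) → ℝ := fun u => ∑ a ∈ A1 u, ∑ b ∈ A2 u, if a + b ∈ S then 0 else 1
  have t1 : ∑ u, (#(A1 u) : ℝ) * #(A2 u) = N * M := by
    have := sift Y Z s (fun _ => 1)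
    simp only [sum_const, nsmul_eq_mul, mul_one, one_mul] at this
    exact this
  have hpow : (2:ℝ)^32 * ((1 + 1/2^19) * ρ)^s ≤ ((1 + 1/2^18) * ρ)^s := by
    have h1 : (1 + 1/2^20) * ((1 + 1/2^19) * ρ) ≤ (1 + 1/2^18) * ρ := by nlinarith
    have h2 : (2:ℝ)^32 ≤ (1 + 1/2^20)^s := by
      have b := one_add_mul_le_pow (a := (1:ℝ)/2^20) (by norm_num) (2^20)
      have b' : (2:ℝ) ≤ (1 + 1/2^20)^(2^20) := by
        refine le_trans (le_of_eq ?_) b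
        push_cast; norm_num
      calc (2:ℝ)^32 ≤ ((1 + 1/2^20)^(2^20))^32 := by gcongr
        _ = (1 + 1/2^20)^(2^25) := by rw [← pow_mul]; norm_num only
        _ ≤ _ := pow_le_pow_right₀ (by norm_num) hs
    calc _ ≤ (1 + 1/2^20)^s * ((1 + 1/2^19) * ρ)^s := by gcongr
      _ = ((1 + 1/2^20) * ((1 + 1/2^19) * ρ))^s := by rw [mul_pow (1 + 1/2^20)]
      _ ≤ _ := by gcongr
  have t2 : (∑ u, bad u) * 2^22 ≤ N * M / 2 := by
    have e := sift Y Z s (fun x => if x ∈ S then 0 else 1)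
    change ∑ u, bad u = _ at e
    rw [e]
    have : ∑ x : G, (if x ∈ S then (0:ℝ) else 1) * rr Y Z x ^ s ≤ N * ((1 + 1/2^19) * ρ)^s := by
      have : ∀ x : G, (if x ∈ S then (0:ℝ) else 1) * rr Y Z x ^ s ≤ ((1 + 1/2^19) * ρ)^s := by
        intro x
        split_ifs with hx
        · rw [zero_mul]; positivity
        · rw [one_mul]
          have : ¬ ((1 + 1/2^19) * ρ ≤ rr Y Z x) := by simpa [hS] using hx
          have h0 := rr_nonneg Y Z x
          gcongr
          exact (not_le.1 this).le
      refine (sum_le_sum fun x _ => this x).trans ?_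
      simp [hN]
    rw [← hN]
    have h3 : N * ((1 + 1/2^19) * ρ)^s * 2^23 ≤ M := by
      refine le_trans ?_ hcon.le
      have : 0 ≤ N * ((1 + 1/2^19) * ρ)^s := by positivity
      calc N * ((1 + 1/2^19) * ρ)^s * 2^23 ≤ N * ((1 + 1/2^19) * ρ)^s * 2^32 := by gcongr <;> norm_num
        _ = N * (2^32 * ((1 + 1/2^19) * ρ)^s) := by ring
        _ ≤ _ := by gcongr
    have h4 := mul_le_mul_of_nonneg_left this hN0.le
    have h5 := mul_le_mul_of_nonneg_left h3 hN0.le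
    linarith
  have t3 : N^2 * ρ^s < N * M := by
    have : N * ρ^s < M := by
      refine lt_of_le_of_lt ?_ hcon
      gcongr
      nlinarith
    rw [sq, mul_assoc]
    exact mul_lt_mul_of_pos_left this hN0
  have : ∃ u, bad u * 2^22 + N^2 * ρ^s / N^s / 2 ≤ #(A1 u) * #(A2 u) := by
    by_contra hno
    push Not at hno
    have h1 : ∑ u, (#(A1 u) : ℝ) * #(A2 u) < ∑ u, (bad u * 2^22 + N^2 * ρ^s / N^s / 2) :=
      sum_lt_sum_of_nonempty ⟨fun _ => 0, mem_univ _⟩ (fun u _ => hno u)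
    rw [t1, sum_add_distrib, ← sum_mul] at h1
    have h2 : ∑ u : Fin s → G, N^2 * ρ^s / N^s / 2 = N^2 * ρ^s/2 := by
      simp only [sum_const, nsmul_eq_mul, card_univ]
      rw [Fintype.card_fun, Fintype.card_fin]
      push_cast
      rw [← hN]; field_simp
    rw [h2] at h1
    linarith
  obtain ⟨u, hu⟩ := this
  have hbad0 : 0 ≤ bad u := sum_nonneg fun _ _ => sum_nonneg fun _ _ => by split_ifs <;> norm_num
  have hA12 : N^2 ≤ #(A1 u) * #(A2 u) * 2^ℓA := by
    have h1 : N^2 * ρ^s / N^s / 2 ≤ #(A1 u) * #(A2 u) := by linarith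
    have h2 : N^2 ≤ N^2 * ρ^s / N^s / 2 * 2^ℓA := by
      rw [hρ, div_pow, div_div, ← mul_div_assoc]
      rw [show N ^ 2 * (↑(#Y) * ↑(#Z)) ^ s / N ^ s / (N ^ s * 2) * 2 ^ ℓA = N^2 * ((↑(#Y) * ↑(#Z)) ^ s * 2 ^ ℓA) / (2 * N^(2*s)) by rw [two_mul s, pow_add]; field_simp]
      rw [le_div_iff₀ (by positivity)]
      gcongr
    calc N^2 ≤ _ := h2
      _ ≤ _ := by gcongr
  have hle1 : (#(A1 u) : ℝ) ≤ N := by rw [hN]; exact_mod_cast card_le_univ _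
  have hle2 : (#(A2 u) : ℝ) ≤ N := by rw [hN]; exact_mod_cast card_le_univ _
  have hp : (0:ℝ) < 2^ℓA := by positivity
  have hA1 : N ≤ #(A1 u) * 2^ℓA := by
    have : N * N ≤ (#(A1 u) * 2^ℓA) * N := by
      calc N * N = N^2 := by ring
        _ ≤ #(A1 u) * #(A2 u) * 2^ℓA := hA12
        _ ≤ #(A1 u) * N * 2^ℓA := by gcongr
        _ = _ := by ring
    exact le_of_mul_le_mul_right this hN0
  have hA2 : N ≤ #(A2 u) * 2^ℓA := by
    have : N * N ≤ (#(A2 u) * 2^ℓA) * N := by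
      calc N * N = N^2 := by ring
        _ ≤ #(A1 u) * #(A2 u) * 2^ℓA := hA12
        _ ≤ N * #(A2 u) * 2^ℓA := by gcongr
        _ = _ := by ring
    exact le_of_mul_le_mul_right this hN0
  have hbadc : (#{p ∈ A1 u ×ˢ A2 u | p.1 + p.2 ∉ S} : ℝ) = bad u := by
    rw [card_filter, sum_product]
    push_cast
    refine sum_congr rfl fun a _ => sum_congr rfl fun b _ => ?_
    by_cases h : a + b ∈ S <;> simp [h]
  have hq : 0 ≤ N^2 * ρ^s / N^s / 2 := by positivity
  obtain ⟨V, y, hV, hVS⟩ := ap (A1 u) (A2 u) S ℓA 23 (by norm_num) hA1 hA2 (by rw [hbadc]; linarith)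
  have hcd : (0:ℝ) < cd V := by exact_mod_cast cd_pos V
  have low : (1 + 1/2^20) * ρ * cd V ≤ ∑ v ∈ {v : G | v ∈ V}, rr Y Z (y + v) := by
    calc (1 + 1/2^20) * ρ * cd V ≤ (1 - 4/2^23) * cd V * ((1 + 1/2^19) * ρ) := by
          have : 0 < ρ * cd V := by positivity
          nlinarith
      _ ≤ #{v : G | v ∈ V ∧ y + v ∈ S} * ((1 + 1/2^19) * ρ) := by gcongr
      _ = ∑ v ∈ {v : G | v ∈ V ∧ y + v ∈ S}, ((1 + 1/2^19) * ρ) := by simp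
      _ ≤ ∑ v ∈ {v : G | v ∈ V ∧ y + v ∈ S}, rr Y Z (y + v) := by
          apply sum_le_sum
          intro v hv
          have := (mem_filter.1 hv).2.2
          simpa [hS] using this
      _ ≤ _ := by
          apply sum_le_sum_of_subset_of_nonneg
          · intro v hv; simp only [mem_filter, mem_univ, true_and] at hv ⊢; exact hv.1
          · intro _ _ _; exact rr_nonneg _ _ _
  have hVd : Fintype.card G ≤ cd V * 2^d := hV.trans (Nat.mul_le_mul_left _ (Nat.pow_le_pow_right (by norm_num) hd))
  have up : (∑ v ∈ {v : G | v ∈ V}, rr Y Z (y + v)) * N ≤ #Z * ((1 + 1/2^21) * (#Y * cd V)) := by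
    rw [sum_rr_coset, sum_mul]
    refine (sum_le_sum fun z _ => hspr V (y + z) hVd).trans ?_
    simp
  have e9 : ρ * N = #Y * #Z := by rw [hρ]; field_simp
  have h10 : (1 + 1/2^20) * ((#Y * #Z) * cd V) ≤ (1 + 1/2^21) * ((#Y * #Z : ℝ) * cd V) := by
    calc _ = (1 + 1/2^20) * ρ * cd V * N := by rw [← e9]; ring
      _ ≤ _ := mul_le_mul_of_nonneg_right low hN0.le
      _ ≤ _ := up
      _ = _ := by ring
  have : (0:ℝ) < (#Y * #Z : ℝ) * cd V := by positivity
  nlinarith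

end CF

namespace CF
open Finset
open scoped Classical
set_option linter.unusedSectionVars false
set_option linter.unusedSimpArgs false

theorem sum_pi_succ {α : Type*} (X : Finset α) (j : ℕ) (f : (Fin (j+1) → α) → ℝ) :
    ∑ x ∈ Fintype.piFinset (fun _ : Fin (j+1) => X), f x =
      ∑ a ∈ X, ∑ x ∈ Fintype.piFinset (fun _ : Fin j => X), f (Fin.cons a x) := by
  rw [← sum_product']
  symm
  apply sum_bij (fun (q : α × (Fin j → α)) _ => (Fin.cons q.1 q.2 : Fin (j+1) → α))
  · intro q hq
    rw [mem_product] at hq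
    rw [Fintype.mem_piFinset]
    intro i
    refine Fin.cases ?_ (fun i => ?_) i
    · simpa using hq.1
    · simpa using Fintype.mem_piFinset.1 hq.2 i
  · intro q _ q' _ h
    have := Fin.cons_injective2 h
    exact Prod.ext this.1 this.2
  · intro x hx
    refine ⟨(x 0, Fin.tail x), ?_, ?_⟩
    · rw [mem_product]
      refine ⟨Fintype.mem_piFinset.1 hx 0, ?_⟩
      rw [Fintype.mem_piFinset]; intro i; exact Fintype.mem_piFinset.1 hx i.succ
    · exact Fin.cons_self_tail x
  · intro q _; rfl

section moments

theorem oddmom {ι : Type*} (I : Finset ι) (u : ι → ℝ) (c : ℝ) (hc : 0 < c) (p : ℕ) (hp : Even p) (hp2 : 2 ≤ p)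
    (h1 : c^p * #I ≤ ∑ i ∈ I, u i ^ p) (h2 : 0 ≤ ∑ i ∈ I, u i ^ (p+1)) :
    c^(p+1)/4 * #I ≤ ∑ i ∈ I with c/2 ≤ u i, u i ^ (p+1) := by
  have key : ∀ x : ℝ, c * x^p - c^(p+1)/2 + x^(p+1) ≤ 2 * (if c/2 ≤ x then x^(p+1) else 0) := by
    intro x
    have g1 : ∀ t : ℝ, 0 ≤ t → c * t^p - c^(p+1)/4 ≤ t^(p+1) := by
      intro t ht
      rcases le_total c t with h | h
      · have : c * t^p ≤ t^(p+1) := by rw [pow_succ, mul_comm]; gcongr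
        have : 0 < c^(p+1) := by positivity
        linarith
      · have h3 : t^(p-1) ≤ c^(p-1) := by gcongr
        have e1 : t^p = t^(p-1) * t := by rw [← pow_succ]; congr 1; omega
        have e2 : c^p = c^(p-1) * c := by rw [← pow_succ]; congr 1; omega
        rw [pow_succ, pow_succ, e1, e2]
        have h4 : t * (c - t) ≤ c*c/4 := by nlinarith [sq_nonneg (c - 2*t)]
        have h5 : 0 ≤ t * (c-t) := mul_nonneg ht (by linarith)
        have h6 : t^(p-1) * (t * (c-t)) ≤ c^(p-1) * (c*c/4) := by gcongr
        linarith
    have hx : x^p = |x|^p := by rw [hp.pow_abs]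
    have g2 := g1 |x| (abs_nonneg x)
    rw [← hx] at g2
    have hodd : Odd (p+1) := hp.add_one
    have hsm : (c/2)^(p+1) ≤ c^(p+1)/8 := by
      rw [div_pow]
      gcongr
      calc (8:ℝ) = 2^3 := by norm_num
        _ ≤ 2^(p+1) := pow_le_pow_right₀ (by norm_num) (by omega)
    have hcp : 0 < c^(p+1) := by positivity
    split_ifs with h
    · have : |x| = x := abs_of_nonneg (by linarith)
      rw [this] at g2; linarith
    · rcases le_total 0 x with h0 | h0
      · rw [abs_of_nonneg h0] at g2
        have : x^(p+1) ≤ (c/2)^(p+1) := by gcongr; linarith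
        linarith
      · rw [abs_of_nonpos h0, hodd.neg_pow] at g2
        linarith
  have := sum_le_sum fun i (_ : i ∈ I) => key (u i)
  rw [sum_add_distrib, sum_sub_distrib, ← mul_sum, ← mul_sum, ← sum_filter] at this
  simp only [sum_const, nsmul_eq_mul] at this
  have h3 := mul_le_mul_of_nonneg_left h1 hc.le
  have : c * (c^p * #I) = c^(p+1) * #I := by rw [pow_succ]; ring
  linarith

variable {α β ζ : Type*}

theorem gram (X : Finset α) (Z : Finset ζ) (g : α → ζ → ℝ) (p : ℕ) :
    ∑ x ∈ X, ∑ x' ∈ X, (∑ z ∈ Z, g x z * g x' z)^p =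
      ∑ z ∈ Fintype.piFinset (fun _ : Fin p => Z), (∑ x ∈ X, ∏ i, g x (z i))^2 := by
  have : ∀ x x', (∑ z ∈ Z, g x z * g x' z)^p = ∑ z ∈ Fintype.piFinset (fun _ : Fin p => Z), (∏ i, g x (z i)) * (∏ i, g x' (z i)) := by
    intro x x'
    rw [Finset.sum_pow' Z (fun z => g x z * g x' z) p]
    simp only [prod_mul_distrib]
  simp only [this]
  have e : ∀ x ∈ X, ∑ x' ∈ X, ∑ z ∈ Fintype.piFinset (fun _ : Fin p => Z), (∏ i, g x (z i)) * (∏ i, g x' (z i)) =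
     ∑ z ∈ Fintype.piFinset (fun _ : Fin p => Z), (∏ i, g x (z i)) * ∑ x' ∈ X, (∏ i, g x' (z i)) := by
    intro x _
    rw [sum_comm]; simp only [mul_sum]
  rw [sum_congr rfl e, sum_comm]
  refine sum_congr rfl fun z _ => ?_
  rw [← sum_mul, sq]

theorem gram_nonneg (X : Finset α) (Z : Finset ζ) (g : α → ζ → ℝ) (p : ℕ) :
    0 ≤ ∑ x ∈ X, ∑ x' ∈ X, (∑ z ∈ Z, g x z * g x' z)^p := by
  rw [gram]; exact sum_nonneg fun _ _ => sq_nonneg _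

theorem gram_cs (X : Finset α) (Y : Finset β) (Z : Finset ζ) (g : α → ζ → ℝ) (g' : β → ζ → ℝ) (p : ℕ) :
    (∑ x ∈ X, ∑ y ∈ Y, (∑ z ∈ Z, g x z * g' y z)^p)^2 ≤
     (∑ x ∈ X, ∑ x' ∈ X, (∑ z ∈ Z, g x z * g x' z)^p) * (∑ y ∈ Y, ∑ y' ∈ Y, (∑ z ∈ Z, g' y z * g' y' z)^p) := by
  rw [gram, gram]
  have : ∀ x y, (∑ z ∈ Z, g x z * g' y z)^p = ∑ z ∈ Fintype.piFinset (fun _ : Fin p => Z), (∏ i, g x (z i)) * (∏ i, g' y (z i)) := by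
    intro x x'
    rw [Finset.sum_pow' Z (fun z => g x z * g' x' z) p]
    simp only [prod_mul_distrib]
  simp only [this]
  have e : ∀ x ∈ X, ∑ y ∈ Y, ∑ z ∈ Fintype.piFinset (fun _ : Fin p => Z), (∏ i, g x (z i)) * (∏ i, g' y (z i)) =
     ∑ z ∈ Fintype.piFinset (fun _ : Fin p => Z), (∏ i, g x (z i)) * ∑ y ∈ Y, (∏ i, g' y (z i)) := by
    intro x _
    rw [sum_comm]; simp only [mul_sum]
  rw [sum_congr rfl e, sum_comm]
  simp only [← sum_mul]
  exact sum_mul_sq_le_sq_mul_sq _ _ _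

end moments

variable {G : Type} [AddCommGroup G] [Module (ZMod 2) G] [Fintype G]

/-- the conclusion of lemU -/
def Ubd (s : ℕ) (Y Z : Finset G) : Prop :=
  ∑ x : G, rr Y Z x ^ s ≤ Fintype.card G * ((1 + 1/2^18) * (#Y * #Z / Fintype.card G))^s

theorem rr_count' (Y Z : Finset G) (x : G) : (#{z ∈ Z | x + z ∈ Y} : ℝ) = rr Y Z x := by
  have := rr_count Y Z x 0
  rw [add_zero] at this
  rw [← this]
  norm_cast
  congr 1; ext u; simp; tauto

theorem hostgrid0 (X Y : Finset G) (s ℓ : ℕ) (m0 : ℝ) (hm0 : 0 ≤ m0) (hX : (Fintype.card G : ℝ) ≤ #X * 2^ℓ)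
    (hs : ℓ ≤ s) (hs1 : 1 ≤ s) (hU : ∀ Z' : Finset G, m0 ≤ #Z' → Ubd s Y Z') (j : ℕ) :
    ∀ Z' : Finset G, ∑ x ∈ Fintype.piFinset (fun _ : Fin j => X), (#{z ∈ Z' | ∀ i, x i + z ∈ Y} : ℝ)^s ≤
      #X^j * (5^j * max ((#Y / Fintype.card G : ℝ)^j * #Z') m0)^s := by
  set N : ℝ := ((Fintype.card G : ℕ) : ℝ) with hN
  have hN0 : 0 < N := by rw [hN]; exact_mod_cast Fintype.card_pos
  set β : ℝ := #Y / N with hβ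
  have hβ0 : 0 ≤ β := by positivity
  have hβ1 : β ≤ 1 := by rw [hβ, div_le_one hN0, hN]; exact_mod_cast card_le_univ _
  induction j with
  | zero =>
    intro Z'
    simp
    gcongr
    exact le_max_left _ _
  | succ j ih =>
    intro Z'
    rw [sum_pi_succ]
    have e1 : ∀ a : G, ∀ x : Fin j → G, {z ∈ Z' | ∀ i, (Fin.cons a x : Fin (j+1) → G) i + z ∈ Y} = {z ∈ {z ∈ Z' | a + z ∈ Y} | ∀ i, x i + z ∈ Y} := by
      intro a x; ext z; simp [Fin.forall_fin_succ]; tauto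
    simp only [e1]
    have h1 : ∀ a ∈ X, ∑ x ∈ Fintype.piFinset (fun _ : Fin j => X), (#{z ∈ {z ∈ Z' | a + z ∈ Y} | ∀ i, x i + z ∈ Y} : ℝ)^s ≤
        #X^j * (5^j)^s * (max (β^j * rr Y Z' a) m0)^s := by
      intro a _
      refine (ih _).trans (le_of_eq ?_)
      rw [rr_count', mul_pow, mul_assoc]
    refine (sum_le_sum h1).trans ?_
    rw [← mul_sum]
    set Mx := max (β^(j+1) * #Z') m0 with hMx
    have hMx0 : 0 ≤ Mx := hm0.trans (le_max_right _ _)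
    have h2 : ∑ a ∈ X, (max (β^j * rr Y Z' a) m0)^s ≤ #X * (5 * Mx)^s := by
      by_cases hc : m0 ≤ #Z'
      · have hu := hU Z' hc
        unfold Ubd at hu
        have h3 : ∑ a ∈ X, (β^j * rr Y Z' a)^s ≤ #X * (4 * Mx)^s := by
          calc _ ≤ ∑ a : G, (β^j * rr Y Z' a)^s :=
                sum_le_sum_of_subset_of_nonneg (subset_univ _) (fun a _ _ => pow_nonneg (mul_nonneg (by positivity) (rr_nonneg _ _ _)) _)
            _ = (β^j)^s * ∑ a : G, rr Y Z' a^s := by rw [mul_sum]; simp only [mul_pow]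
            _ ≤ (β^j)^s * (N * ((1 + 1/2^18) * (#Y * #Z' / N))^s) := by gcongr
            _ ≤ (β^j)^s * ((#X * 2^s) * (2 * (#Y * #Z' / N))^s) := by
                gcongr
                · refine hX.trans ?_
                  gcongr; norm_num
                · norm_num
            _ = #X * (4 * (β^(j+1) * #Z'))^s := by
                rw [show (#Y * #Z' / N : ℝ) = β * #Z' by rw [hβ]; ring, pow_succ]
                simp only [mul_pow]
                rw [show (4:ℝ)^s = 2^s * 2^s by rw [← mul_pow]; norm_num]; ring
            _ ≤ _ := by gcongr; exact le_max_left _ _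
        have h4 : ∑ a ∈ X, (max (β^j * rr Y Z' a) m0)^s ≤ ∑ a ∈ X, ((β^j * rr Y Z' a)^s + Mx^s) := by
          apply sum_le_sum
          intro a _
          have g0 : 0 ≤ β^j * rr Y Z' a := mul_nonneg (by positivity) (rr_nonneg _ _ _)
          rcases max_cases (β^j * rr Y Z' a) m0 with h | h
          · rw [h.1]; have : 0 ≤ Mx^s := by positivity
            linarith
          · rw [h.1]
            have : m0^s ≤ Mx^s := by gcongr; exact le_max_right _ _
            have : 0 ≤ (β^j * rr Y Z' a)^s := by positivity
            linarith
        refine h4.trans ?_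
        rw [sum_add_distrib, sum_const, nsmul_eq_mul]
        have h5 : (4:ℝ)^s + 1 ≤ 5^s := by
          have h6 : ∀ s : ℕ, (4:ℝ)^(s+1) + 1 ≤ 5^(s+1) := by
            intro s
            induction s with
            | zero => norm_num
            | succ s ih =>
              rw [pow_succ 4, pow_succ 5]
              have : (0:ℝ) < 4^(s+1) := by positivity
              nlinarith
          have := h6 (s-1)
          rwa [show s - 1 + 1 = s by omega] at this
        have h7 : (#X:ℝ) * Mx^s * (4^s + 1) ≤ #X * Mx^s * 5^s := by gcongr
        rw [mul_pow] at h3 ⊢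
        linarith
      · have hMm : Mx = m0 := by
          rw [hMx]; apply max_eq_right
          have g1 : β^(j+1) ≤ 1 := pow_le_one₀ hβ0 hβ1
          have : β^(j+1) * #Z' ≤ 1 * #Z' := by gcongr
          linarith
        have : ∀ a ∈ X, (max (β^j * rr Y Z' a) m0)^s ≤ (5 * Mx)^s := by
          intro a _
          have g1 : β^j ≤ 1 := pow_le_one₀ hβ0 hβ1
          have g2 : rr Y Z' a ≤ #Z' := by
            rw [← rr_count']; exact_mod_cast card_filter_le _ _
          have g9 := rr_nonneg Y Z' a
          have g3 : β^j * rr Y Z' a ≤ 1 * #Z' := by gcongr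
          have : max (β^j * rr Y Z' a) m0 ≤ 5 * Mx := by
            apply max_le <;> linarith
          have g0 : 0 ≤ max (β^j * rr Y Z' a) m0 := hm0.trans (le_max_right _ _)
          gcongr
        refine (sum_le_sum this).trans ?_
        simp
    calc _ ≤ #X^j * (5^j)^s * (#X * (5 * Mx)^s) := by gcongr
      _ = _ := by simp only [mul_pow, pow_succ]; ring

/-- normalised host weight -/
noncomputable def nu (Y : Finset G) (x z : G) : ℝ := if x + z ∈ Y then (Fintype.card G : ℝ) / #Y else 0

theorem hostgrid (X Y Z : Finset G) (s ℓ R : ℕ) (hX : (Fintype.card G : ℝ) ≤ #X * 2^ℓ) (hY : Y.Nonempty)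
    (hs : ℓ ≤ s) (hs1 : 1 ≤ s) (hU : ∀ Z' : Finset G, (#Y / Fintype.card G : ℝ)^R * #Z ≤ #Z' → Ubd s Y Z') (j : ℕ)
    (hj : j ≤ R) :
    ∑ x ∈ Fintype.piFinset (fun _ : Fin j => X), (∑ z ∈ Z, ∏ i, nu Y (x i) z)^s ≤
      #X^j * (5^j * #Z)^s := by
  set N : ℝ := ((Fintype.card G : ℕ) : ℝ) with hN
  have hN0 : 0 < N := by rw [hN]; exact_mod_cast Fintype.card_pos
  have hY0 : (0:ℝ) < #Y := by exact_mod_cast card_pos.2 hY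
  set β : ℝ := #Y / N with hβ
  have hβ0 : 0 < β := by positivity
  have hβ1 : β ≤ 1 := by rw [hβ, div_le_one hN0, hN]; exact_mod_cast card_le_univ _
  have h := hostgrid0 X Y s ℓ (β^R * #Z) (by positivity) hX hs hs1 hU j Z
  rw [← hN, ← hβ] at h
  rw [max_eq_left (by gcongr ?_ * _; exact pow_le_pow_of_le_one hβ0.le hβ1 hj)] at h
  have e1 : ∀ x : Fin j → G, (∑ z ∈ Z, ∏ i, nu Y (x i) z)^s = (#{z ∈ Z | ∀ i, x i + z ∈ Y} : ℝ)^s / (β^j)^s := by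
    intro x
    have : ∀ z, ∏ i, nu Y (x i) z = (if ∀ i, x i + z ∈ Y then (1:ℝ) else 0) / β^j := by
      intro z
      unfold nu
      have : ∀ i, (if x i + z ∈ Y then (Fintype.card G : ℝ)/ #Y else 0) = (if x i + z ∈ Y then (1:ℝ) else 0) * β⁻¹ := by
        intro i; split_ifs <;> simp [hβ, hN]
      simp only [this]
      rw [prod_mul_distrib, prod_boole]
      simp [div_eq_mul_inv]
    simp only [this]
    rw [← sum_div, div_pow, sum_boole]
  simp only [e1]
  rw [← sum_div, div_le_iff₀ (by positivity)]
  refine h.trans (le_of_eq ?_)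
  simp only [mul_pow]; ring

end CF

namespace CF
open Finset
open scoped Classical
set_option linter.unusedSectionVars false
set_option linter.unusedSimpArgs false

variable {G : Type} [AddCommGroup G] [Module (ZMod 2) G] [Fintype G]

/-- balanced convolution -/
noncomputable def hh (X Y : Finset G) (w : G) : ℝ := Fintype.card G * rr X Y w / (#X * #Y) - 1

noncomputable def bal (X : Finset G) (x z : G) : ℝ := (if x + z ∈ X then (Fintype.card G : ℝ) / #X else 0) - 1

theorem sum_ind_shift (X : Finset G) (x : G) (c : ℝ) : ∑ z : G, (if x + z ∈ X then c else 0) = #X * c := by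
  have := Equiv.sum_comp (Equiv.addLeft x) (fun z => if z ∈ X then c else 0)
  simp only [Equiv.coe_addLeft] at this
  have h2 : ∑ z : G, (if z ∈ X then c else 0) = #X * c := by simp
  rw [← h2]; convert this using 2 with z
  by_cases h : x + z ∈ X <;> simp [h]

theorem sum_bal (X Y : Finset G) (hX : X.Nonempty) (hY : Y.Nonempty) (x y : G) :
    ∑ z : G, bal X x z * bal Y y z = Fintype.card G * hh X Y (x+y) := by
  have hX0 : (0:ℝ) < #X := by exact_mod_cast card_pos.2 hX
  have hY0 : (0:ℝ) < #Y := by exact_mod_cast card_pos.2 hY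
  set N : ℝ := ((Fintype.card G : ℕ) : ℝ) with hN
  have hN0 : 0 < N := by rw [hN]; exact_mod_cast Fintype.card_pos
  have e : ∀ z, bal X x z * bal Y y z = (N/ #X * (N/ #Y)) * (if x + z ∈ X ∧ y + z ∈ Y then (1:ℝ) else 0)
      - (if x + z ∈ X then N / #X else 0) - (if y + z ∈ Y then N / #Y else 0) + 1 := by
    intro z; unfold bal
    by_cases h1 : x + z ∈ X <;> by_cases h2 : y + z ∈ Y <;> simp [h1, h2, ← hN] <;> ring
  simp only [e]
  rw [sum_add_distrib, sum_sub_distrib, sum_sub_distrib, ← mul_sum, sum_ind_shift, sum_ind_shift, sum_boole, rr_count]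
  simp only [sum_const, card_univ, nsmul_eq_mul, ← hN, hh]
  field_simp
  ring

theorem sum_pairs (f : G → ℝ) : ∑ x : G, ∑ y : G, f (x + y) = Fintype.card G * ∑ w : G, f w := by
  have : ∀ x : G, ∑ y : G, f (x + y) = ∑ w : G, f w := fun x => Equiv.sum_comp (Equiv.addLeft x) f
  simp only [this]; simp

theorem hh_cs (X Y : Finset G) (hX : X.Nonempty) (hY : Y.Nonempty) (p : ℕ) :
    (∑ w, hh X Y w ^ p)^2 ≤ (∑ w, hh X X w ^ p) * (∑ w, hh Y Y w ^ p) := by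
  have h := gram_cs univ univ univ (bal X) (bal Y) p
  set N : ℝ := ((Fintype.card G : ℕ) : ℝ) with hN
  have hN0 : 0 < N := by rw [hN]; exact_mod_cast Fintype.card_pos
  simp only [sum_bal _ _ hX hY, sum_bal _ _ hX hX, sum_bal _ _ hY hY] at h
  rw [sum_pairs (fun w => (N * hh X Y w)^p), sum_pairs (fun w => (N * hh X X w)^p), sum_pairs (fun w => (N * hh Y Y w)^p)] at h
  simp only [mul_pow, ← mul_sum, ← hN] at h
  have e : N^2 * ((N^p)^2 * (∑ w, hh X Y w ^ p)^2) = (N * N^p)^2 * (∑ w, hh X Y w ^ p)^2 := by ring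
  rw [e] at h
  have : (N * N^p)^2 * (∑ w, hh X Y w ^ p)^2 ≤ (N * N^p)^2 * ((∑ w, hh X X w ^ p) * (∑ w, hh Y Y w ^ p)) := by linarith
  exact le_of_mul_le_mul_left this (by positivity)

theorem hh_nonneg (X : Finset G) (hX : X.Nonempty) (p : ℕ) : 0 ≤ ∑ w, hh X X w ^ p := by
  have h := gram_nonneg univ univ (bal X) p
  set N : ℝ := ((Fintype.card G : ℕ) : ℝ) with hN
  have hN0 : 0 < N := by rw [hN]; exact_mod_cast Fintype.card_pos
  simp only [sum_bal _ _ hX hX] at h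
  rw [sum_pairs (fun w => (N * hh X X w)^p)] at h
  simp only [mul_pow, ← mul_sum, ← hN] at h
  by_contra hc
  push Not at hc
  have : N * (N^p * ∑ w, hh X X w ^ p) < 0 := by
    apply mul_neg_of_pos_of_neg hN0
    exact mul_neg_of_pos_of_neg (by positivity) hc
  linarith

theorem one_add_hh (X Y : Finset G) (hX : X.Nonempty) (hY : Y.Nonempty) (w : G) :
    rr X Y w = (1 + hh X Y w) * (#X * #Y / Fintype.card G) := by
  have hX0 : (0:ℝ) < #X := by exact_mod_cast card_pos.2 hX
  have hY0 : (0:ℝ) < #Y := by exact_mod_cast card_pos.2 hY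
  have hN0 : (0:ℝ) < Fintype.card G := by exact_mod_cast Fintype.card_pos
  unfold hh; field_simp; ring

/-- moment growth contradiction -/
theorem hh_upper (X : Finset G) (hX : X.Nonempty) (p : ℕ) (hp : Even p) (hp2 : 2 ≤ p) (hU : Ubd (2^20 * (p+1)) X X) :
    ∑ w, hh X X w ^ p < (1/2^15)^p * Fintype.card G := by
  have hX0 : (0:ℝ) < #X := by exact_mod_cast card_pos.2 hX
  set N : ℝ := ((Fintype.card G : ℕ) : ℝ) with hN
  have hN0 : 0 < N := by rw [hN]; exact_mod_cast Fintype.card_pos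
  by_contra hc
  push Not at hc
  have h1 := oddmom (univ : Finset G) (hh X X) (1/2^15) (by positivity) p hp hp2
    (by rw [card_univ, ← hN]; exact hc) (hh_nonneg X hX (p+1))
  rw [card_univ, ← hN] at h1
  unfold Ubd at hU
  simp only [one_add_hh X X hX hX, mul_pow (1 + hh X X _), mul_pow ((1:ℝ) + 1/2^18), ← hN] at hU
  rw [← sum_mul, ← mul_assoc] at hU
  have hU2 := le_of_mul_le_mul_right hU (by positivity)
  have hnn : ∀ w, 0 ≤ 1 + hh X X w := by
    intro w; unfold hh
    have := rr_nonneg X X w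
    have : 0 ≤ Fintype.card G * rr X X w / (#X * #X) := by positivity
    linarith
  have key : ∀ u : ℝ, (1/2^15)/2 ≤ u → (1 + 1/2^18)^(2^20) * (8 * 2^15 * u) ≤ (1 + u)^(2^20) := by
    intro u hu
    have hu0 : 0 < u := lt_of_lt_of_le (by positivity) hu
    have g1 : (1 + 1/2^18) * (1 + u/4) ≤ 1 + u := by nlinarith
    have g2 : 8 * 2^15 * u ≤ (1 + u/4)^(2^20) := by
      have := one_add_mul_le_pow (a := u/4) (by linarith) (2^20)
      refine le_trans ?_ this
      push_cast
      nlinarith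
    calc _ ≤ (1 + 1/2^18)^(2^20) * (1 + u/4)^(2^20) := by gcongr
      _ = ((1 + 1/2^18) * (1 + u/4))^(2^20) := by rw [mul_pow]
      _ ≤ _ := by gcongr
  have h2 : ((1 + 1/2^18 : ℝ)^(2^20) * (8 * 2^15))^(p+1) * ∑ w with (1/2^15)/2 ≤ hh X X w, hh X X w ^ (p+1)
      ≤ ∑ w, (1 + hh X X w)^(2^20 * (p+1)) := by
    rw [mul_sum]
    calc _ ≤ ∑ w with (1/2^15)/2 ≤ hh X X w, (1 + hh X X w)^(2^20 * (p+1)) := by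
          apply sum_le_sum
          intro w hw
          have hw' := (mem_filter.1 hw).2
          have h0 : 0 < hh X X w := lt_of_lt_of_le (by positivity) hw'
          have := key _ hw'
          rw [pow_mul, ← mul_pow, mul_assoc]
          gcongr
      _ ≤ _ := sum_le_sum_of_subset_of_nonneg (filter_subset _ _) (fun w _ _ => pow_nonneg (hnn w) _)
  have h3 : ((1 + 1/2^18 : ℝ)^(2^20) * (8 * 2^15))^(p+1) * ((1/2^15)^(p+1)/4 * N) ≤ N * (1 + 1/2^18)^(2^20 * (p+1)) := by
    refine le_trans ?_ (h2.trans hU2)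
    gcongr
  rw [mul_pow, ← pow_mul, mul_pow] at h3
  have e : (1 + 1/2^18 : ℝ)^(2^20 * (p+1)) * (8^(p+1) * (2^15)^(p+1)) * ((1/2^15)^(p+1)/4 * N)
     = (N * (1 + 1/2^18 : ℝ)^(2^20 * (p+1))) * (8^(p+1)/4) := by
    rw [div_pow, one_pow]; field_simp
  rw [e] at h3
  have h4 : (0:ℝ) < N * (1 + 1/2^18 : ℝ)^(2^20 * (p+1)) := by positivity
  have h5 : (8:ℝ)^(p+1)/4 ≤ 1 := by
    by_contra hh5
    push Not at hh5
    nlinarith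
  have h6 : (8:ℝ)^1 ≤ 8^(p+1) := pow_le_pow_right₀ (by norm_num) (by omega)
  linarith

theorem lemLw (X Y Z : Finset G) (hX : X.Nonempty) (hY : Y.Nonempty) (p : ℕ) (hp : Even p) (hp2 : 2 ≤ p)
    (hZ : (Fintype.card G : ℝ) ≤ #Z * 2^p) (hUX : Ubd (2^20 * (p+1)) X X) (hUY : Ubd (2^20 * (p+1)) Y Y) :
    (1 - 1/2^14) * (#X * #Y * #Z / Fintype.card G : ℝ) ≤ ∑ z ∈ Z, rr X Y z := by
  have hX0 : (0:ℝ) < #X := by exact_mod_cast card_pos.2 hX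
  have hY0 : (0:ℝ) < #Y := by exact_mod_cast card_pos.2 hY
  have u1 := hh_upper X hX p hp hp2 hUX
  have u2 := hh_upper Y hY p hp hp2 hUY
  have cs := hh_cs X Y hX hY p
  set N : ℝ := ((Fintype.card G : ℕ) : ℝ) with hN
  have hN0 : 0 < N := by rw [hN]; exact_mod_cast Fintype.card_pos
  by_contra hc
  push Not at hc
  have e1 : ∑ z ∈ Z, rr X Y z = (#Z + ∑ z ∈ Z, hh X Y z) * (#X * #Y / N) := by
    simp only [one_add_hh X Y hX hY]
    rw [← sum_mul, sum_add_distrib]; simp [← hN]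
  rw [e1, show (1 - 1/2^14) * (#X * #Y * #Z / N : ℝ) = ((1 - 1/2^14) * #Z) * (#X * #Y / N) by ring] at hc
  have hc2 := lt_of_mul_lt_mul_right hc (by positivity)
  have hc3 : 1/2^14 * (#Z:ℝ) ≤ ∑ z ∈ Z, |hh X Y z| := by
    have : -∑ z ∈ Z, hh X Y z ≤ ∑ z ∈ Z, |hh X Y z| := by
      rw [← sum_neg_distrib]; exact sum_le_sum fun z _ => neg_le_abs _
    linarith
  have hZ0 : (0:ℝ) < #Z := by
    by_contra hh
    have : (#Z:ℝ) = 0 := le_antisymm (not_lt.1 hh) (by positivity)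
    rw [this, zero_mul] at hZ; linarith
  have pm := wpm Z (fun _ => 1) (fun z => |hh X Y z|) (fun _ _ => zero_le_one) (fun _ _ => abs_nonneg _) (p-1)
  rw [show p - 1 + 1 = p by omega] at pm
  simp only [one_mul, sum_const, nsmul_eq_mul, mul_one, hp.pow_abs] at pm
  have h1 : (1/2^14)^p * #Z ≤ ∑ z ∈ Z, hh X Y z ^ p := by
    have : (1/2^14 * (#Z:ℝ))^p ≤ (#Z:ℝ)^(p-1) * ∑ z ∈ Z, hh X Y z ^ p := le_trans (by gcongr) pm
    have e2 : (1/2^14 * (#Z:ℝ))^p = (#Z:ℝ)^(p-1) * ((1/2^14)^p * #Z) := by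
      rw [mul_pow, show (#Z:ℝ)^p = #Z^(p-1) * #Z by rw [← pow_succ]; congr 1; omega]; ring
    rw [e2] at this
    exact le_of_mul_le_mul_left this (by positivity)
  have h2 : (1/2^15)^p * N ≤ ∑ w, hh X Y w ^ p := by
    calc (1/2^15:ℝ)^p * N ≤ (1/2^15:ℝ)^p * ((#Z:ℝ) * 2^p) := by gcongr
      _ = (1/2^14:ℝ)^p * (#Z:ℝ) := by
          rw [show (1/2^14:ℝ) = 1/2^15 * 2 by norm_num, mul_pow (1/2^15:ℝ)]; ring
      _ ≤ _ := h1
      _ ≤ _ := sum_le_sum_of_subset_of_nonneg (subset_univ _) (fun _ _ _ => hp.pow_nonneg _)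
  have h3 : (∑ w, hh X X w ^ p) * (∑ w, hh Y Y w ^ p) < ((1/2^15)^p * N) * ((1/2^15)^p * N) := by
    have g1 := hh_nonneg X hX p
    have g2 := hh_nonneg Y hY p
    exact mul_lt_mul'' u1 u2 g1 g2
  have h4 : ((1/2^15)^p * N)^2 ≤ (∑ w, hh X Y w ^ p)^2 := by gcongr
  nlinarith

theorem lemUp (X Y Z : Finset G) (s ℓ : ℕ) (hs : 2^14 * ℓ ≤ s) (hs1 : 1 ≤ s) (hX : (Fintype.card G : ℝ) ≤ #X * 2^ℓ) (hU : Ubd s Y Z) :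
    ∑ x ∈ X, rr Y Z x ≤ (1 + 1/2^14) * (1 + 1/2^18) * (#X * #Y * #Z / Fintype.card G : ℝ) := by
  set N : ℝ := ((Fintype.card G : ℕ) : ℝ) with hN
  have hN0 : 0 < N := by rw [hN]; exact_mod_cast Fintype.card_pos
  have pm := wpm X (fun _ => 1) (fun z => rr Y Z z) (fun _ _ => zero_le_one) (fun _ _ => rr_nonneg _ _ _) (s-1)
  rw [show s - 1 + 1 = s by omega] at pm
  simp only [one_mul, sum_const, nsmul_eq_mul, mul_one] at pm
  have h1 : ∑ x ∈ X, rr Y Z x ^ s ≤ N * ((1 + 1/2^18) * (#Y * #Z / N))^s :=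
    (sum_le_sum_of_subset_of_nonneg (subset_univ _) (fun _ _ _ => pow_nonneg (rr_nonneg _ _ _) _)).trans hU
  have h2 : (2:ℝ)^ℓ ≤ (1 + 1/2^14)^s := by
    have b := one_add_mul_le_pow (a := (1:ℝ)/2^14) (by norm_num) (2^14)
    have b' : (2:ℝ) ≤ (1 + 1/2^14)^(2^14) := by
      refine le_trans (le_of_eq ?_) b
      push_cast; norm_num
    calc (2:ℝ)^ℓ ≤ ((1 + 1/2^14)^(2^14))^ℓ := by gcongr
      _ = (1 + 1/2^14)^(2^14 * ℓ) := by rw [← pow_mul]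
      _ ≤ _ := pow_le_pow_right₀ (by norm_num) hs
  have h3 : (∑ x ∈ X, rr Y Z x)^s ≤ ((1 + 1/2^14) * (1 + 1/2^18) * (#X * #Y * #Z / N))^s := by
    calc _ ≤ _ := pm
      _ ≤ #X^(s-1) * ((#X * (1 + 1/2^14)^s) * ((1 + 1/2^18) * (#Y * #Z / N))^s) := by
          gcongr
          refine h1.trans ?_
          gcongr
          refine hX.trans ?_
          gcongr
      _ = #X^s * ((1 + 1/2^14)^s * ((1 + 1/2^18) * (#Y * #Z / N))^s) := by
          rw [show (#X:ℝ)^s = #X^(s-1) * #X by rw [← pow_succ]; congr 1; omega]; ring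
      _ = _ := by rw [← mul_pow, ← mul_pow]; congr 1; ring
  exact le_of_pow_le_pow_left₀ (by omega) (by positivity) h3

end CF

namespace CF
open Finset
open scoped Classical
set_option linter.unusedSectionVars false
set_option linter.unusedSimpArgs false

/-- moment bound for grids -/
def MM {α ζ : Type} (X : Finset α) (Z : Finset ζ) (ν : α → ζ → ℝ) (s R : ℕ) : Prop :=
  ∀ j ≤ R, ∑ x ∈ Fintype.piFinset (fun _ : Fin j => X), (∑ z ∈ Z, ∏ i, ν (x i) z)^s ≤ (#X:ℝ)^j * (5^j * #Z)^s

theorem sum_pow_pi {ζ : Type} (Z : Finset ζ) (f : ζ → ℝ) (s : ℕ) :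
    (∑ z ∈ Z, f z)^s = ∑ z ∈ Fintype.piFinset (fun _ : Fin s => Z), ∏ i, f (z i) := by
  have := Finset.prod_univ_sum (fun _ : Fin s => Z) (fun _ z => f z)
  rw [← this]; simp

theorem piFinset_append {α : Type} (X : Finset α) (k r : ℕ) (g : (Fin (k+r) → α) → ℝ) :
    ∑ a ∈ Fintype.piFinset (fun _ : Fin k => X), ∑ b ∈ Fintype.piFinset (fun _ : Fin r => X), g (Fin.append a b)
     = ∑ x ∈ Fintype.piFinset (fun _ : Fin (k+r) => X), g x := by
  rw [← sum_product']
  refine sum_nbij' (fun p => Fin.append p.1 p.2) (fun x => (fun i => x (Fin.castAdd r i), fun i => x (Fin.natAdd k i))) ?_ ?_ ?_ ?_ ?_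
  · rintro ⟨a, b⟩ h
    simp only [mem_product, Fintype.mem_piFinset] at h ⊢
    intro i
    refine Fin.addCases (fun i => ?_) (fun i => ?_) i
    · simp [h.1 i]
    · simp [h.2 i]
  · intro x h
    simp only [mem_product, Fintype.mem_piFinset] at h ⊢
    exact ⟨fun i => h _, fun i => h _⟩
  · rintro ⟨a, b⟩ h
    simp
  · intro x h
    ext i
    refine Fin.addCases (fun i => ?_) (fun i => ?_) i <;> simp
  · rintro ⟨a, b⟩ h
    rfl

section
variable {α ζ : Type}

theorem T_holder (X : Finset α) (Z : Finset ζ) (ν : α → ζ → ℝ) (hν : ∀ x z, 0 ≤ ν x z) (F : ζ → ℝ) (hF : ∀ z, 0 ≤ F z)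
    (s r : ℕ) (hr : 1 ≤ r) :
    (∑ x ∈ X, (∑ z ∈ Z, ν x z * F z)^s)^r ≤ ((∑ z ∈ Z, F z)^s)^(r-1) *
      ∑ y ∈ Fintype.piFinset (fun _ : Fin r => X), (∑ z ∈ Z, F z * ∏ i, ν (y i) z)^s := by
  have e1 : ∑ x ∈ X, (∑ z ∈ Z, ν x z * F z)^s =
      ∑ z ∈ Fintype.piFinset (fun _ : Fin s => Z), (∏ i, F (z i)) * ∑ x ∈ X, ∏ i, ν x (z i) := by
    simp only [sum_pow_pi, prod_mul_distrib]
    rw [sum_comm]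
    refine sum_congr rfl fun z _ => ?_
    rw [mul_sum]; exact sum_congr rfl fun x _ => mul_comm _ _
  have e2 : ∑ y ∈ Fintype.piFinset (fun _ : Fin r => X), (∑ z ∈ Z, F z * ∏ i, ν (y i) z)^s
      = ∑ z ∈ Fintype.piFinset (fun _ : Fin s => Z), (∏ i, F (z i)) * (∑ x ∈ X, ∏ i, ν x (z i))^r := by
    simp only [sum_pow_pi, prod_mul_distrib]
    rw [sum_comm]
    refine sum_congr rfl fun z _ => ?_
    rw [mul_sum]; refine sum_congr rfl fun x _ => ?_
    rw [prod_comm]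
  rw [e1, e2, sum_pow_pi Z F s]
  have := wpm (Fintype.piFinset (fun _ : Fin s => Z)) (fun z => ∏ i, F (z i)) (fun z => ∑ x ∈ X, ∏ i, ν x (z i))
    (fun z _ => prod_nonneg fun i _ => hF _) (fun z _ => sum_nonneg fun x _ => prod_nonneg fun i _ => hν _ _) (r-1)
  rwa [show r - 1 + 1 = r by omega] at this

set_option maxHeartbeats 1000000 in
theorem W_bound (X : Finset α) (Z : Finset ζ) (ν f : α → ζ → ℝ) (hf : ∀ x z, 0 ≤ f x z) (hfν : ∀ x z, f x z ≤ ν x z)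
    (k r s R : ℕ) (hM : MM X Z ν s R) (hk : 1 ≤ k) (hkr : k ≤ r) (hrs : r ≤ s) (hR : k + r ≤ R) (hZ : Z.Nonempty) :
    ∑ x ∈ Fintype.piFinset (fun _ : Fin k => X), ∑ y ∈ X,
      (∑ z ∈ Z, ν y z * ∏ i, f (x i) z)^s / ((∑ z ∈ Z, ∏ i, f (x i) z) + 1/2^r * #Z)^(s-1)
      ≤ (#X:ℝ)^(k+1) * #Z * (1/2^r) * 50^s := by
  have hν : ∀ x z, 0 ≤ ν x z := fun x z => (hf x z).trans (hfν x z)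
  have hZ0 : (0:ℝ) < #Z := by exact_mod_cast card_pos.2 hZ
  set m : ℝ := (#Z : ℝ) with hm
  set n : ℝ := (#X : ℝ) with hn
  have hn0 : 0 ≤ n := by positivity
  set τ : ℝ := 1/2^r with hτ
  have hτ0 : 0 < τ := by positivity
  set v : (Fin k → α) → ℝ := fun x => ∑ z ∈ Z, ∏ i, f (x i) z with hv
  have hv0 : ∀ x, 0 ≤ v x := fun x => sum_nonneg fun z _ => prod_nonneg fun i _ => hf _ _
  set T1 : (Fin k → α) → ℝ := fun x => ∑ y ∈ X, (∑ z ∈ Z, ν y z * ∏ i, f (x i) z)^s with hT1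
  have hT10 : ∀ x, 0 ≤ T1 x := fun x => sum_nonneg fun y _ => pow_nonneg (sum_nonneg fun z _ => mul_nonneg (hν _ _) (prod_nonneg fun i _ => hf _ _)) _
  set Tr : (Fin k → α) → ℝ := fun x => ∑ y ∈ Fintype.piFinset (fun _ : Fin r => X), (∑ z ∈ Z, (∏ i, f (x i) z) * ∏ i, ν (y i) z)^s with hTr
  have hTr0 : ∀ x, 0 ≤ Tr x := fun x => sum_nonneg fun y _ => pow_nonneg (sum_nonneg fun z _ => mul_nonneg (prod_nonneg fun i _ => hf _ _) (prod_nonneg fun i _ => hν _ _)) _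
  have e0 : ∀ x : Fin k → α, ∑ y ∈ X, (∑ z ∈ Z, ν y z * ∏ i, f (x i) z)^s / ((∑ z ∈ Z, ∏ i, f (x i) z) + τ * m)^(s-1)
     = T1 x / (v x + τ * m)^(s-1) := fun x => by rw [hT1, sum_div]
  simp only [e0]
  have hb : ∀ x, 0 < v x + τ * m := fun x => by have := hv0 x; positivity
  have key : ∀ x, (T1 x / (v x + τ * m)^(s-1))^r ≤ Tr x / (τ * m)^(s-r) := by
    intro x
    have h1 : T1 x^r ≤ (v x^s)^(r-1) * Tr x := T_holder X Z ν hν _ (fun z => prod_nonneg fun i _ => hf _ _) s r (by omega)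
    have hvx := hv0 x
    have hbx := hb x
    have hTrx := hTr0 x
    rw [div_pow, div_le_div_iff₀ (by positivity) (by positivity)]
    have h2 : (v x^s)^(r-1) * (τ * m)^(s-r) ≤ ((v x + τ*m)^(s-1))^r := by
      have : ((v x + τ*m)^(s-1))^r = ((v x + τ*m)^s)^(r-1) * (v x + τ*m)^(s-r) := by
        rw [← pow_mul, ← pow_mul, ← pow_add]; congr 1
        obtain ⟨r', rfl⟩ : ∃ r', r = r' + 1 := ⟨r-1, by omega⟩
        obtain ⟨t, rfl⟩ : ∃ t, s = r' + 1 + t := ⟨s-(r'+1), by omega⟩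
        simp only [Nat.add_sub_cancel, Nat.add_sub_cancel_left]
        rw [show r' + 1 + t - 1 = r' + t by omega]; ring
      rw [this]
      have : 0 < τ * m := by positivity
      gcongr <;> linarith
    calc T1 x^r * (τ*m)^(s-r) ≤ ((v x^s)^(r-1) * Tr x) * (τ*m)^(s-r) := by gcongr
      _ = ((v x^s)^(r-1) * (τ * m)^(s-r)) * Tr x := by ring
      _ ≤ ((v x + τ*m)^(s-1))^r * Tr x := by gcongr
      _ = _ := by ring
  have hsumTr : ∑ x ∈ Fintype.piFinset (fun _ : Fin k => X), Tr x ≤ n^(k+r) * (5^(k+r) * m)^s := by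
    refine le_trans ?_ (hM (k+r) hR)
    rw [← piFinset_append]
    refine sum_le_sum fun x _ => sum_le_sum fun y _ => ?_
    refine pow_le_pow_left₀ (sum_nonneg fun z _ => mul_nonneg (prod_nonneg fun i _ => hf _ _) (prod_nonneg fun i _ => hν _ _)) ?_ _
    refine sum_le_sum fun z _ => ?_
    rw [Fin.prod_univ_add]
    simp only [Fin.append_left, Fin.append_right]
    refine mul_le_mul_of_nonneg_right ?_ (prod_nonneg fun i _ => hν _ _)
    exact prod_le_prod (fun i _ => hf _ _) fun i _ => hfν _ _
  have hW := wpm (Fintype.piFinset (fun _ : Fin k => X)) (fun _ => 1) (fun x => T1 x / (v x + τ * m)^(s-1)) (fun _ _ => zero_le_one)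
    (fun x _ => by have := hT10 x; have := hb x; positivity) (r-1)
  rw [show r - 1 + 1 = r by omega] at hW
  simp only [one_mul, sum_const, nsmul_eq_mul, mul_one, Fintype.card_piFinset, prod_const, card_univ, Fintype.card_fin, Nat.cast_pow] at hW
  refine le_of_pow_le_pow_left₀ (n := r) (by omega) (by positivity) (hW.trans ?_)
  calc (n^k)^(r-1) * ∑ x ∈ Fintype.piFinset (fun _ : Fin k => X), (T1 x / (v x + τ * m)^(s-1))^r
      ≤ (n^k)^(r-1) * ∑ x ∈ Fintype.piFinset (fun _ : Fin k => X), Tr x / (τ * m)^(s-r) := by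
        gcongr with x; exact key x
    _ ≤ (n^k)^(r-1) * (n^(k+r) * (5^(k+r) * m)^s / (τ * m)^(s-r)) := by
        rw [← sum_div]; gcongr
    _ ≤ (n^k)^(r-1) * (n^(k+r) * ((τ * m)^r * (50^s)^r)) := by
        gcongr
        rw [mul_div_assoc]
        gcongr
        rw [div_le_iff₀ (by positivity)]
        have e : (τ * m)^r * (50^s)^r * (τ * m)^(s-r) = (τ * 50^r * m)^s *1 := by
          have : (τ * m)^s = (τ*m)^r * (τ*m)^(s-r) := by rw [← pow_add]; congr 1; omega
          rw [← pow_mul, mul_comm s r, pow_mul, mul_one, mul_assoc τ, mul_comm (50^r) m, ← mul_assoc, mul_pow _ (50^r) s, this]; ring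
        rw [e, mul_one]
        gcongr
        rw [hτ]
        have : (50:ℝ)^r = 2^r * 5^r * 5^r := by rw [← mul_pow, ← mul_pow]; norm_num
        rw [this, pow_add]
        have h3 : (5:ℝ)^k ≤ 5^r := pow_le_pow_right₀ (by norm_num) hkr
        have : 1 / 2^r * ((2:ℝ)^r * 5^r * 5^r) = 5^r * 5^r := by field_simp
        rw [this]; gcongr
    _ = _ := by
        rw [show n^(k+r) = n^k * n^r by rw [pow_add]]
        have : (n^k)^r = (n^k)^(r-1) * n^k := by rw [← pow_succ]; congr 1; omega
        simp only [mul_pow]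
        rw [pow_succ, mul_pow, this]; ring

end
end CF

namespace CF
open Finset
open scoped Classical
set_option linter.unusedSectionVars false
set_option linter.unusedSimpArgs false
section
variable {α ζ : Type}

theorem sum_D_pow (Q : Finset α) (Z : Finset ζ) (f : α → ζ → ℝ) (w : ζ → ℝ) (k : ℕ) :
    ∑ z ∈ Z, w z * (∑ x ∈ Q, f x z)^k = ∑ x ∈ Fintype.piFinset (fun _ : Fin k => Q), ∑ z ∈ Z, w z * ∏ i, f (x i) z := by
  simp only [sum_pow_pi, mul_sum]
  rw [sum_comm]

theorem D_moment (X Q : Finset α) (hQ : Q ⊆ X) (Z : Finset ζ) (ν f : α → ζ → ℝ) (hf : ∀ x z, 0 ≤ f x z) (hfν : ∀ x z, f x z ≤ ν x z)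
    (k s R : ℕ) (hM : MM X Z ν s R) (hs : 1 ≤ s) (hR : 2*k ≤ R) (hq : (#X:ℝ) ≤ #Q * 2^s) :
    ∑ z ∈ Z, (∑ x ∈ Q, f x z)^(2*k) ≤ (10 * #Q)^(2*k) * #Z := by
  have hν : ∀ x z, 0 ≤ ν x z := fun x z => (hf x z).trans (hfν x z)
  have e := sum_D_pow Q Z f (fun _ => 1) (2*k)
  simp only [one_mul] at e
  rw [e]
  have hW := wpm (Fintype.piFinset (fun _ : Fin (2*k) => Q)) (fun _ => 1) (fun x => ∑ z ∈ Z, ∏ i, f (x i) z) (fun _ _ => zero_le_one)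
    (fun x _ => sum_nonneg fun z _ => prod_nonneg fun i _ => hf _ _) (s-1)
  rw [show s - 1 + 1 = s by omega] at hW
  simp only [one_mul, sum_const, nsmul_eq_mul, mul_one, Fintype.card_piFinset, prod_const, card_univ, Fintype.card_fin, Nat.cast_pow] at hW
  refine le_of_pow_le_pow_left₀ (n := s) (by omega) (by positivity) (hW.trans ?_)
  have h1 : ∑ x ∈ Fintype.piFinset (fun _ : Fin (2*k) => Q), (∑ z ∈ Z, ∏ i, f (x i) z)^s ≤ (#X:ℝ)^(2*k) * (5^(2*k) * #Z)^s := by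
    refine le_trans ?_ (hM (2*k) hR)
    refine (sum_le_sum_of_subset_of_nonneg (Fintype.piFinset_subset _ _ fun _ => hQ)
      (fun x _ _ => pow_nonneg (sum_nonneg fun z _ => prod_nonneg fun i _ => hf _ _) _)).trans ?_
    refine sum_le_sum fun x _ => pow_le_pow_left₀ (sum_nonneg fun z _ => prod_nonneg fun i _ => hf _ _) ?_ _
    exact sum_le_sum fun z _ => prod_le_prod (fun i _ => hf _ _) fun i _ => hfν _ _
  calc _ ≤ ((#Q:ℝ)^(2*k))^(s-1) * ((#Q * 2^s)^(2*k) * (5^(2*k) * #Z)^s) := by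
        gcongr
        refine h1.trans ?_
        gcongr
    _ = ((#Q:ℝ)^(2*k))^s * ((2^s)^(2*k) * (5^(2*k) * #Z)^s) := by
        have : ((#Q:ℝ)^(2*k))^s = ((#Q:ℝ)^(2*k))^(s-1) * (#Q)^(2*k) := by rw [← pow_succ]; congr 1; omega
        rw [this]; ring
    _ = _ := by
        rw [← pow_mul 2, mul_comm s, pow_mul 2, ← mul_pow, ← mul_pow, show (10:ℝ) = 2 * 5 by norm_num, mul_pow (2*5:ℝ), mul_pow 2 5]
        congr 1; ring

theorem u_split (u b K : ℝ) (hu : 0 ≤ u) (hb : 0 < b) (hK : 0 < K) (s : ℕ) (hs : 1 ≤ s) :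
    u ≤ K * b + u^s / b^(s-1) / K^(s-1) := by
  by_cases h : u ≤ K * b
  · have : 0 ≤ u^s / b^(s-1) / K^(s-1) := by positivity
    linarith
  · push Not at h
    have : u ≤ u^s / b^(s-1) / K^(s-1) := by
      rw [div_div, le_div_iff₀ (by positivity), ← mul_pow]
      have : u^s = u * u^(s-1) := by rw [← pow_succ']; congr 1; omega
      rw [this]
      gcongr
      linarith
    have : 0 < K * b := by positivity
    linarith

theorem D_k (Q : Finset α) (Z : Finset ζ) (f : α → ζ → ℝ) (hf : ∀ x z, 0 ≤ f x z) (δ : ℝ) (hδ : 0 < δ) (k : ℕ)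
    (h2 : ∑ z ∈ Z, (∑ x ∈ Q, f x z)^(2*k) ≤ (10 * #Q)^(2*k) * #Z)
    (hB : (#{z ∈ Z | 33/32 * δ * #Q ≤ ∑ x ∈ Q, f x z} : ℝ) ≤ (δ/10)^(2*k) * #Z) :
    ∑ z ∈ Z, (∑ x ∈ Q, f x z)^k ≤ 2 * (33/32 * δ * #Q)^k * #Z := by
  set D : ζ → ℝ := fun z => ∑ x ∈ Q, f x z with hD
  have hD0 : ∀ z, 0 ≤ D z := fun z => sum_nonneg fun x _ => hf _ _
  rw [← sum_filter_add_sum_filter_not Z (fun z => 33/32 * δ * #Q ≤ D z)]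
  set B := {z ∈ Z | 33/32 * δ * #Q ≤ D z} with hBdef
  have h3 : ∑ z ∈ Z with ¬ (33/32 * δ * #Q ≤ D z), D z^k ≤ (33/32 * δ * #Q)^k * #Z := by
    calc _ ≤ ∑ z ∈ Z with ¬ (33/32 * δ * #Q ≤ D z), (33/32 * δ * #Q)^k := by
          refine sum_le_sum fun z hz => ?_
          have := (mem_filter.1 hz).2
          push Not at this
          exact pow_le_pow_left₀ (hD0 z) this.le _
      _ ≤ ∑ z ∈ Z, (33/32 * δ * #Q)^k := sum_le_sum_of_subset_of_nonneg (filter_subset _ _) (fun _ _ _ => by positivity)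
      _ = _ := by rw [sum_const, nsmul_eq_mul]; ring
  have h4 : ∑ z ∈ B, D z^k ≤ (δ * #Q)^k * #Z := by
    refine le_of_pow_le_pow_left₀ (n := 2) (by norm_num) (by positivity) ?_
    have cs := wpm B (fun _ => 1) (fun z => D z^k) (fun _ _ => zero_le_one) (fun z _ => pow_nonneg (hD0 z) _) 1
    simp only [one_mul, sum_const, nsmul_eq_mul, mul_one, pow_one] at cs
    refine cs.trans ?_
    have h5 : ∑ z ∈ B, (D z^k)^(1+1) ≤ (10 * #Q)^(2*k) * #Z := by
      refine le_trans ?_ h2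
      simp only [← pow_mul, mul_comm k]
      exact sum_le_sum_of_subset_of_nonneg (filter_subset _ _) (fun z _ _ => pow_nonneg (hD0 z) _)
    calc _ ≤ ((δ/10)^(2*k) * #Z) * ((10 * #Q)^(2*k) * #Z) := by
          have : 0 ≤ ∑ z ∈ B, (D z^k)^(1+1) := sum_nonneg fun z _ => pow_nonneg (pow_nonneg (hD0 z) _) _
          gcongr
      _ = ((δ/10 * (10 * #Q))^k * #Z)^2 := by rw [mul_pow (δ/10)]; ring
      _ = _ := by congr 3; ring
  have h6 : (δ * #Q)^k ≤ (33/32 * δ * #Q)^k := by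
    refine pow_le_pow_left₀ (by positivity) ?_ _
    have : 0 ≤ δ * #Q := by positivity
    linarith
  have h7 : (δ * #Q)^k * #Z ≤ (33/32 * δ * #Q)^k * (#Z:ℝ) := by gcongr
  linarith

theorem D_lower (Q : Finset α) (Z : Finset ζ) (hZ : Z.Nonempty) (f : α → ζ → ℝ) (w : ζ → ℝ) (hf : ∀ x z, 0 ≤ f x z) (hw : ∀ z, 0 ≤ w z)
    (δ : ℝ) (hδ : 0 < δ) (k : ℕ) (hk : 1 ≤ k) (h1 : ∀ x ∈ Q, 17/16 * δ^2 * #Z ≤ ∑ z ∈ Z, f x z * w z)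
    (h2 : ∑ z ∈ Z, w z ≤ 129/128 * δ * #Z) :
    δ * #Z * (67/64 * δ * #Q)^k ≤ ∑ z ∈ Z, w z * (∑ x ∈ Q, f x z)^k := by
  have hZ0 : (0:ℝ) < #Z := by exact_mod_cast card_pos.2 hZ
  have pm := wpm Z w (fun z => ∑ x ∈ Q, f x z) (fun z _ => hw z) (fun z _ => sum_nonneg fun x _ => hf _ _) (k-1)
  rw [show k - 1 + 1 = k by omega] at pm
  have h3 : 17/16 * δ^2 * #Z * #Q ≤ ∑ z ∈ Z, w z * ∑ x ∈ Q, f x z := by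
    simp only [mul_sum]
    rw [sum_comm]
    calc _ = ∑ x ∈ Q, 17/16 * δ^2 * #Z := by rw [sum_const, nsmul_eq_mul]; ring
      _ ≤ _ := sum_le_sum fun x hx => (h1 x hx).trans (le_of_eq (sum_congr rfl fun z _ => mul_comm _ _))
  set S := ∑ z ∈ Z, w z * (∑ x ∈ Q, f x z)^k with hS
  have hS0 : 0 ≤ S := sum_nonneg fun z _ => mul_nonneg (hw z) (pow_nonneg (sum_nonneg fun x _ => hf _ _) _)
  have hw0 : 0 ≤ ∑ z ∈ Z, w z := sum_nonneg fun z _ => hw z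
  have h4 : (17/16 * δ^2 * #Z * #Q)^k ≤ (129/128 * δ * #Z)^(k-1) * S := by
    calc _ ≤ (∑ z ∈ Z, w z * ∑ x ∈ Q, f x z)^k := by gcongr
      _ ≤ _ := pm
      _ ≤ _ := by gcongr
  have h5 : (129/128 * δ * #Z)^(k-1) * (δ * #Z * (67/64 * δ * #Q)^k) ≤ (129/128 * δ * #Z)^(k-1) * S := by
    refine le_trans ?_ h4
    calc _ ≤ (129/128 * δ * #Z)^(k-1) * ((129/128 * δ * #Z) * (67/64 * δ * #Q)^k) := by
          gcongr
          have : 0 < δ * #Z := by positivity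
          linarith
      _ = (129/128 * δ * #Z)^k * (67/64 * δ * #Q)^k := by
          rw [← mul_assoc, ← pow_succ]; congr 2; omega
      _ ≤ _ := by
          rw [← mul_pow]
          refine pow_le_pow_left₀ (by positivity) ?_ _
          have : 0 ≤ δ^2 * #Z * #Q := by positivity
          nlinarith
  exact le_of_mul_le_mul_left h5 (by positivity)

theorem I_low (X : Finset α) (hX : X.Nonempty) (a : α → ℝ) (ha : ∀ y, 0 ≤ a y) (q k s : ℕ) (hk : 1 ≤ k) (hsq : k * (q+1) ≤ s)
    (hP : (#X:ℝ)^2 ≤ 2^q * ∑ y ∈ X, a y) :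
    (#X:ℝ)^(k+1) ≤ (∑ y ∈ X with (#X:ℝ) ≤ a y * 2^(q+1), a y^k) * 2^s := by
  have hX0 : (0:ℝ) < #X := by exact_mod_cast card_pos.2 hX
  have a5 : (#{y ∈ X | (#X:ℝ) ≤ a y * 2^(q+1)}:ℝ) ≤ #X := by exact_mod_cast card_le_card (filter_subset _ _)
  have hXc : ∑ y ∈ X, (#X:ℝ) / 2^(q+1) = #X * (#X / 2^(q+1)) := by rw [sum_const, nsmul_eq_mul]
  generalize (#X : ℝ) = n at *
  have hI0 : 0 ≤ ∑ y ∈ X with n ≤ a y * 2^(q+1), a y^k := sum_nonneg fun y _ => pow_nonneg (ha y) _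
  have a1 : n^2 ≤ 2^(q+1) * ∑ y ∈ X with n ≤ a y * 2^(q+1), a y := by
    rw [← sum_filter_add_sum_filter_not X (fun y => n ≤ a y * 2^(q+1)), mul_add] at hP
    have a2 : ∑ y ∈ X with ¬ (n ≤ a y * 2^(q+1)), a y ≤ n * (n / 2^(q+1)) := by
      calc _ ≤ ∑ y ∈ X with ¬ (n ≤ a y * 2^(q+1)), n / 2^(q+1) := by
            refine sum_le_sum fun y hy => ?_
            have := (mem_filter.1 hy).2
            push Not at this
            rw [le_div_iff₀ (by positivity)]; exact this.le
        _ ≤ ∑ y ∈ X, n / 2^(q+1) := sum_le_sum_of_subset_of_nonneg (filter_subset _ _) (fun _ _ _ => by positivity)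
        _ = _ := hXc
    have a3 : 2^q * (n * (n / 2^(q+1))) = n^2/2 := by rw [pow_succ]; field_simp
    have a4 : (2:ℝ)^q * ∑ y ∈ X with ¬ (n ≤ a y * 2^(q+1)), a y ≤ n^2/2 := by
      rw [← a3]; gcongr
    have e : ∀ J : ℝ, 2^(q+1) * J = 2 * (2^q * J) := fun J => by rw [pow_succ]; ring
    rw [e]; linarith
  have pm := wpm {y ∈ X | n ≤ a y * 2^(q+1)} (fun _ => 1) a (fun _ _ => zero_le_one) (fun y _ => ha y) (k-1)
  rw [show k - 1 + 1 = k by omega] at pm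
  simp only [one_mul, sum_const, nsmul_eq_mul, mul_one] at pm
  have hJ0 : 0 ≤ ∑ y ∈ X with n ≤ a y * 2^(q+1), a y := sum_nonneg fun y _ => ha y
  have hc0 : 0 ≤ (#{y ∈ X | n ≤ a y * 2^(q+1)}:ℝ) := by positivity
  generalize ∑ y ∈ X with n ≤ a y * 2^(q+1), a y = J at *
  generalize ∑ y ∈ X with n ≤ a y * 2^(q+1), a y ^ k = I at *
  generalize (#{y ∈ X | n ≤ a y * 2^(q+1)}:ℝ) = c at *
  have a6 : (n^2)^k ≤ (2^(q+1))^k * (n^(k-1) * I) := by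
    calc _ ≤ (2^(q+1) * J)^k := by gcongr
      _ = (2^(q+1))^k * J^k := mul_pow _ _ _
      _ ≤ (2^(q+1))^k * (c^(k-1) * I) := by gcongr
      _ ≤ _ := by gcongr
  have a7 : (n^2)^k = n^(k-1) * n^(k+1) := by rw [← pow_mul, ← pow_add]; congr 1; omega
  rw [a7] at a6
  have a8 : n^(k+1) ≤ (2^(q+1))^k * I := by
    refine le_of_mul_le_mul_left (a := n^(k-1)) ?_ (by positivity)
    linarith
  refine a8.trans ?_
  rw [mul_comm, ← pow_mul]
  gcongr
  · norm_num
  · rw [mul_comm]; exact hsq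

set_option maxHeartbeats 2000000 in
theorem stepB (X : Finset α) (hX : X.Nonempty) (Z : Finset ζ) (hZ : Z.Nonempty) (ν f : α → ζ → ℝ) (hf : ∀ x z, 0 ≤ f x z) (hfν : ∀ x z, f x z ≤ ν x z)
    (P : α → α → Prop) (δ : ℝ) (hδ : 0 < δ) (q k r s R : ℕ)
    (hM : MM X Z ν s R) (hk : 1 ≤ k) (hkr : k ≤ r) (hrs : r ≤ s) (hR : k + r ≤ R) (hsq : k * (q+1) ≤ s)
    (hτ : 1/2^r ≤ δ^k) (h400 : 400 < δ * (67/66)^k)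
    (hP1 : ∀ x ∈ X, ∀ y ∈ X, P x y → 17/16 * δ^2 * #Z ≤ ∑ z ∈ Z, f x z * f y z)
    (hP2 : ∀ x ∈ X, ∀ y ∈ X, P x y → ∑ z ∈ Z, f y z ≤ 129/128 * δ * #Z)
    (hP : (#X:ℝ)^2 ≤ 2^q * ∑ y ∈ X, (#{x ∈ X | P x y} : ℝ)) :
    ∃ y ∈ X, (#X:ℝ) ≤ #{x ∈ X | P x y} * 2^(q+1) ∧
      (δ/10)^(2*k) * #Z ≤ #{z ∈ Z | 33/32 * δ * #{x ∈ X | P x y} ≤ ∑ x ∈ X with P x y, f x z} := by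
  by_contra hcon
  push Not at hcon
  have hZ0 : (0:ℝ) < #Z := by exact_mod_cast card_pos.2 hZ
  have hX0 : (0:ℝ) < #X := by exact_mod_cast card_pos.2 hX
  have hν : ∀ x z, 0 ≤ ν x z := fun x z => (hf x z).trans (hfν x z)
  set m : ℝ := (#Z : ℝ) with hm
  set n : ℝ := (#X : ℝ) with hn
  set τ : ℝ := 1/2^r with hτd
  have hτ0 : 0 < τ := by positivity
  set Q : α → Finset α := fun y => {x ∈ X | P x y} with hQ
  have hQX : ∀ y, Q y ⊆ X := fun y => filter_subset _ _
  set X2 := {y ∈ X | n ≤ #(Q y) * 2^(q+1)} with hX2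
  set I : ℝ := ∑ y ∈ X2, (#(Q y):ℝ)^k with hI
  have hI0 : 0 ≤ I := sum_nonneg fun y _ => by positivity
  have hq1 : q + 1 ≤ s := le_trans (Nat.le_mul_of_pos_left _ hk) hsq
  -- lower bound of I
  have hIlow : n^(k+1) ≤ I * 2^s := I_low X hX (fun y => (#(Q y):ℝ)) (fun y => by positivity) q k s hk hsq hP
  clear_value I
  have hIpos : 0 < I := by
    by_contra hh
    have : I = 0 := le_antisymm (not_lt.1 hh) hI0
    rw [this, zero_mul] at hIlow
    have : 0 < n^(k+1) := by positivity
    linarith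
  -- u, v
  set v : (Fin k → α) → ℝ := fun x => ∑ z ∈ Z, ∏ i, f (x i) z with hv
  have hv0 : ∀ x, 0 ≤ v x := fun x => sum_nonneg fun z _ => prod_nonneg fun i _ => hf _ _
  set u : α → (Fin k → α) → ℝ := fun y x => ∑ z ∈ Z, ν y z * ∏ i, f (x i) z with hu
  have hu0 : ∀ y x, 0 ≤ u y x := fun y x => sum_nonneg fun z _ => mul_nonneg (hν _ _) (prod_nonneg fun i _ => hf _ _)
  have hW := W_bound X Z ν f hf hfν k r s R hM hk hkr hrs hR hZ
  set W : ℝ := ∑ x ∈ Fintype.piFinset (fun _ : Fin k => X), ∑ y ∈ X, (u y x)^s / (v x + τ * m)^(s-1) with hWd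
  have hb : ∀ x, 0 < v x + τ * m := fun x => by have := hv0 x; positivity
  have hlow : δ * m * (67/64*δ)^k * I ≤ ∑ y ∈ X2, ∑ x ∈ Fintype.piFinset (fun _ : Fin k => Q y), u y x := by
    rw [hI, mul_sum]
    refine sum_le_sum fun y hy => ?_
    have hy' := mem_filter.1 hy
    have hyQ : (Q y).Nonempty := by
      rw [nonempty_iff_ne_empty]; intro h
      have := hy'.2; rw [h] at this; simp at this; linarith
    obtain ⟨x0, hx0⟩ := hyQ
    have hx0' := mem_filter.1 hx0
    have b1 := D_lower (Q y) Z hZ f (f y) hf (hf y) δ hδ k hk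
      (fun x hx => hP1 x (mem_filter.1 hx).1 y hy'.1 (mem_filter.1 hx).2) (hP2 x0 hx0'.1 y hy'.1 hx0'.2)
    rw [sum_D_pow, mul_pow (67/64*δ), ← mul_assoc] at b1
    refine b1.trans (sum_le_sum fun x _ => sum_le_sum fun z _ => ?_)
    exact mul_le_mul_of_nonneg_right (hfν _ _) (prod_nonneg fun i _ => hf _ _)
  have hup : ∑ y ∈ X2, ∑ x ∈ Fintype.piFinset (fun _ : Fin k => Q y), u y x ≤
      100 * (2 * (33/32*δ)^k * m * I + τ * m * I) + W / 100^(s-1) := by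
    calc _ ≤ ∑ y ∈ X2, ∑ x ∈ Fintype.piFinset (fun _ : Fin k => Q y), (100 * (v x + τ * m) + (u y x)^s / (v x + τ * m)^(s-1) / 100^(s-1)) :=
          sum_le_sum fun y _ => sum_le_sum fun x _ => u_split _ _ _ (hu0 y x) (hb x) (by norm_num) s (by omega)
      _ = 100 * (∑ y ∈ X2, ∑ x ∈ Fintype.piFinset (fun _ : Fin k => Q y), v x + τ * m * I) +
          (∑ y ∈ X2, ∑ x ∈ Fintype.piFinset (fun _ : Fin k => Q y), (u y x)^s / (v x + τ * m)^(s-1)) / 100^(s-1) := by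
          simp only [sum_add_distrib, ← mul_sum, ← sum_div, sum_const, Fintype.card_piFinset, prod_const, card_univ, Fintype.card_fin, nsmul_eq_mul, Nat.cast_pow, hI]
          congr 2
          rw [← sum_mul]; ring
      _ ≤ _ := by
          gcongr
          · rw [hI, mul_sum]
            refine sum_le_sum fun y hy => ?_
            have hy' := mem_filter.1 hy
            have c1 := D_moment X (Q y) (hQX y) Z ν f hf hfν k s R hM (by omega) (by omega) (by
              refine hy'.2.trans ?_
              gcongr
              norm_num)
            have c2 := D_k (Q y) Z f hf δ hδ k c1 (hcon y hy'.1 hy'.2).le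
            have e := sum_D_pow (Q y) Z f (fun _ => 1) k
            simp only [one_mul] at e
            rw [e] at c2
            refine c2.trans (le_of_eq ?_)
            rw [mul_pow (33/32*δ)]; ring
          · rw [hWd, sum_comm' (t' := X) (s' := fun _ => Fintype.piFinset (fun _ : Fin k => X)) (by intros; tauto)]
            have hnn : ∀ x y, 0 ≤ (u y x)^s / (v x + τ * m)^(s-1) := fun x y => by
              have := hu0 y x; have := hb x; positivity
            calc _ ≤ ∑ y ∈ X2, ∑ x ∈ Fintype.piFinset (fun _ : Fin k => X), (u y x)^s / (v x + τ * m)^(s-1) :=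
                  sum_le_sum fun y _ => sum_le_sum_of_subset_of_nonneg (Fintype.piFinset_subset _ _ fun _ => hQX y) fun x _ _ => hnn x y
              _ ≤ _ := sum_le_sum_of_subset_of_nonneg (filter_subset _ _) fun y _ _ => sum_nonneg fun x _ => hnn x y
  have hW2 : W / 100^(s-1) ≤ 100 * τ * m * I := by
    rw [div_le_iff₀ (by positivity)]
    calc W ≤ n^(k+1) * m * τ * 50^s := hW
      _ ≤ (I * 2^s) * m * τ * 50^s := by gcongr
      _ = (τ * m * I) * (100 * 100^(s-1)) := by
          have : (100:ℝ) * 100^(s-1) = 2^s * 50^s := by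
            rw [← pow_succ', ← mul_pow]; norm_num; congr 1; omega
          rw [this]; ring
      _ = _ := by ring
  have hfin : δ * m * (67/64*δ)^k * I ≤ 400 * (33/32*δ)^k * m * I := by
    have h1 : τ ≤ (33/32*δ)^k := hτ.trans (pow_le_pow_left₀ hδ.le (by linarith) _)
    have h2 : τ * (m * I) ≤ (33/32*δ)^k * (m * I) := by gcongr
    linarith
  have e1 : δ * m * (67/64*δ)^k * I = (33/32*δ)^k * m * I * (δ * (67/66)^k) := by
    have : (67/64*δ)^k = (33/32*δ)^k * (67/66)^k := by rw [← mul_pow]; congr 1; ring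
    rw [this]; ring
  have h3 : 0 < (33/32*δ)^k * m * I := by positivity
  rw [e1] at hfin
  nlinarith
end
end CF

namespace CF
open Finset
open scoped Classical
set_option linter.unusedSectionVars false
set_option linter.unusedSimpArgs false
section
variable {α ζ : Type}

theorem degs (X : Finset α) (deg : α → ℝ) (hd : ∀ x, 0 ≤ deg x) (a : ℝ) (ha : 0 < a)
    (htot : ∑ x ∈ X, deg x = a * #X)
    (hhi : ∑ x ∈ X with ¬ (deg x ≤ 2049/2048 * a), deg x < 1/2048 * (a * #X)) :
    3/4 * (a * #X) ≤ ∑ x ∈ X with (127/128 * a ≤ deg x ∧ deg x ≤ 2049/2048 * a), deg x := by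
  have h1 := sum_filter_add_sum_filter_not X (fun x => deg x ≤ 2049/2048 * a) deg
  have h2 := sum_filter_add_sum_filter_not {x ∈ X | deg x ≤ 2049/2048 * a} (fun x => 127/128 * a ≤ deg x) deg
  rw [filter_filter, filter_filter] at h2
  have e : ({x ∈ X | deg x ≤ 2049/2048 * a ∧ 127/128 * a ≤ deg x}) = {x ∈ X | 127/128 * a ≤ deg x ∧ deg x ≤ 2049/2048 * a} := by
    ext x; simp [and_comm]
  rw [e] at h2
  set g := {x ∈ X | 127/128 * a ≤ deg x ∧ deg x ≤ 2049/2048 * a} with hg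
  set l := {x ∈ X | deg x ≤ 2049/2048 * a ∧ ¬ 127/128 * a ≤ deg x} with hl
  have hgl : (#g:ℝ) + #l ≤ #X := by
    have : Disjoint g l := by
      rw [disjoint_left]; intro x hx hx'
      exact (mem_filter.1 hx').2.2 (mem_filter.1 hx).2.1
    have : #g + #l ≤ #X := by
      rw [← card_union_of_disjoint this]
      exact card_le_card (union_subset (filter_subset _ _) (filter_subset _ _))
    exact_mod_cast this
  have h3 : ∑ x ∈ g, deg x ≤ #g * (2049/2048 * a) := by
    rw [← nsmul_eq_mul]; exact sum_le_card_nsmul _ _ _ fun x hx => (mem_filter.1 hx).2.2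
  have h4 : ∑ x ∈ l, deg x ≤ #l * (127/128 * a) := by
    rw [← nsmul_eq_mul]; refine sum_le_card_nsmul _ _ _ fun x hx => ?_
    have := (mem_filter.1 hx).2.2
    push Not at this; exact this.le
  have h5 : (2047/2048) * (a * #X) ≤ (#g * (2049/2048) + #l * (127/128)) * a := by linarith
  have h6 : (2047/2048) * (#X:ℝ) ≤ #g * (2049/2048) + #l * (127/128) := by
    refine le_of_mul_le_mul_right ?_ ha
    linarith
  have h7 : (#l:ℝ) ≤ 1/8 * #X := by linarith
  have h8 : (#l:ℝ) * a ≤ 1/8 * #X * a := by gcongr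
  have h9 : 0 ≤ #X * a := by positivity
  linarith

theorem MM_two (X : Finset α) (Z : Finset ζ) (ν : α → ζ → ℝ) (s R : ℕ) (hM : MM X Z ν s R) (hR : 2 ≤ R) :
    ∑ x ∈ X, ∑ y ∈ X, (∑ z ∈ Z, ν x z * ν y z)^s ≤ (#X:ℝ)^2 * (25 * #Z)^s := by
  have h := hM 2 hR
  rw [sum_pi_succ] at h
  simp only [sum_pi_succ] at h
  norm_num at h
  simpa [Fin.prod_univ_two] using h

set_option maxHeartbeats 2000000 in
theorem halfB (X : Finset α) (hX : X.Nonempty) (Z : Finset ζ) (hZ : Z.Nonempty) (ν f : α → ζ → ℝ) (hf : ∀ x z, 0 ≤ f x z) (hfν : ∀ x z, f x z ≤ ν x z)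
    (δ : ℝ) (L p j q k r s R : ℕ) (hδL : 1/2^L ≤ δ)
    (hM : MM X Z ν s R) (hk : 1 ≤ k) (hkr : k ≤ r) (hrs : r ≤ s) (hR : k + r ≤ R) (hsq : k * (q+1) ≤ s)
    (hτ : 1/2^r ≤ δ^k) (h400 : 400 < δ * (67/66)^k)
    (hp : Even p) (hp2 : 2 ≤ p) (hj : 2 ≤ j) (hs : s = (p+1)*j) (hq : q = 2*((2*L+7)*(p+1)+4))
    (Xg : Finset α) (hXg : Xg ⊆ X) (hdeg1 : ∀ x ∈ Xg, 127/128 * (δ * #Z) ≤ ∑ z ∈ Z, f x z)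
    (hdeg2 : ∀ x ∈ Xg, ∑ z ∈ Z, f x z ≤ 2049/2048 * (δ * #Z))
    (hmass : 3/4 * (δ * #Z * #X) ≤ ∑ x ∈ Xg, ∑ z ∈ Z, f x z)
    (hK : (δ^2 * #Z / 4)^p * (#X:ℝ)^2 ≤ ∑ x ∈ Xg, ∑ y ∈ Xg, (∑ z ∈ Z, (f x z - δ) * (f y z - δ))^p) :
    ∃ X' ⊆ X, ∃ Z' ⊆ Z, (#X:ℝ) ≤ #X' * 2^(q+1) ∧ (δ/10)^(2*k) * #Z ≤ #Z' ∧
      33/32 * δ * #X' * #Z' ≤ ∑ x ∈ X', ∑ z ∈ Z', f x z := by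
  have hδ : 0 < δ := lt_of_lt_of_le (by positivity) hδL
  have hZ0 : (0:ℝ) < #Z := by exact_mod_cast card_pos.2 hZ
  have hX0 : (0:ℝ) < #X := by exact_mod_cast card_pos.2 hX
  have hν : ∀ x z, 0 ≤ ν x z := fun x z => (hf x z).trans (hfν x z)
  have hM2 := MM_two X Z ν s R hM (by omega)
  set m : ℝ := (#Z : ℝ) with hm
  set n : ℝ := (#X : ℝ) with hn
  set K : α → α → ℝ := fun x y => ∑ z ∈ Z, (f x z - δ) * (f y z - δ) with hKd
  set ff : α → α → ℝ := fun x y => ∑ z ∈ Z, f x z * f y z with hff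
  have hff0 : ∀ x y, 0 ≤ ff x y := fun x y => sum_nonneg fun z _ => mul_nonneg (hf _ _) (hf _ _)
  have hKff : ∀ x y, K x y = ff x y - δ * (∑ z ∈ Z, f x z) - δ * (∑ z ∈ Z, f y z) + δ^2 * m := by
    intro x y
    have : ∀ z, (f x z - δ) * (f y z - δ) = f x z * f y z - δ * f x z - δ * f y z + δ^2 := fun z => by ring
    simp only [hKd, hff, this, sum_add_distrib, sum_sub_distrib, ← mul_sum, sum_const, nsmul_eq_mul]
    ring
  have hXgn : 1/2 * n ≤ #Xg := by
    have h1 : ∑ x ∈ Xg, ∑ z ∈ Z, f x z ≤ #Xg * (2049/2048 * (δ * m)) := by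
      rw [← nsmul_eq_mul]; exact sum_le_card_nsmul _ _ _ hdeg2
    have h2 : 3/4 * n ≤ #Xg * (2049/2048) := by
      refine le_of_mul_le_mul_right (a := δ * m) ?_ (by positivity)
      linarith
    linarith
  set c : ℝ := δ^2 * m / 4 with hc
  have hc0 : 0 < c := by positivity
  have odd := oddmom (Xg ×ˢ Xg) (fun i => K i.1 i.2) c hc0 p hp hp2 (by
      rw [sum_product, card_product]; push_cast
      refine le_trans ?_ hK
      have : (#Xg:ℝ) ≤ n := by rw [hn]; exact_mod_cast card_le_card hXg
      rw [pow_two n]; gcongr) (by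
      rw [sum_product]; exact gram_nonneg Xg Z (fun x z => f x z - δ) (p+1))
  set Ps := (Xg ×ˢ Xg).filter (fun i => c/2 ≤ K i.1 i.2) with hPs
  obtain ⟨P, hPd⟩ : ∃ P : α → α → Prop, ∀ x y, P x y ↔ (x ∈ Xg ∧ y ∈ Xg ∧ c/2 ≤ K x y) := ⟨_, fun x y => Iff.rfl⟩
  have hPcard : (#Ps : ℝ) ≤ ∑ y ∈ X, (#{x ∈ X | P x y} : ℝ) := by
    have : #Ps ≤ ∑ y ∈ X, #{x ∈ X | P x y} := by
      rw [card_eq_sum_card_fiberwise (f := Prod.snd) (t := X)]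
      · refine sum_le_sum fun y _ => ?_
        refine card_le_card_of_injOn Prod.fst ?_ ?_
        · rintro ⟨x, y'⟩ h
          simp only [hPs, coe_filter, mem_filter, mem_product, Set.mem_ofPred_eq] at h
          obtain ⟨⟨⟨h1, h2⟩, h3⟩, rfl⟩ := h
          simp only [coe_filter, Set.mem_ofPred_eq]
          exact ⟨hXg h1, (hPd _ _).2 ⟨h1, h2, h3⟩⟩
        · rintro ⟨x, y1⟩ h1 ⟨x2, y2⟩ h2 h
          simp only [coe_filter, Set.mem_ofPred_eq] at h1 h2
          simp only at h
          rw [h, h1.2, h2.2]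
      · rintro ⟨x, y⟩ h
        simp only [hPs, coe_filter, mem_product, Set.mem_ofPred_eq] at h
        exact hXg h.1.2
    exact_mod_cast this
  have hPff : ∀ x y, P x y → 17/16 * δ^2 * m ≤ ff x y ∧ K x y ≤ ff x y := by
    intro x y hh
    obtain ⟨hx, hy, hxy⟩ := (hPd _ _).1 hh
    have h1 := mul_le_mul_of_nonneg_left (hdeg1 x hx) hδ.le
    have h2 := mul_le_mul_of_nonneg_left (hdeg1 y hy) hδ.le
    have h3 := hKff x y
    have h4 : 0 < δ^2 * m := by positivity
    constructor <;> nlinarith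
  -- size of P
  have hP : n^2 ≤ 2^q * ∑ y ∈ X, (#{x ∈ X | P x y} : ℝ) := by
    suffices h : n^2 ≤ 2^q * #Ps by
      refine h.trans ?_
      gcongr
    by_contra hcon
    push Not at hcon
    have h1 : c^(p+1)/16 * n^2 ≤ ∑ i ∈ Ps, ff i.1 i.2^(p+1) := by
      calc _ ≤ c^(p+1)/4 * (#(Xg ×ˢ Xg):ℝ) := by
            rw [card_product]; push_cast
            have : (1/2*n)*(1/2*n) ≤ (#Xg:ℝ) * #Xg := by gcongr
            calc c^(p+1)/16 * n^2 = c^(p+1)/4 * ((1/2*n)*(1/2*n)) := by ring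
              _ ≤ _ := by gcongr
        _ ≤ _ := odd
        _ ≤ _ := by
            refine sum_le_sum fun i hi => ?_
            simp only [hPs, mem_filter, mem_product] at hi
            exact pow_le_pow_left₀ (by linarith) (hPff i.1 i.2 ((hPd _ _).2 ⟨hi.1.1, hi.1.2, hi.2⟩)).2 _
    have pm := wpm Ps (fun _ => 1) (fun i => ff i.1 i.2^(p+1)) (fun _ _ => zero_le_one) (fun i _ => pow_nonneg (hff0 _ _) _) (j-1)
    rw [show j - 1 + 1 = j by omega] at pm
    simp only [one_mul, sum_const, nsmul_eq_mul, mul_one, ← pow_mul, ← hs] at pm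
    have h2 : ∑ i ∈ Ps, ff i.1 i.2^s ≤ n^2 * (25 * m)^s := by
      refine le_trans ?_ hM2
      rw [← sum_product' X X (fun x y => (∑ z ∈ Z, ν x z * ν y z)^s)]
      refine le_trans (sum_le_sum_of_subset_of_nonneg (t := X ×ˢ X) ?_ (fun i _ _ => pow_nonneg (hff0 _ _) _)) ?_
      · exact (filter_subset _ _).trans (product_subset_product hXg hXg)
      · refine sum_le_sum fun i _ => pow_le_pow_left₀ (hff0 _ _) ?_ _
        exact sum_le_sum fun z _ => mul_le_mul (hfν _ _) (hfν _ _) (hf _ _) (hν _ _)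
    set θ : ℝ := 1/2^((2*L+7)*(p+1)+4) with hθ
    have hθ0 : 0 < θ := by positivity
    have hθ1 : θ ≤ 1 := by rw [hθ]; exact (div_le_one (by positivity)).2 (one_le_pow₀ (by norm_num))
    have hPsθ : (#Ps:ℝ) < n^2 * θ^2 := by
      have : θ^2 = 1/2^q := by rw [hθ, div_pow, one_pow, ← pow_mul, hq, mul_comm _ 2]
      rw [this, mul_one_div, lt_div_iff₀ (by positivity)]; linarith
    have h3 : θ * (25*m)^(p+1) ≤ c^(p+1)/16 := by
      have : θ = (1/2^(2*L+7))^(p+1) / 16 := by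
        rw [hθ, pow_add, pow_mul, div_pow, one_pow]; norm_num; ring
      rw [this, div_mul_eq_mul_div, ← mul_pow]
      gcongr
      have : (1/2^L:ℝ)^2 ≤ δ^2 := by gcongr
      have e : (1:ℝ)/2^(2*L+7) = (1/2^L)^2 / 128 := by
        rw [pow_add, mul_comm 2 L, pow_mul]; norm_num; ring
      rw [e, hc]
      nlinarith
    have h4 : (n^2 * (θ * (25*m)^(p+1)))^j ≤ (#Ps:ℝ)^(j-1) * (n^2 * (25*m)^s) := by
      calc _ ≤ (c^(p+1)/16 * n^2)^j := by
            refine pow_le_pow_left₀ (by positivity) ?_ _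
            rw [mul_comm (c^(p+1)/16)]; gcongr
        _ ≤ _ := pow_le_pow_left₀ (by positivity) h1 _
        _ ≤ _ := pm
        _ ≤ _ := by gcongr
    have h5 : (#Ps:ℝ)^(j-1) * (n^2 * (25*m)^s) < (n^2 * θ^2)^(j-1) * (n^2 * (25*m)^s) := by
      refine mul_lt_mul_of_pos_right ?_ (by positivity)
      exact pow_lt_pow_left₀ hPsθ (by positivity) (by omega)
    have h6 : (n^2 * θ^2)^(j-1) * (n^2 * (25*m)^s) ≤ (n^2 * (θ * (25*m)^(p+1)))^j := by
      have e1 : (n^2 * (θ * (25*m)^(p+1)))^j = (n^2)^(j-1) * (n^2 * (25*m)^s) * θ^j := by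
        have : (n^2)^j = (n^2)^(j-1) * n^2 := by rw [← pow_succ]; congr 1; omega
        rw [mul_pow, mul_pow, this, hs, pow_mul]; ring
      have e2 : (θ^2)^(j-1) ≤ θ^j := by
        rw [← pow_mul]; exact pow_le_pow_of_le_one hθ0.le hθ1 (by omega)
      rw [e1, mul_pow]
      calc _ = (n^2)^(j-1) * (n^2 * (25*m)^s) * (θ^2)^(j-1) := by ring
        _ ≤ _ := by gcongr
    linarith
  obtain ⟨y, hy, hy1, hy2⟩ := stepB X hX Z hZ ν f hf hfν P δ hδ q k r s R hM hk hkr hrs hR hsq hτ h400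
    (fun x _ y _ h => (hPff x y h).1) (fun x _ y _ h => by
      have h1 := hdeg2 y ((hPd _ _).1 h).2.1
      have : 0 < δ * m := by positivity
      rw [← hm]; linarith) hP
  refine ⟨{x ∈ X | P x y}, filter_subset _ _, _, filter_subset _ _, hy1, hy2, ?_⟩
  rw [sum_comm]
  calc _ = ∑ z ∈ Z with 33/32 * δ * #{x ∈ X | P x y} ≤ ∑ x ∈ X with P x y, f x z, 33/32 * δ * #{x ∈ X | P x y} := by
        rw [sum_const, nsmul_eq_mul]; ring
    _ ≤ _ := sum_le_sum fun z hz => (mem_filter.1 hz).2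
end
end CF

namespace CF
open Finset
open scoped Classical
set_option linter.unusedSectionVars false
set_option linter.unusedSimpArgs false
variable {G : Type} [AddCommGroup G] [Module (ZMod 2) G] [Fintype G]

noncomputable def fA (A : Finset (G × G)) (Y : Finset G) (x z : G) : ℝ :=
  if (x, x + z) ∈ A then (Fintype.card G : ℝ) / #Y else 0

theorem fA_nonneg (A : Finset (G × G)) (Y : Finset G) (x z : G) : 0 ≤ fA A Y x z := by
  unfold fA; split_ifs <;> positivity

theorem fA_le (A : Finset (G × G)) (Y : Finset G) (hA : ∀ p ∈ A, p.2 ∈ Y) (x z : G) : fA A Y x z ≤ nu Y x z := by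
  unfold fA nu
  by_cases h : (x, x + z) ∈ A
  · rw [if_pos h, if_pos (hA _ h)]
  · rw [if_neg h]; split_ifs <;> positivity

theorem add_add_self' (x y : G) : x + (x + y) = y := ((add_eq_iff x (x+y) y).2 rfl)

theorem sum_fA (A : Finset (G × G)) (Y X' Z' : Finset G) :
    ∑ x ∈ X', ∑ z ∈ Z', fA A Y x z = #{p ∈ A | p.1 ∈ X' ∧ p.1 + p.2 ∈ Z'} * ((Fintype.card G : ℝ) / #Y) := by
  rw [← sum_product' X' Z' (fun x z => fA A Y x z)]
  simp only [fA]
  rw [← sum_filter, sum_const, nsmul_eq_mul]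
  congr 2
  refine card_nbij' (fun p => (p.1, p.1 + p.2)) (fun p => (p.1, p.1 + p.2)) ?_ ?_ ?_ ?_
  · rintro ⟨x, z⟩ h
    simp only [coe_filter, mem_product, Set.mem_ofPred_eq] at h ⊢
    rw [add_add_self']
    exact ⟨h.2, h.1⟩
  · rintro ⟨x, z⟩ h
    simp only [coe_filter, mem_product, Set.mem_ofPred_eq] at h ⊢
    rw [add_add_self']
    exact ⟨h.2, h.1⟩
  · rintro ⟨x, z⟩ h
    simp [add_add_self']
  · rintro ⟨x, z⟩ h
    simp [add_add_self']

def CFr (A : Finset (G × G)) : Prop := ∀ x y d, (x, y) ∈ A → (x + d, y) ∈ A → (x, y + d) ∈ A → d = 0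

def Half (X Y Z : Finset G) (A : Finset (G × G)) (δ : ℝ) (q t : ℕ) : Prop :=
  ∃ X' ⊆ X, ∃ Z' ⊆ Z, (#X:ℝ) ≤ #X' * 2^(q+1) ∧ (#Z:ℝ) ≤ #Z' * 2^t ∧
    2049/2048 * δ * #X' * #Z' ≤ ∑ x ∈ X', ∑ z ∈ Z', fA A Y x z

theorem side (X Y Z : Finset G) (A : Finset (G × G)) (hA : ∀ p ∈ A, p.1 ∈ X ∧ p.2 ∈ Y ∧ p.1 + p.2 ∈ Z) (hA0 : A.Nonempty)
    (δ : ℝ) (hδ0 : 0 < δ) (hδ : δ * (#X * #Y * #Z) = #A * Fintype.card G) (g q t : ℕ) (hg : (#X * #Y : ℝ) ≤ #A * 2^g) (hgq : g + 11 ≤ q + 1)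
    (hn : ¬ Half X Y Z A δ q t) :
    ∃ Xg ⊆ X, (∀ x ∈ Xg, 127/128 * (δ * #Z) ≤ ∑ z ∈ Z, fA A Y x z) ∧ (∀ x ∈ Xg, ∑ z ∈ Z, fA A Y x z ≤ 2049/2048 * (δ * #Z)) ∧
      3/4 * (δ * #Z * #X) ≤ ∑ x ∈ Xg, ∑ z ∈ Z, fA A Y x z := by
  obtain ⟨p0, hp0⟩ := hA0
  obtain ⟨hx0, hy0, hz0⟩ := hA p0 hp0
  have hX0 : (0:ℝ) < #X := by exact_mod_cast card_pos.2 ⟨_, hx0⟩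
  have hY0 : (0:ℝ) < #Y := by exact_mod_cast card_pos.2 ⟨_, hy0⟩
  have hZ0 : (0:ℝ) < #Z := by exact_mod_cast card_pos.2 ⟨_, hz0⟩
  set N : ℝ := ((Fintype.card G : ℕ) : ℝ) with hN
  have hN0 : 0 < N := by rw [hN]; exact_mod_cast Fintype.card_pos
  have hall : {p ∈ A | p.1 ∈ X ∧ p.1 + p.2 ∈ Z} = A := by
    rw [filter_eq_self]; exact fun p hp => ⟨(hA p hp).1, (hA p hp).2.2⟩
  have htot : ∑ x ∈ X, ∑ z ∈ Z, fA A Y x z = δ * #Z * #X := by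
    rw [sum_fA, hall, ← hN, ← mul_div_assoc, ← hδ]; field_simp
  refine ⟨_, filter_subset (fun x => 127/128 * (δ * #Z) ≤ ∑ z ∈ Z, fA A Y x z ∧ ∑ z ∈ Z, fA A Y x z ≤ 2049/2048 * (δ * #Z)) X, fun x hx => (mem_filter.1 hx).2.1, fun x hx => (mem_filter.1 hx).2.2, ?_⟩
  refine degs X _ (fun x => sum_nonneg fun z _ => fA_nonneg _ _ _ _) (δ * #Z) (by positivity) htot ?_
  by_contra hc
  push Not at hc
  refine hn ⟨{x ∈ X | ¬ (∑ z ∈ Z, fA A Y x z ≤ 2049/2048 * (δ * #Z))}, filter_subset _ _, Z, Subset.refl _, ?_, ?_, ?_⟩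
  · have hdN : ∀ x, ∑ z ∈ Z, fA A Y x z ≤ N := by
      intro x
      calc _ ≤ ∑ z ∈ Z, nu Y x z := sum_le_sum fun z _ => fA_le A Y (fun p hp => (hA p hp).2.1) x z
        _ ≤ ∑ z : G, nu Y x z := sum_le_sum_of_subset_of_nonneg (subset_univ _) fun z _ _ => by unfold nu; split_ifs <;> positivity
        _ = N := by unfold nu; rw [sum_ind_shift, ← hN]; field_simp
    have h1 : 1/2048 * (δ * #Z * #X) ≤ #{x ∈ X | ¬ (∑ z ∈ Z, fA A Y x z ≤ 2049/2048 * (δ * #Z))} * N := by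
      refine hc.trans ?_
      rw [← nsmul_eq_mul]
      push Not
      exact sum_le_card_nsmul _ _ _ fun x _ => hdN x
    set c : ℝ := (#{x ∈ X | ¬ (∑ z ∈ Z, fA A Y x z ≤ 2049/2048 * (δ * #Z))} : ℝ)
    have hc0 : 0 ≤ c := by positivity
    have h2 : (#A:ℝ) ≤ 2048 * c * #Y := by
      have : δ * #Z * #X = #A * N / #Y := by rw [← hδ]; field_simp
      rw [this] at h1
      have h3 : (#A:ℝ) * N ≤ 2048 * c * #Y * N := by
        have := mul_le_mul_of_nonneg_right h1 hY0.le
        have e : 1/2048 * (#A * N / #Y) * #Y = 1/2048 * ((#A:ℝ) * N) := by field_simp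
        rw [e] at this; linarith
      exact le_of_mul_le_mul_right h3 hN0
    have h4 : (#X:ℝ) * #Y ≤ (c * 2^(g+11)) * #Y := by
      calc _ ≤ (#A:ℝ) * 2^g := hg
        _ ≤ (2048 * c * #Y) * 2^g := by gcongr
        _ = _ := by rw [pow_add]; norm_num; ring
    refine (le_of_mul_le_mul_right h4 hY0).trans ?_
    gcongr
    norm_num
  · exact le_mul_of_one_le_right hZ0.le (one_le_pow₀ (by norm_num))
  · calc _ = ∑ x ∈ X with ¬ (∑ z ∈ Z, fA A Y x z ≤ 2049/2048 * (δ * #Z)), 2049/2048 * (δ * #Z) := by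
          rw [sum_const, nsmul_eq_mul]; ring
      _ ≤ _ := sum_le_sum fun x hx => by
          have := (mem_filter.1 hx).2
          push Not at this
          exact this.le

theorem cross_le (X Y Z : Finset G) (A : Finset (G × G)) (hcf : CFr A) (x y : G) (hxy : (x, y) ∈ A) :
    ∑ z ∈ Z, fA A Y x z * fA (A.image Prod.swap) X y z ≤ (Fintype.card G : ℝ) / #Y * (Fintype.card G / #X) := by
  have h0 : (0:ℝ) ≤ (Fintype.card G : ℝ) / #Y * (Fintype.card G / #X) := by positivity
  calc _ ≤ ∑ z ∈ Z, (if z = x + y then (Fintype.card G : ℝ) / #Y * (Fintype.card G / #X) else 0) := by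
        refine sum_le_sum fun z _ => ?_
        unfold fA
        by_cases h1 : (x, x + z) ∈ A
        · by_cases h2 : (y, y + z) ∈ A.image Prod.swap
          · rw [if_pos h1, if_pos h2]
            have h3 : (y + z, y) ∈ A := by
              simpa using h2
            have hd : x + y + z = 0 := by
              refine hcf x y (x + y + z) hxy ?_ ?_
              · rwa [add_assoc, add_add_self']
              · rwa [add_comm x y, add_assoc, add_add_self']
            rw [if_pos ((add_eq_zero_iff' _ _).1 hd).symm]
          · rw [if_neg h2, mul_zero]; split_ifs <;> positivity
        · rw [if_neg h1, zero_mul]; split_ifs <;> positivity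
    _ ≤ _ := by
        rw [sum_ite_eq']; split_ifs
        · exact le_rfl
        · exact h0

set_option maxHeartbeats 2000000 in
theorem stepA (X Y Z : Finset G) (A : Finset (G × G)) (hA : ∀ p ∈ A, p.1 ∈ X ∧ p.2 ∈ Y ∧ p.1 + p.2 ∈ Z) (hA0 : A.Nonempty)
    (hcf : CFr A) (δ : ℝ) (hδ : δ * (#X * #Y * #Z) = #A * Fintype.card G)
    (L g p j q k r s R t : ℕ) (hδL : 1/2^L ≤ δ) (hg : (#X * #Y : ℝ) ≤ #A * 2^g)
    (hMX : MM X Z (nu Y) s R) (hMY : MM Y Z (nu X) s R) (hbig : 4 * (Fintype.card G : ℝ)^2 ≤ δ^2 * (#X * #Y * #Z))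
    (hk : 1 ≤ k) (hkr : k ≤ r) (hrs : r ≤ s) (hR : k + r ≤ R) (hsq : k * (q+1) ≤ s)
    (hτ : 1/2^r ≤ δ^k) (h400 : 400 < δ * (67/66)^k)
    (hp : Even p) (hp2 : 2 ≤ p) (hj : 2 ≤ j) (hs : s = (p+1)*j) (hq : q = 2*((2*L+7)*(p+1)+4)) (hgp : g + 1 ≤ p)
    (ht : t = 2*k*(L+4)) :
    Half X Y Z A δ q t ∨ Half Y X Z (A.image Prod.swap) δ q t := by
  by_contra hcon
  push Not at hcon
  obtain ⟨hn1, hn2⟩ := hcon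
  have hδ0 : 0 < δ := lt_of_lt_of_le (by positivity) hδL
  have hA' : ∀ p ∈ A.image Prod.swap, p.1 ∈ Y ∧ p.2 ∈ X ∧ p.1 + p.2 ∈ Z := by
    rintro ⟨y, x⟩ h
    have h : (x, y) ∈ A := by simpa using h
    obtain ⟨h1, h2, h3⟩ := hA _ h
    exact ⟨h2, h1, by rw [add_comm]; exact h3⟩
  have hcardA : #(A.image Prod.swap) = #A := card_image_of_injective _ Prod.swap_injective
  have hgq : g + 11 ≤ q + 1 := by rw [hq]; nlinarith
  obtain ⟨Xg, hXgX, hX1, hX2, hX3⟩ := side X Y Z A hA hA0 δ hδ0 hδ g q t hg hgq hn1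
  obtain ⟨Yg, hYgY, hY1, hY2, hY3⟩ := side Y X Z (A.image Prod.swap) hA' (hA0.image _) δ hδ0 (by rw [hcardA, ← hδ]; ring) g q t (by rw [hcardA]; linarith) hgq hn2
  obtain ⟨p0, hp0⟩ := hA0
  obtain ⟨hx0, hy0, hz0⟩ := hA p0 hp0
  have hX0 : (0:ℝ) < #X := by exact_mod_cast card_pos.2 ⟨_, hx0⟩
  have hY0 : (0:ℝ) < #Y := by exact_mod_cast card_pos.2 ⟨_, hy0⟩
  have hZ0 : (0:ℝ) < #Z := by exact_mod_cast card_pos.2 ⟨_, hz0⟩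
  have hA00 : (0:ℝ) < #A := by exact_mod_cast card_pos.2 ⟨_, hp0⟩
  have conv : ∀ (X Y : Finset G) (A : Finset (G × G)), (∃ X' ⊆ X, ∃ Z' ⊆ Z, (#X:ℝ) ≤ #X' * 2^(q+1) ∧ (δ/10)^(2*k) * #Z ≤ #Z' ∧
      33/32 * δ * #X' * #Z' ≤ ∑ x ∈ X', ∑ z ∈ Z', fA A Y x z) → Half X Y Z A δ q t := by
    rintro X Y A ⟨X', hX', Z', hZ', h1, h2, h3⟩
    refine ⟨X', hX', Z', hZ', h1, ?_, ?_⟩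
    · have : (1/2^t:ℝ) ≤ (δ/10)^(2*k) := by
        rw [ht, mul_comm (2*k), pow_mul, ← one_div_pow]
        refine pow_le_pow_left₀ (by positivity) ?_ _
        have e4 : (1/2^(L+4):ℝ) = 1/2^L/16 := by rw [pow_add]; field_simp; norm_num
        rw [e4]
        linarith
      have h4 : 1/2^t * (#Z:ℝ) ≤ #Z' := le_trans (by gcongr) h2
      rw [one_div_mul_eq_div, div_le_iff₀ (by positivity)] at h4
      exact h4
    · refine le_trans ?_ h3
      have : 0 ≤ δ * #X' * #Z' := by positivity
      linarith
  set f := fA A Y with hf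
  set f2 := fA (A.image Prod.swap) X with hf2
  set SX := ∑ x ∈ Xg, ∑ y ∈ Xg, (∑ z ∈ Z, (f x z - δ) * (f y z - δ))^p with hSX
  set SY := ∑ x ∈ Yg, ∑ y ∈ Yg, (∑ z ∈ Z, (f2 x z - δ) * (f2 y z - δ))^p with hSY
  have hSX0 : 0 ≤ SX := gram_nonneg Xg Z (fun x z => f x z - δ) p
  have hSY0 : 0 ≤ SY := gram_nonneg Yg Z (fun x z => f2 x z - δ) p
  have cs := gram_cs Xg Yg Z (fun x z => f x z - δ) (fun x z => f2 x z - δ) p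
  have nX : SX < (δ^2 * #Z / 4)^p * (#X:ℝ)^2 := by
    by_contra hh
    push Not at hh
    exact hn1 (conv _ _ _ (halfB X ⟨_, hx0⟩ Z ⟨_, hz0⟩ (nu Y) f (fA_nonneg _ _) (fA_le A Y (fun p hp => (hA p hp).2.1)) δ L p j q k r s R hδL
      hMX hk hkr hrs hR hsq hτ h400 hp hp2 hj hs hq Xg hXgX hX1 hX2 hX3 hh))
  have nY : SY < (δ^2 * #Z / 4)^p * (#Y:ℝ)^2 := by
    by_contra hh
    push Not at hh
    exact hn2 (conv _ _ _ (halfB Y ⟨_, hy0⟩ Z ⟨_, hz0⟩ (nu X) f2 (fA_nonneg _ _) (fA_le _ X (fun p hp => (hA' p hp).2.1)) δ L p j q k r s R hδL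
      hMY hk hkr hrs hR hsq hτ h400 hp hp2 hj hs hq Yg hYgY hY1 hY2 hY3 hh))
  set N : ℝ := ((Fintype.card G : ℕ) : ℝ) with hN
  have hN0 : 0 < N := by rw [hN]; exact_mod_cast Fintype.card_pos
  set m : ℝ := (#Z:ℝ) with hm
  -- mass on Xg × Yg
  set Ag := {a ∈ A | a.1 ∈ Xg ∧ a.2 ∈ Yg} with hAg
  have hAgc : 1/2 * (#A:ℝ) ≤ #Ag := by
    have h1 : 3/4 * (#A:ℝ) ≤ #{a ∈ A | a.1 ∈ Xg ∧ a.1 + a.2 ∈ Z} := by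
      rw [hf, sum_fA, ← hN] at hX3
      refine le_of_mul_le_mul_right (a := N / #Y) ?_ (by positivity)
      refine le_trans (le_of_eq ?_) hX3
      have : (#A:ℝ) * (N / #Y) = δ * m * #X := by rw [← mul_div_assoc, ← hδ]; field_simp
      rw [mul_assoc, this]
    have h2 : 3/4 * (#A:ℝ) ≤ #{a ∈ A.image Prod.swap | a.1 ∈ Yg ∧ a.1 + a.2 ∈ Z} := by
      rw [hf2, sum_fA, ← hN] at hY3
      refine le_of_mul_le_mul_right (a := N / #X) ?_ (by positivity)
      refine le_trans (le_of_eq ?_) hY3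
      have : (#A:ℝ) * (N / #X) = δ * m * #Y := by rw [← mul_div_assoc, ← hδ]; field_simp
      rw [mul_assoc, this]
    have h3 : #{a ∈ A | a.1 ∈ Xg ∧ a.1 + a.2 ∈ Z} ≤ #{a ∈ A | a.1 ∈ Xg} := card_le_card fun a ha => by
      simp only [mem_filter] at ha ⊢; exact ⟨ha.1, ha.2.1⟩
    have h4 : #{a ∈ A.image Prod.swap | a.1 ∈ Yg ∧ a.1 + a.2 ∈ Z} ≤ #{a ∈ A | a.2 ∈ Yg} := by
      refine card_le_card_of_injOn Prod.swap ?_ (Prod.swap_injective.injOn)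
      rintro ⟨y, x⟩ h
      simp only [coe_filter, Set.mem_ofPred_eq] at h
      have h' : (x, y) ∈ A := by simpa using h.1
      simp only [Prod.swap_prod_mk, coe_filter, Set.mem_ofPred_eq]
      exact ⟨h', h.2.1⟩
    have h5 : #{a ∈ A | a.1 ∈ Xg} + #{a ∈ A | a.2 ∈ Yg} ≤ #A + #Ag := by
      rw [hAg, filter_and, ← card_union_add_card_inter]
      refine Nat.add_le_add_right (card_le_card ?_) _
      exact union_subset (filter_subset _ _) (filter_subset _ _)
    have h3' : (#{a ∈ A | a.1 ∈ Xg ∧ a.1 + a.2 ∈ Z}:ℝ) ≤ #{a ∈ A | a.1 ∈ Xg} := by exact_mod_cast h3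
    have h4' : (#{a ∈ A.image Prod.swap | a.1 ∈ Yg ∧ a.1 + a.2 ∈ Z}:ℝ) ≤ #{a ∈ A | a.2 ∈ Yg} := by exact_mod_cast h4
    have h5' : (#{a ∈ A | a.1 ∈ Xg}:ℝ) + #{a ∈ A | a.2 ∈ Yg} ≤ #A + #Ag := by exact_mod_cast h5
    linarith
  have hlow : #Ag * (δ^2 * m / 2)^p ≤ ∑ x ∈ Xg, ∑ y ∈ Yg, (∑ z ∈ Z, (f x z - δ) * (f2 y z - δ))^p := by
    rw [← sum_product' Xg Yg (fun x y => (∑ z ∈ Z, (f x z - δ) * (f2 y z - δ))^p)]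
    have hsub : Ag ⊆ Xg ×ˢ Yg := fun a ha => mem_product.2 (mem_filter.1 ha).2
    refine le_trans ?_ (sum_le_sum_of_subset_of_nonneg hsub fun a _ _ => hp.pow_nonneg _)
    rw [← nsmul_eq_mul]
    refine card_nsmul_le_sum _ _ _ fun a ha => ?_
    obtain ⟨ha1, ha2, ha3⟩ := mem_filter.1 ha
    rw [← hp.pow_abs (∑ z ∈ Z, (f a.1 z - δ) * (f2 a.2 z - δ))]
    refine pow_le_pow_left₀ (by positivity) ?_ _
    have c1 := cross_le X Y Z A hcf a.1 a.2 ha1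
    have e : ∑ z ∈ Z, (f a.1 z - δ) * (f2 a.2 z - δ) = ∑ z ∈ Z, f a.1 z * f2 a.2 z - δ * (∑ z ∈ Z, f a.1 z) - δ * (∑ z ∈ Z, f2 a.2 z) + δ^2 * m := by
      have : ∀ z, (f a.1 z - δ) * (f2 a.2 z - δ) = f a.1 z * f2 a.2 z - δ * f a.1 z - δ * f2 a.2 z + δ^2 := fun z => by ring
      simp only [this, sum_add_distrib, sum_sub_distrib, ← mul_sum, sum_const, nsmul_eq_mul]
      ring
    have c2 := mul_le_mul_of_nonneg_left (hX1 a.1 ha2) hδ0.le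
    have c3 := mul_le_mul_of_nonneg_left (hY1 a.2 ha3) hδ0.le
    have c4 : N / #Y * (N / #X) ≤ δ^2 * m / 4 := by
      rw [div_mul_div_comm, div_le_iff₀ (by positivity)]
      nlinarith
    have c5 : 0 < δ^2 * m := by positivity
    have c6 := neg_le_abs (∑ z ∈ Z, (f a.1 z - δ) * (f2 a.2 z - δ))
    refine le_trans ?_ c6
    rw [e]
    have c1' : ∑ z ∈ Z, f a.1 z * f2 a.2 z ≤ N / #Y * (N / #X) := c1
    nlinarith
  have h2p : (#X:ℝ) * #Y ≤ 1/2 * #A * 2^p := by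
    refine hg.trans ?_
    have : (2:ℝ)^(g+1) ≤ 2^p := pow_le_pow_right₀ (by norm_num) hgp
    rw [pow_succ] at this
    nlinarith
  have hlow2 : (#X:ℝ) * #Y * (δ^2 * m / 4)^p ≤ ∑ x ∈ Xg, ∑ y ∈ Yg, (∑ z ∈ Z, (f x z - δ) * (f2 y z - δ))^p := by
    refine le_trans ?_ hlow
    have e : (δ^2 * m / 2)^p = 2^p * (δ^2 * m / 4)^p := by rw [← mul_pow]; congr 1; ring
    rw [e, ← mul_assoc]
    refine mul_le_mul_of_nonneg_right (h2p.trans ?_) (by positivity)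
    gcongr
  have h7 : ((#X:ℝ) * #Y * (δ^2 * m / 4)^p)^2 ≤ SX * SY := le_trans (by gcongr) cs
  have h8 : SX * SY < ((δ^2 * m / 4)^p * (#X:ℝ)^2) * ((δ^2 * m / 4)^p * (#Y:ℝ)^2) := mul_lt_mul'' nX nY hSX0 hSY0
  have h9 : ((#X:ℝ) * #Y * (δ^2 * m / 4)^p)^2 = ((δ^2 * m / 4)^p * (#X:ℝ)^2) * ((δ^2 * m / 4)^p * (#Y:ℝ)^2) := by ring
  linarith

end CF

namespace CF
open Finset
open scoped Classical
set_option linter.unusedSectionVars false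
set_option linter.unusedSimpArgs false
variable {G : Type} [AddCommGroup G] [Module (ZMod 2) G] [Fintype G]

/-- spread relative to a subspace -/
def sprV (d : ℕ) (ε : ℝ) (V : Submodule (ZMod 2) G) (Y : Finset G) : Prop :=
  ∀ W : Submodule (ZMod 2) G, W ≤ V → ∀ a : G, (cd V : ℝ) ≤ cd W * 2^d →
    (#{y ∈ Y | a + y ∈ W} : ℝ) * cd V ≤ (1+ε) * (#Y * cd W)

lemma coset_avg (V V1 : Submodule (ZMod 2) G) (h1 : V1 ≤ V) (b : G) (Y : Finset G) (hY : ∀ y ∈ Y, b + y ∈ V) (f : G → ℝ) :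
    ∑ v ∈ univ.filter (fun v => v ∈ V), ∑ y ∈ Y with b + v + y ∈ V1, f y = cd V1 * ∑ y ∈ Y, f y := by
  simp only [sum_filter (s := Y)]
  rw [sum_comm, mul_sum]
  refine sum_congr rfl fun y hy => ?_
  rw [← sum_filter, sum_const, nsmul_eq_mul]
  congr 2
  rw [filter_filter, cd, ← card_shift (fun x => x ∈ V1) (b + y)]
  congr 1
  ext v
  simp only [mem_filter, mem_univ, true_and]
  have e : b + v + y = v + (b + y) := by abel
  rw [e]
  constructor
  · exact fun h => h.2
  · intro h
    refine ⟨?_, h⟩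
    have := V.sub_mem (h1 h) (hY y hy)
    simpa using this

lemma cd_pos' (V : Submodule (ZMod 2) G) : (0:ℝ) < cd V := by exact_mod_cast cd_pos V

set_option maxHeartbeats 1000000 in
lemma extract (u : G → ℝ) (hu : ∀ y, u y ≤ 1) (Y : Finset G) (hY0 : Y.Nonempty) (V V1 : Submodule (ZMod 2) G) (h1 : V1 ≤ V) (b : G)
    (hY : ∀ y ∈ Y, b + y ∈ V) (lam : ℝ) (hl : 0 < lam) (hsum : lam * #Y ≤ ∑ y ∈ Y, u y) (d J : ℕ) (ε : ℝ) (hε : 0 < ε)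
    (hJ : 2 * (cd V : ℝ) < lam * #Y * (1+ε)^J) :
    ∃ V2 ≤ V1, ∃ Y2 ⊆ Y, ∃ b2, Y2.Nonempty ∧ (∀ y ∈ Y2, b2 + y ∈ V2) ∧ sprV d ε V2 Y2 ∧ 1/2 * lam * #Y2 ≤ ∑ y ∈ Y2, u y ∧
      1/2 * lam * #Y * cd V2 ≤ (#Y2 : ℝ) * cd V ∧ (cd V1 : ℝ) ≤ cd V2 * 2^(d*J) := by
  have hYp : (0:ℝ) < #Y := by exact_mod_cast hY0.card_pos
  have hVp := cd_pos' V
  have hV1p := cd_pos' V1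
  -- minimal subset
  obtain ⟨T, hT, hTmin⟩ := exists_min_image (Y.powerset.filter (fun T => 1/2 * lam * ((#Y:ℝ) + #T) ≤ ∑ y ∈ T, u y)) card
    ⟨Y, by simp only [mem_filter, mem_powerset, Subset.refl, true_and]; linarith⟩
  simp only [mem_filter, mem_powerset] at hT hTmin
  obtain ⟨hTY, hTs⟩ := hT
  have hTc : 1/2 * lam * #Y ≤ (#T:ℝ) := by
    have : ∑ y ∈ T, u y ≤ #T := by simpa using sum_le_card_nsmul T u 1 (fun y _ => hu y)
    have : 0 ≤ lam * #T := by positivity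
    linarith
  have hsub : ∀ S ⊆ T, 1/2 * lam * (#S:ℝ) ≤ ∑ y ∈ S, u y := by
    intro S hS
    rcases S.eq_empty_or_nonempty with rfl | hSn
    · simp
    by_contra hh
    push Not at hh
    have hc := card_sdiff_add_card_eq_card hS
    have hs := sum_sdiff hS (f := u)
    have := hTmin (T \ S) ⟨(sdiff_subset.trans hTY), by
      have : (#(T \ S):ℝ) + #S = #T := by exact_mod_cast hc
      rw [show (#(T \ S):ℝ) = #T - #S by linarith]
      linarith⟩
    have := hSn.card_pos
    omega
  set ρ : ℝ := 1/2 * lam * #Y / cd V with hρ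
  have hρ0 : 0 < ρ := by positivity
  obtain ⟨P, hP⟩ : ∃ P : ℕ → Prop, ∀ j, P j ↔ ∃ W ≤ V1, ∃ a, (cd V1:ℝ) ≤ cd W * 2^(d*j) ∧ ρ * (1+ε)^j * cd W ≤ (#{y ∈ T | a + y ∈ W}:ℝ) :=
    ⟨_, fun _ => Iff.rfl⟩
  have hP0 : P 0 := by
    rw [hP]
    by_contra hh
    push Not at hh
    have av := coset_avg V V1 h1 b T (fun y hy => hY y (hTY hy)) (fun _ => 1)
    simp only [sum_const, nsmul_eq_mul, mul_one] at av
    have : ∑ v ∈ univ.filter (fun v => v ∈ V), ((#{y ∈ T | b + v + y ∈ V1}:ℕ):ℝ) < ∑ v ∈ univ.filter (fun v => v ∈ V), ρ * cd V1 := by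
      refine sum_lt_sum_of_nonempty ⟨0, by simp⟩ fun v _ => ?_
      have := hh V1 le_rfl (b+v) (by simp)
      simpa using this
    rw [av, sum_const, nsmul_eq_mul] at this
    have e : ((#(univ.filter (fun v => v ∈ V)) : ℕ) : ℝ) = cd V := rfl
    rw [e, hρ] at this
    have e2 : (cd V:ℝ) * (1/2 * lam * #Y / cd V * cd V1) = cd V1 * (1/2 * lam * #Y) := by field_simp
    rw [e2] at this
    exact absurd (lt_of_mul_lt_mul_left this hV1p.le) (not_lt.2 hTc)
  have hPJ : ∀ j, P j → j < J := by
    intro j hj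
    rw [hP] at hj
    obtain ⟨W, hW, a, h2, h3⟩ := hj
    by_contra hJj
    push Not at hJj
    have hWp := cd_pos' W
    have h4 : (#{y ∈ T | a + y ∈ W}:ℝ) ≤ cd W := by
      rw [cd, ← card_shift (fun x => x ∈ W) a]
      exact_mod_cast card_le_card fun y hy => by
        simp only [mem_filter, mem_univ, true_and] at hy ⊢; rw [add_comm]; exact hy.2
    have h5 : ρ * (1+ε)^j ≤ 1 := le_of_mul_le_mul_right (by linarith) hWp
    have h6 : (1+ε)^J ≤ (1+ε)^j := pow_le_pow_right₀ (by linarith) hJj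
    have h7 : ρ * (1+ε)^J ≤ 1 := le_trans (by gcongr) h5
    rw [hρ, div_mul_eq_mul_div, div_le_one hVp] at h7
    linarith
  have hg := Nat.findGreatest_spec (P := P) (Nat.zero_le J) hP0
  set j := Nat.findGreatest P J with hj
  have hjJ : j < J := hPJ j hg
  have hn : ¬ P (j+1) := fun h => by
    have := Nat.le_findGreatest (P := P) (hPJ _ h).le h
    omega
  rw [hP] at hg hn
  obtain ⟨W, hW, a, h2, h3⟩ := hg
  have hWp := cd_pos' W
  push Not at hn
  refine ⟨W, hW, T.filter (fun y => a + y ∈ W), (filter_subset _ _).trans hTY, a, ?_, ?_, ?_, ?_, ?_, ?_⟩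
  · rw [← card_pos]
    have : (0:ℝ) < #{y ∈ T | a + y ∈ W} := lt_of_lt_of_le (by positivity) h3
    exact_mod_cast this
  · intro y hy; exact (mem_filter.1 hy).2
  · intro W' hW' a' hd
    have hW'p := cd_pos' W'
    have h4 := hn W' (hW'.trans hW) a' (by
      rw [mul_add, mul_one, pow_add]
      calc (cd V1:ℝ) ≤ cd W * 2^(d*j) := h2
        _ ≤ (cd W' * 2^d) * 2^(d*j) := by gcongr
        _ = _ := by ring)
    have h5 : (#{y ∈ T.filter (fun y => a + y ∈ W) | a' + y ∈ W'}:ℝ) ≤ #{y ∈ T | a' + y ∈ W'} := by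
      exact_mod_cast card_le_card (filter_subset_filter _ (filter_subset _ _))
    calc (#{y ∈ T.filter (fun y => a + y ∈ W) | a' + y ∈ W'}:ℝ) * cd W ≤ (ρ * (1+ε)^(j+1) * cd W') * cd W := by
          gcongr; exact h5.trans h4.le
      _ = (1+ε) * ((ρ * (1+ε)^j * cd W) * cd W') := by ring
      _ ≤ _ := by gcongr
  · exact hsub _ (filter_subset _ _)
  · calc 1/2 * lam * #Y * cd W = ρ * cd W * cd V := by rw [hρ]; field_simp
      _ ≤ ρ * (1+ε)^j * cd W * cd V := by
        have : 1 ≤ (1+ε)^j := one_le_pow₀ (by linarith)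
        gcongr
        exact le_mul_of_one_le_right hρ0.le this
      _ ≤ _ := by gcongr
  · refine h2.trans ?_
    gcongr
    norm_num

end CF

namespace CF
open Finset
open scoped Classical
set_option linter.unusedSectionVars false
set_option linter.unusedSimpArgs false
variable {G : Type} [AddCommGroup G] [Module (ZMod 2) G] [Fintype G]

set_option maxHeartbeats 1000000 in
lemma cosetsplit (g : G → ℝ) (hg : ∀ y, g y ≤ 1) (X : Finset G) (hX0 : X.Nonempty) (V1 V2 : Submodule (ZMod 2) G) (h1 : V2 ≤ V1) (a : G)
    (hX : ∀ y ∈ X, a + y ∈ V1) (lam : ℝ) (hl : 0 < lam) (hsum : 1/4 * lam * #X ≤ ∑ y ∈ X, g y) (dX : ℕ)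
    (hspr : sprV dX (1/2^28) V1 X) (hcd : (cd V1:ℝ) ≤ cd V2 * 2^dX) :
    (∃ c, 1/32 * lam * (#X * cd V2) ≤ (#{x ∈ X | c + x ∈ V2}:ℝ) * cd V1 ∧ 
      2 * lam * (#{x ∈ X | c + x ∈ V2}:ℝ) ≤ ∑ x ∈ X with c + x ∈ V2, g x) ∨
    (∃ c, (1 - 1/2^22) * (#X * cd V2) ≤ (#{x ∈ X | c + x ∈ V2}:ℝ) * cd V1 ∧ 0 < ∑ x ∈ X with c + x ∈ V2, g x) := by
  by_contra hcon
  push Not at hcon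
  obtain ⟨hA, hB⟩ := hcon
  have hXp : (0:ℝ) < #X := by exact_mod_cast hX0.card_pos
  have hV1p := cd_pos' V1
  have hV2p := cd_pos' V2
  set μ : ℝ := #X * cd V2 / cd V1 with hμ
  have hμ0 : 0 < μ := by positivity
  have hμe : μ * cd V1 = #X * cd V2 := by rw [hμ]; field_simp
  obtain ⟨n, hn⟩ : ∃ n : G → ℝ, ∀ c, n c = (#{x ∈ X | c + x ∈ V2}:ℝ) := ⟨_, fun _ => rfl⟩
  obtain ⟨S, hS⟩ : ∃ S : G → ℝ, ∀ c, S c = ∑ x ∈ X with c + x ∈ V2, g x := ⟨_, fun _ => rfl⟩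
  simp only [← hn, ← hS] at hA hB
  have hn0 : ∀ c, 0 ≤ n c := fun c => by rw [hn]; positivity
  have hSn : ∀ c, S c ≤ n c := fun c => by
    rw [hn, hS]; simpa using sum_le_card_nsmul _ g 1 (fun y _ => hg y)
  have hup : ∀ c, n c ≤ (1 + 1/2^28) * μ := fun c => by
    have := hspr V2 h1 c hcd
    rw [← hn, ← hμe] at this
    exact le_of_mul_le_mul_right (by linarith) hV1p
  set F : Finset G := univ.filter (fun v => v ∈ V1) with hF
  have hFc : (#F:ℝ) = cd V1 := rfl
  have sn : ∑ v ∈ F, n (a + v) = μ * #F := by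
    have := coset_avg V1 V2 h1 a X hX (fun _ => 1)
    simp only [sum_const, nsmul_eq_mul, mul_one] at this
    simp only [hn]; rw [this, hFc, hμe]; ring
  have sS : 1/4 * lam * (μ * #F) ≤ ∑ v ∈ F, S (a + v) := by
    have := coset_avg V1 V2 h1 a X hX g
    simp only [hS]; rw [this, hFc, hμe]
    have := mul_le_mul_of_nonneg_left hsum hV2p.le
    linarith
  -- pointwise bound
  have key : ∀ c, S c ≤ 2 * lam * (2^22 * ((1 + 1/2^28) * μ - n c)) + 1/32 * lam * μ := by
    intro c
    have hu := hup c
    have hz : 0 ≤ 2 * lam * (2^22 * ((1 + 1/2^28) * μ - n c)) := by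
      have : 0 ≤ (1 + 1/2^28) * μ - n c := by linarith
      positivity
    by_cases hgood : (1 - 1/2^22) * (#X * cd V2) ≤ n c * cd V1
    · have := hB c hgood
      have : 0 ≤ 1/32 * lam * μ := by positivity
      linarith
    · push Not at hgood
      by_cases h32 : 1/32 * lam * (#X * cd V2) ≤ n c * cd V1
      · have h3 := hA c h32
        rw [← hμe, ← mul_assoc] at hgood
        have h4 := lt_of_mul_lt_mul_right hgood hV1p.le
        have h5 : n c ≤ 2^22 * ((1 + 1/2^28) * μ - n c) := by linarith
        have : 0 ≤ 1/32 * lam * μ := by positivity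
        have := mul_le_mul_of_nonneg_left h5 (by positivity : 0 ≤ 2 * lam)
        linarith
      · push Not at h32
        rw [← hμe, ← mul_assoc] at h32
        have h4 := lt_of_mul_lt_mul_right h32 hV1p.le
        linarith [hSn c]
  have h6 : ∑ v ∈ F, S (a + v) ≤ ∑ v ∈ F, (2 * lam * (2^22 * ((1 + 1/2^28) * μ - n (a+v))) + 1/32 * lam * μ) := sum_le_sum fun v _ => key _
  rw [sum_add_distrib, ← mul_sum, ← mul_sum, sum_sub_distrib, sn] at h6
  simp only [sum_const, nsmul_eq_mul] at h6
  have : 0 < lam * (μ * #F) := by rw [hFc]; positivity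
  linarith

lemma tp {a b : ℕ} (h : a ≤ b) : (2:ℝ)^a ≤ 2^b := pow_le_pow_right₀ (by norm_num) h
lemma tpm (c : ℝ) (hc : 0 ≤ c) {a b : ℕ} (h : a ≤ b) : c * (2:ℝ)^a ≤ c * 2^b := mul_le_mul_of_nonneg_left (tp h) hc

/-- number of increments -/
def JJ (h ℓ : ℕ) : ℕ := 2^28 * (h + 3 + ℓ)

lemma bern (ε : ℝ) (e : ℕ) (he : ε = 1/2^e) (m : ℕ) : (2:ℝ)^m ≤ (1+ε)^(2^e*m) := by
  rw [pow_mul]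
  refine pow_le_pow_left₀ (by norm_num) ?_ _
  have := one_add_mul_le_pow (a := ε) (by rw [he]; have : (0:ℝ) ≤ 1/2^e := by positivity
                                          linarith) (2^e)
  refine le_trans (le_of_eq ?_) this
  rw [he]; push_cast; field_simp; norm_num

set_option maxHeartbeats 2000000 in
lemma pseudo (w : G → G → ℝ) (hw : ∀ x y, w x y ≤ 1) (d h ℓ1 : ℕ) : ∀ m : ℕ, ∀ (V : Submodule (ZMod 2) G) (a b : G) (X Y : Finset G) (lam : ℝ) (ℓ : ℕ),
    X.Nonempty → Y.Nonempty → (∀ x ∈ X, a + x ∈ V) → (∀ y ∈ Y, b + y ∈ V) → (lam * (#X * #Y) ≤ ∑ x ∈ X, ∑ y ∈ Y, w x y) →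
    1 < lam * 2^m → 1 ≤ lam * 2^h → ℓ + m*(2*h+6) ≤ ℓ1 → (cd V:ℝ) ≤ #X*2^ℓ → (cd V:ℝ) ≤ #Y*2^ℓ →
    ∃ V', ∃ a' b', ∃ X' ⊆ X, ∃ Y' ⊆ Y, (∀ x ∈ X', a' + x ∈ V') ∧ (∀ y ∈ Y', b' + y ∈ V') ∧ 
      sprV d (1/2^21) V' X' ∧ sprV d (1/2^21) V' Y' ∧ 0 < ∑ x ∈ X', ∑ y ∈ Y', w x y ∧
      (cd V':ℝ) ≤ #X'*2^ℓ1 ∧ (cd V':ℝ) ≤ #Y'*2^ℓ1 ∧ (cd V:ℝ) ≤ cd V' * 2^(m * (d * JJ h ℓ1 * (JJ h ℓ1 + 2))) := by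
  intro m
  induction m with
  | zero =>
    intro V a b X Y lam ℓ hX0 hY0 _ _ hs h1
    exfalso
    have hXp : (0:ℝ) < #X := by exact_mod_cast hX0.card_pos
    have hYp : (0:ℝ) < #Y := by exact_mod_cast hY0.card_pos
    have : ∑ x ∈ X, ∑ y ∈ Y, w x y ≤ #X * #Y := by
      calc _ ≤ ∑ x ∈ X, ∑ y ∈ Y, (1:ℝ) := sum_le_sum fun x _ => sum_le_sum fun y _ => hw x y
        _ = _ := by simp
    have h2 : 0 < (#X:ℝ) * #Y := by positivity
    nlinarith
  | succ m ih =>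
    intro V a b X Y lam ℓ hX0 hY0 hXV hYV hs hm hh hℓ hcX hcY
    have hXp : (0:ℝ) < #X := by exact_mod_cast hX0.card_pos
    have hYp : (0:ℝ) < #Y := by exact_mod_cast hY0.card_pos
    have hl : 0 < lam := by
      by_contra hc
      push Not at hc
      have : lam * 2^h ≤ 0 := mul_nonpos_of_nonpos_of_nonneg hc (by positivity)
      linarith
    have hVp := cd_pos' V
    set J := JJ h ℓ1 with hJ
    have hℓℓ : ℓ + (2*h+6) ≤ ℓ1 := by
      have : (m+1)*(2*h+6) = m*(2*h+6) + (2*h+6) := by ring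
      omega
    have hJ' : ∀ e ≤ 28, (2:ℝ)^(h+ℓ+3) ≤ (1 + 1/2^e)^J := by
      intro e he
      refine (bern (1/2^e) e rfl (h+ℓ+3)).trans (pow_le_pow_right₀ (by simp) ?_)
      rw [hJ, JJ]
      exact Nat.mul_le_mul (pow_le_pow_right₀ (by norm_num) he) (by omega)
    have hJ28 := hJ' 28 le_rfl
    have hJ21 := hJ' 21 (by norm_num)
    have hbase : ∀ (Q : Finset G), (cd V:ℝ) ≤ #Q*2^ℓ → ∀ t : ℝ, (2:ℝ)^(h+ℓ+3) ≤ t → 2 * (cd V:ℝ) < lam / 2 * #Q * t := by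
      intro Q hQ t ht
      have hQp : (0:ℝ) ≤ #Q := by positivity
      calc 2 * (cd V:ℝ) ≤ 2 * (#Q * 2^ℓ) := by linarith
        _ ≤ 2 * (#Q * 2^ℓ) * (lam * 2^h) := le_mul_of_one_le_right (by positivity) hh
        _ < 2 * (#Q * 2^ℓ) * (lam * 2^h) * 2 := by
          have : 0 < (#Q:ℝ) * 2^ℓ := lt_of_lt_of_le hVp hQ
          have : 0 < 2 * (#Q * 2^ℓ) * (lam * 2^h) := by positivity
          linarith
        _ = lam / 2 * #Q * 2^(h+ℓ+3) := by rw [pow_add, pow_add]; ring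
        _ ≤ _ := by gcongr
    -- extract X1
    obtain ⟨V1, hV1, X1, hX1X, a1, hX1n, hX1V, hX1s, hX1l, hX1d, hV1d⟩ := extract (fun x => (∑ y ∈ Y, w x y) / #Y) (fun x => by
        rw [div_le_one hYp]; simpa using sum_le_card_nsmul Y (w x) 1 (fun y _ => hw x y)) X hX0 V V le_rfl a hXV lam hl (by
        rw [← sum_div, le_div_iff₀ hYp]; linarith) (d*J+d) J (1/2^28) (by positivity) (by
          have h1 := hbase X hcX _ hJ28
          refine h1.trans_le ?_
          have : 0 ≤ lam * #X * (1 + 1/2^28:ℝ)^J := by positivity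
          linarith)
    have hX1p : (0:ℝ) < #X1 := by exact_mod_cast hX1n.card_pos
    have hV1p := cd_pos' V1
    obtain ⟨V2, hV2, Y2, hY2Y, b2, hY2n, hY2V, hY2s, hY2l, hY2d, hV2d⟩ := extract (fun y => (∑ x ∈ X1, w x y) / #X1) (fun x => by
        rw [div_le_one hX1p]; simpa using sum_le_card_nsmul X1 (fun z => w z x) 1 (fun y _ => hw y x)) Y hY0 V V1 hV1 b hYV (lam/2) (by positivity) (by
        rw [← sum_div, le_div_iff₀ hX1p, sum_comm]
        rw [← sum_div, le_div_iff₀ hYp] at hX1l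
        linarith) d J (1/2^21) (by positivity) (hbase Y hcY _ hJ21)
    have hY2p : (0:ℝ) < #Y2 := by exact_mod_cast hY2n.card_pos
    have hV2p := cd_pos' V2
    have hcd12 : (cd V1:ℝ) ≤ cd V2 * 2^(d*J+d) := hV2d.trans (tpm _ (by positivity) (by omega))
    have hcost : (cd V:ℝ) ≤ cd V2 * 2^(d*J*(J+2)) := by
      calc (cd V:ℝ) ≤ (cd V2 * 2^(d*J)) * 2^((d*J+d)*J) := hV1d.trans (by gcongr)
        _ = cd V2 * 2^(d*J*(J+2)) := by rw [mul_assoc, ← pow_add]; congr 2; ring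
    -- Y2 density
    have hYdens : (cd V2:ℝ) ≤ #Y2 * 2^(ℓ+h+2) := by
      refine le_of_mul_le_mul_right (a := (cd V:ℝ)) ?_ hVp
      calc (cd V2:ℝ) * cd V ≤ cd V2 * (#Y * 2^ℓ) := by gcongr
        _ ≤ cd V2 * (#Y * 2^ℓ) * (lam * 2^h) := le_mul_of_one_le_right (by positivity) hh
        _ = (1/2 * (lam/2) * #Y * cd V2) * 2^(ℓ+h+2) := by rw [pow_add, pow_add]; ring
        _ ≤ (#Y2 * cd V) * 2^(ℓ+h+2) := by gcongr
        _ = _ := by ring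
    have hXdens : (cd V1:ℝ) ≤ #X1 * 2^(ℓ+h+1) := by
      refine le_of_mul_le_mul_right (a := (cd V:ℝ)) ?_ hVp
      calc (cd V1:ℝ) * cd V ≤ cd V1 * (#X * 2^ℓ) := by gcongr
        _ ≤ cd V1 * (#X * 2^ℓ) * (lam * 2^h) := le_mul_of_one_le_right (by positivity) hh
        _ = (1/2 * lam * #X * cd V1) * 2^(ℓ+h+1) := by rw [pow_add, pow_add]; ring
        _ ≤ (#X1 * cd V) * 2^(ℓ+h+1) := by gcongr
        _ = _ := by ring
    rcases cosetsplit (fun x => (∑ y ∈ Y2, w x y) / #Y2) (fun x => by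
        rw [div_le_one hY2p]; simpa using sum_le_card_nsmul Y2 (w x) 1 (fun y _ => hw x y)) X1 hX1n V1 V2 hV2 a1 hX1V lam hl (by
        rw [← sum_div, le_div_iff₀ hY2p]
        rw [← sum_div, le_div_iff₀ hX1p, sum_comm] at hY2l
        linarith) (d*J+d) hX1s hcd12 with ⟨c, hc1, hc2⟩ | ⟨c, hc1, hc2⟩
    · have hX3n : (0:ℝ) < #{x ∈ X1 | c + x ∈ V2} := by
        have : 0 < (#{x ∈ X1 | c + x ∈ V2}:ℝ) * cd V1 := lt_of_lt_of_le (by positivity) hc1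
        exact pos_of_mul_pos_left this hV1p.le
      have hX3d : (cd V2:ℝ) ≤ (#{x ∈ X1 | c + x ∈ V2}:ℝ) * 2^(ℓ+(2*h+6)) := by
        refine le_of_mul_le_mul_right (a := (cd V1:ℝ)) ?_ hV1p
        calc (cd V2:ℝ) * cd V1 ≤ cd V2 * (#X1 * 2^(ℓ+h+1)) := by gcongr
          _ ≤ cd V2 * (#X1 * 2^(ℓ+h+1)) * (lam * 2^h) := le_mul_of_one_le_right (by positivity) hh
          _ = (1/32 * lam * (#X1 * cd V2)) * 2^(ℓ+(2*h+6)) := by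
            rw [show ℓ+(2*h+6) = (ℓ+h+1)+h+5 by ring, pow_add _ _ 5, pow_add _ _ h]; ring
          _ ≤ ((#{x ∈ X1 | c + x ∈ V2}:ℝ) * cd V1) * 2^(ℓ+(2*h+6)) := by gcongr
          _ = _ := by ring
      obtain ⟨V', a', b', X', hX', Y', hY', r1, r2, r3, r4, r5, r6, r7, r8⟩ := ih V2 c b2 (X1.filter (fun x => c + x ∈ V2)) Y2 (2*lam) (ℓ+(2*h+6))
        (card_pos.1 (by exact_mod_cast hX3n)) hY2n (fun x hx => (mem_filter.1 hx).2) hY2V (by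
          rw [← sum_div, le_div_iff₀ hY2p] at hc2
          linarith) (by rw [pow_succ] at hm; linarith) (by linarith) (by
            have : (m+1)*(2*h+6) = m*(2*h+6) + (2*h+6) := by ring
            omega) hX3d (hYdens.trans (tpm _ (by positivity) (by omega)))
      refine ⟨V', a', b', X', hX'.trans ((filter_subset _ _).trans hX1X), Y', hY'.trans hY2Y, r1, r2, r3, r4, r5, r6, r7, ?_⟩
      calc (cd V:ℝ) ≤ (cd V' * 2^(m*(d*J*(J+2)))) * 2^(d*J*(J+2)) := hcost.trans (by gcongr)
        _ = _ := by rw [mul_assoc, ← pow_add]; congr 2; ring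
    · refine ⟨V2, c, b2, X1.filter (fun x => c + x ∈ V2), (filter_subset _ _).trans hX1X, Y2, hY2Y, fun x hx => (mem_filter.1 hx).2, hY2V, ?_, hY2s, ?_, ?_, ?_, ?_⟩
      · intro W hW a' hd
        have h1 := hX1s W (hW.trans hV2) a' (by
          calc (cd V1:ℝ) ≤ (cd W * 2^d) * 2^(d*J) := hV2d.trans (by gcongr)
            _ = _ := by rw [mul_assoc, ← pow_add]; congr 2; ring)
        have hWp := cd_pos' W
        have h2 : (#{x ∈ X1.filter (fun x => c + x ∈ V2) | a' + x ∈ W}:ℝ) ≤ #{x ∈ X1 | a' + x ∈ W} := by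
          exact_mod_cast card_le_card (filter_subset_filter _ (filter_subset _ _))
        refine le_of_mul_le_mul_right (a := (cd V1:ℝ)) ?_ hV1p
        calc (#{x ∈ X1.filter (fun x => c + x ∈ V2) | a' + x ∈ W}:ℝ) * cd V2 * cd V1 
            ≤ #{x ∈ X1 | a' + x ∈ W} * cd V2 * cd V1 := by gcongr
          _ = #{x ∈ X1 | a' + x ∈ W} * cd V1 * cd V2 := by ring
          _ ≤ (1 + 1/2^28) * (#X1 * cd W) * cd V2 := by gcongr
          _ = (1 + 1/2^28) * (#X1 * cd V2) * cd W := by ring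
          _ ≤ ((1 + 1/2^21) * (1 - 1/2^22)) * (#X1 * cd V2) * cd W := by gcongr; norm_num
          _ = (1 + 1/2^21) * ((1 - 1/2^22) * (#X1 * cd V2)) * cd W := by ring
          _ ≤ (1 + 1/2^21) * (#{x ∈ X1 | c + x ∈ V2} * cd V1) * cd W := by gcongr
          _ = _ := by ring
      · rw [← sum_div] at hc2
        exact (div_pos_iff_of_pos_right hY2p).1 hc2
      · refine le_trans ?_ (show (#(X1.filter (fun x => c + x ∈ V2)):ℝ) * 2^(ℓ+h+2) ≤ _ from tpm _ (by positivity) (by omega))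
        refine le_of_mul_le_mul_right (a := (cd V1:ℝ)) ?_ hV1p
        calc (cd V2:ℝ) * cd V1 ≤ cd V2 * (#X1 * 2^(ℓ+h+1)) := by gcongr
          _ = (1/2) * (#X1 * cd V2) * 2^(ℓ+h+2) := by rw [pow_succ _ (ℓ+h+1)]; ring
          _ ≤ ((1 - 1/2^22) * (#X1 * cd V2)) * 2^(ℓ+h+2) := by gcongr; norm_num
          _ ≤ ((#{x ∈ X1 | c + x ∈ V2}:ℝ) * cd V1) * 2^(ℓ+h+2) := by gcongr
          _ = _ := by ring
      · exact hYdens.trans (tpm _ (by positivity) (by omega))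
      · refine hcost.trans ?_
        exact tpm _ (by positivity) (Nat.le_mul_of_pos_left _ (by omega))

end CF

namespace CF
open Finset
open scoped Classical
set_option linter.unusedSectionVars false
set_option linter.unusedSimpArgs false
variable {G : Type} [AddCommGroup G] [Module (ZMod 2) G] [Fintype G]

noncomputable def TT (X Y Z : Finset G) : Finset (G × G) := (X ×ˢ Y).filter (fun p => p.1 + p.2 ∈ Z)

def State (X Y Z : Finset G) (A : Finset (G × G)) (δ : ℝ) (g ℓ : ℕ) : Prop :=
  A ⊆ TT X Y Z ∧ A.Nonempty ∧ CFr A ∧ δ * #(TT X Y Z) ≤ #A ∧ (#X * #Y : ℝ) ≤ #A * 2^g ∧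
    (Fintype.card G : ℝ) ≤ #X * 2^ℓ ∧ (Fintype.card G : ℝ) ≤ #Y * 2^ℓ

lemma add_add_self3 (a x : G) : a + (a + x) = x := add_add_self' a x

lemma card_tr (V : Submodule (ZMod 2) G) (b : G) (S : Finset G) (hS : ∀ s ∈ S, b + s ∈ V) :
    #(univ.filter (fun v : V => b + v ∈ S)) = #S := by
  refine card_bij (fun v _ => b + (v:G)) (fun v hv => (mem_filter.1 hv).2) (fun v _ u _ h => Subtype.ext (add_left_cancel h)) ?_
  intro s hs
  exact ⟨⟨b + s, hS s hs⟩, by simp [add_add_self3, hs], by simp [add_add_self3]⟩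

lemma card_tr2 (V : Submodule (ZMod 2) G) (a b : G) (S : Finset (G × G)) (hS : ∀ s ∈ S, a + s.1 ∈ V ∧ b + s.2 ∈ V) :
    #(univ.filter (fun v : V × V => (a + (v.1:G), b + (v.2:G)) ∈ S)) = #S := by
  refine card_bij (fun v _ => (a + (v.1:G), b + (v.2:G))) (fun v hv => (mem_filter.1 hv).2) (fun v _ u _ h => ?_) ?_
  · simp only [Prod.mk.injEq, add_right_inj] at h
    exact Prod.ext (Subtype.ext h.1) (Subtype.ext h.2)
  · intro s hs
    exact ⟨(⟨a + s.1, (hS s hs).1⟩, ⟨b + s.2, (hS s hs).2⟩), by simp [add_add_self3, hs], by simp [add_add_self3]⟩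

lemma cd_map (V : Submodule (ZMod 2) G) (W : Submodule (ZMod 2) V) : cd (W.map V.subtype) = cd W := by
  unfold cd
  symm
  refine card_bij (fun v _ => (v:G)) (fun v hv => ?_) (fun v _ u _ h => Subtype.ext h) ?_
  · simp only [mem_filter, mem_univ, true_and] at hv ⊢
    exact ⟨v, hv, rfl⟩
  · intro s hs
    simp only [mem_filter, mem_univ, true_and] at hs
    obtain ⟨v, hv, rfl⟩ := hs
    exact ⟨v, by simpa using hv, rfl⟩

lemma cd_card (V : Submodule (ZMod 2) G) : Fintype.card V = cd V := by
  rw [cd, Fintype.card_subtype]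

lemma spr_tr (V : Submodule (ZMod 2) G) (b : G) (S : Finset G) (hS : ∀ s ∈ S, b + s ∈ V) (d : ℕ) (ε : ℝ) (h : sprV d ε V S) :
    spr d ε (univ.filter (fun v : V => b + v ∈ S)) := by
  intro W c hd
  have h1 := h (W.map V.subtype) (Submodule.map_subtype_le V W) (c + b) (by
    rw [cd_map, ← cd_card]; exact_mod_cast hd)
  rw [cd_map] at h1
  rw [card_tr V b S hS, cd_card]
  refine le_trans ?_ h1
  gcongr
  refine card_le_card_of_injOn (fun v => b + (v:G)) ?_ (fun v _ u _ h => Subtype.ext (add_left_cancel h))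
  intro v hv
  simp only [coe_filter, mem_filter, mem_univ, true_and, Set.mem_ofPred_eq] at hv ⊢
  refine ⟨hv.1, c + v, hv.2, ?_⟩
  simp only [Submodule.subtype_apply, Submodule.coe_add]
  rw [add_assoc, add_add_self3]

set_option maxHeartbeats 1000000 in
lemma PR (X Y Z : Finset G) (A : Finset (G × G)) (δ : ℝ) (hδ : 0 ≤ δ) (g ℓ d ℓ1 : ℕ) (hst : State X Y Z A δ g ℓ)
    (hℓ : ℓ + (g+16)*(2*(g+15)+6) ≤ ℓ1) :
    ∃ V : Submodule (ZMod 2) G, ∃ X' Y' Z' : Finset V, ∃ A' : Finset (V × V), State X' Y' Z' A' ((1-1/2^14)*δ) (g+15) ℓ1 ∧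
      spr d (1/2^21) X' ∧ spr d (1/2^21) Y' ∧
      (Fintype.card G : ℝ) ≤ Fintype.card V * 2^((g+16) * (d * JJ (g+15) ℓ1 * (JJ (g+15) ℓ1 + 2))) := by
  obtain ⟨hAT, hA0, hcf, hδA, hg, hX, hY⟩ := hst
  have hsub : A ⊆ X ×ˢ Y := hAT.trans (filter_subset _ _)
  obtain ⟨p0, hp0⟩ := hA0
  have hp0' := mem_product.1 (hsub hp0)
  set w : G → G → ℝ := fun x y => (if (x,y) ∈ A then 1 else 0) - (1-1/2^14)*δ*(if (x,y) ∈ TT X Y Z then 1 else 0) - 1/2^(g+15) with hw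
  have hws : ∀ X' ⊆ X, ∀ Y' ⊆ Y, ∑ x ∈ X', ∑ y ∈ Y', w x y = #((X' ×ˢ Y').filter (fun p => p ∈ A)) - (1-1/2^14)*δ*#((X' ×ˢ Y').filter (fun p => p ∈ TT X Y Z))
      - 1/2^(g+15) * (#X' * #Y') := by
    intro X' _ Y' _
    rw [← sum_product' X' Y' w]
    simp only [hw, sum_sub_distrib, ← mul_sum, sum_boole, sum_const, nsmul_eq_mul, card_product, Nat.cast_mul]
    ring
  have hw1 : ∀ x y, w x y ≤ 1 := by
    intro x y
    have h1 : 0 ≤ (1-1/2^14)*δ*(if (x,y) ∈ TT X Y Z then (1:ℝ) else 0) := by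
      have : (0:ℝ) ≤ 1 - 1/2^14 := by norm_num
      split_ifs <;> positivity
    have h2 : (if (x,y) ∈ A then (1:ℝ) else 0) ≤ 1 := by split_ifs <;> norm_num
    have h3 : (0:ℝ) ≤ 1/2^(g+15) := by positivity
    simp only [hw]; linarith
  have hinA : (X ×ˢ Y).filter (fun p => p ∈ A) = A := by
    ext p; simp only [mem_filter]; exact ⟨fun h => h.2, fun h => ⟨hsub h, h⟩⟩
  have hinT : (X ×ˢ Y).filter (fun p => p ∈ TT X Y Z) = TT X Y Z := by
    ext p; simp only [mem_filter]; exact ⟨fun h => h.2, fun h => ⟨filter_subset _ _ h, h⟩⟩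
  have hct : ((cd (⊤ : Submodule (ZMod 2) G) : ℕ):ℝ) = Fintype.card G := by simp [cd]
  obtain ⟨V, a, b, X', hX', Y', hY', hXV, hYV, sX, sY, hpos, hcX, hcY, hcV⟩ := pseudo w hw1 d (g+15) ℓ1 (g+16) ⊤ 0 0 X Y (1/2^(g+15)) ℓ ⟨_, hp0'.1⟩ ⟨_, hp0'.2⟩ 
    (by simp) (by simp) (by
      rw [hws X Subset.rfl Y Subset.rfl, hinA, hinT]
      have h1 : 1/2^(g+15) * (#X * #Y:ℝ) ≤ 1/2^15 * #A := by
        rw [pow_add, one_div_mul_eq_div, div_le_iff₀ (by positivity)]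
        refine hg.trans (le_of_eq ?_); field_simp
      linarith) (by rw [pow_succ _ (g+15)]; field_simp; norm_num) (by field_simp; norm_num) hℓ (by rw [hct]; exact hX) (by rw [hct]; exact hY)
  rw [hws X' hX' Y' hY'] at hpos
  set Ac := (X' ×ˢ Y').filter (fun p => p ∈ A) with hAc
  set Tc := (X' ×ˢ Y').filter (fun p => p ∈ TT X Y Z) with hTc
  have hprod : ∀ p ∈ X' ×ˢ Y', a + p.1 ∈ V ∧ b + p.2 ∈ V := fun p hp => 
    ⟨hXV _ (mem_product.1 hp).1, hYV _ (mem_product.1 hp).2⟩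
  have cA := card_tr2 V a b Ac (fun p hp => hprod p (filter_subset _ _ hp))
  have cT := card_tr2 V a b Tc (fun p hp => hprod p (filter_subset _ _ hp))
  have cX := card_tr V a X' hXV
  have cY := card_tr V b Y' hYV
  set X2 := univ.filter (fun v : V => a + v ∈ X') with hX2
  set Y2 := univ.filter (fun v : V => b + v ∈ Y') with hY2
  set Z2 := univ.filter (fun v : V => a + b + v ∈ Z) with hZ2
  set A2 := univ.filter (fun v : V × V => (a + (v.1:G), b + (v.2:G)) ∈ Ac) with hA2
  have hT2 : TT X2 Y2 Z2 = univ.filter (fun v : V × V => (a + (v.1:G), b + (v.2:G)) ∈ Tc) := by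
    ext v
    simp only [TT, hX2, hY2, hZ2, hTc, mem_filter, mem_product, mem_univ, true_and, Submodule.coe_add]
    have e : a + (v.1:G) + (b + v.2) = a + b + (v.1 + v.2) := by abel
    rw [e]
    constructor
    · rintro ⟨⟨h1, h2⟩, h3⟩; exact ⟨⟨h1, h2⟩, ⟨hX' h1, hY' h2⟩, h3⟩
    · rintro ⟨⟨h1, h2⟩, _, h3⟩; exact ⟨⟨h1, h2⟩, h3⟩
  have hδ0 : 0 ≤ (1-1/2^14)*δ*#Tc := by
    have : (0:ℝ) ≤ 1 - 1/2^14 := by norm_num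
    positivity
  have hxy0 : 0 ≤ 1/2^(g+15) * (#X' * #Y':ℝ) := by positivity
  refine ⟨V, X2, Y2, Z2, A2, ⟨?_, ?_, ?_, ?_, ?_, ?_, ?_⟩, spr_tr V a X' hXV d _ sX, spr_tr V b Y' hYV d _ sY, ?_⟩
  · rw [hT2]
    intro v hv
    simp only [hA2, hAc, hTc, mem_filter, mem_univ, true_and] at hv ⊢
    exact ⟨hv.1, hAT hv.2⟩
  · rw [← card_pos, cA]
    have : (0:ℝ) < #Ac := by linarith
    exact_mod_cast this
  · intro x y dd h1 h2 h3
    simp only [hA2, hAc, mem_filter, mem_univ, true_and, Submodule.coe_add] at h1 h2 h3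
    have := hcf (a + x) (b + y) dd h1.2 (by rw [add_assoc]; exact h2.2) (by rw [add_assoc]; exact h3.2)
    exact_mod_cast this
  · rw [hT2, cT, cA]; linarith
  · rw [cX, cY, cA]
    have : 1/2^(g+15) * (#X' * #Y':ℝ) ≤ #Ac := by linarith
    rw [one_div_mul_eq_div, div_le_iff₀ (by positivity)] at this
    exact this
  · rw [cX, cd_card]; exact hcX
  · rw [cY, cd_card]; exact hcY
  · rw [cd_card, ← hct]; exact hcV

end CF

namespace CF
open Finset
open scoped Classical
set_option linter.unusedSectionVars false
set_option linter.unusedSimpArgs false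
variable {G : Type} [AddCommGroup G] [Module (ZMod 2) G] [Fintype G]

def kk (L : ℕ) : ℕ := 66 * (L + 11)
def pp (g : ℕ) : ℕ := 2 * g + 32
def j0 (L ℓ : ℕ) : ℕ := 2 * (kk L * (4*L+23) + ℓ) + 1
def ss (L g ℓ : ℕ) : ℕ := (pp g + 1) * (2^20 * j0 L ℓ)
def qq (L g : ℕ) : ℕ := 2*((2*L+7)*(pp g+1)+4)
def tt (L : ℕ) : ℕ := 2 * kk L * (L + 4)
def RR (L : ℕ) : ℕ := kk L + L * kk L
def lA (L g ℓ : ℕ) : ℕ := ss L g ℓ * (ℓ * (RR L + 2) + g + tt L) + 1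

lemma lemU' (Y Z : Finset G) (d s ℓA ℓ e : ℕ) (hspr : spr d (1/2^21) Y) (hs : 2^25 ≤ s) (hY : (Fintype.card G : ℝ) ≤ #Y * 2^ℓ)
    (hZ : (Fintype.card G : ℝ) ≤ #Z * 2^e) (hA : s * (ℓ + e) + 1 ≤ ℓA) (hd : dAP ℓA 23 ≤ d) : Ubd s Y Z := by
  refine lemU Y Z d s ℓA hspr hs ?_ hd
  set N : ℝ := ((Fintype.card G : ℕ) : ℝ) with hN
  have hN0 : 0 < N := by rw [hN]; exact_mod_cast Fintype.card_pos
  calc 2 * N^(2*s) = 2 * (N * N)^s := by rw [pow_mul, sq]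
    _ ≤ 2 * ((#Y * 2^ℓ) * (#Z * 2^e))^s := by gcongr
    _ = (#Y * #Z:ℝ)^s * 2^(s*(ℓ+e)+1) := by
      rw [pow_succ, mul_comm s, pow_mul, pow_add]
      rw [show ((#Y:ℝ) * 2^ℓ) * (#Z * 2^e) = (#Y * #Z) * (2^ℓ * 2^e) by ring, mul_pow]; ring
    _ ≤ _ := tpm _ (by positivity) hA

lemma card_TT (X Y Z : Finset G) : (#(TT X Y Z):ℝ) = ∑ x ∈ X, rr Y Z x := by
  simp only [rr_eq]
  rw [TT, card_filter, sum_product]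
  push_cast
  refine sum_congr rfl fun x _ => ?_
  rw [card_filter]; push_cast
  exact sum_congr rfl fun y _ => by rw [add_comm]

lemma card_TT' (X Y Z : Finset G) : (#(TT X Y Z):ℝ) = ∑ z ∈ Z, rr X Y z := by
  simp only [rr]
  rw [TT, card_filter, sum_product]
  push_cast
  rw [sum_comm (s := Z) (t := X)]
  refine sum_congr rfl fun x _ => ?_
  rw [sum_comm]
  refine sum_congr rfl fun y _ => ?_
  rw [sum_ite_eq]

set_option maxHeartbeats 1000000 in
lemma finish (X Y Z : Finset G) (A : Finset (G × G)) (hA : ∀ p ∈ A, p.1 ∈ X ∧ p.2 ∈ Y ∧ p.1 + p.2 ∈ Z)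
    (hcf : CFr A) (δ δm : ℝ) (hδ0 : 0 < δm) (hδ : δm * (#X * #Y * #Z) = #A * Fintype.card G) (hδm : (1-1/2^14)*δ ≤ δm) 
    (q t g ℓ s : ℕ) (hg : (#X * #Y : ℝ) ≤ #A * 2^g) (hX : (Fintype.card G : ℝ) ≤ #X * 2^ℓ) (hY : (Fintype.card G : ℝ) ≤ #Y * 2^ℓ)
    (hU : ∀ Z' : Finset G, (#Z : ℝ) ≤ #Z' * 2^t → Ubd s Y Z') (hs : 2^14 * (ℓ+q+1) ≤ s) (hZ0 : Z.Nonempty)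
    (hH : Half X Y Z A δm q t) : ∃ X Y Z : Finset G, ∃ A, State X Y Z A ((1+1/2^12)*δ) (g+t) (ℓ+q+1) := by
  obtain ⟨X', hX', Z', hZ', h1, h2, h3⟩ := hH
  rw [sum_fA] at h3
  set A' := {p ∈ A | p.1 ∈ X' ∧ p.1 + p.2 ∈ Z'} with hA'
  have hX2 : (Fintype.card G : ℝ) ≤ #X' * 2^(ℓ+q+1) := by
    calc (Fintype.card G : ℝ) ≤ (#X' * 2^(q+1)) * 2^ℓ := hX.trans (by gcongr)
      _ = _ := by rw [mul_assoc, ← pow_add]; congr 2; ring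
  set N : ℝ := ((Fintype.card G : ℕ) : ℝ) with hN
  have hN0 : 0 < N := by rw [hN]; exact_mod_cast Fintype.card_pos
  have hXp : (0:ℝ) < #X := pos_of_mul_pos_left (hN0.trans_le hX) (by positivity)
  have hYp : (0:ℝ) < #Y := pos_of_mul_pos_left (hN0.trans_le hY) (by positivity)
  have hX'p : (0:ℝ) < #X' := pos_of_mul_pos_left (hN0.trans_le hX2) (by positivity)
  have hZp : (0:ℝ) < #Z := by exact_mod_cast hZ0.card_pos
  have hZ'p : (0:ℝ) < #Z' := pos_of_mul_pos_left (hZp.trans_le h2) (by positivity)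
  have h4 : 2049/2048 * (δm * (#X' * #Y * #Z' / N)) ≤ #A' := by
    rw [← mul_div_assoc, le_div_iff₀ hYp] at h3
    rw [← mul_div_assoc, ← mul_div_assoc, div_le_iff₀ hN0]
    linarith
  have hTu := lemUp X' Y Z' s (ℓ+q+1) hs (by omega) hX2 (hU Z' h2)
  rw [← card_TT, ← hN] at hTu
  refine ⟨X', Y, Z', A', ?_, ?_, ?_, ?_, ?_, hX2, hY.trans (tpm _ (by positivity) (by omega))⟩
  · intro p hp
    simp only [hA', mem_filter] at hp
    simp only [TT, mem_filter, mem_product]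
    exact ⟨⟨hp.2.1, (hA p hp.1).2.1⟩, hp.2.2⟩
  · rw [← card_pos]
    have : (0:ℝ) < #A' := lt_of_lt_of_le (by positivity) h4
    exact_mod_cast this
  · intro x y d a b c
    exact hcf x y d (filter_subset _ _ a) (filter_subset _ _ b) (filter_subset _ _ c)
  · refine le_trans ?_ h4
    set M : ℝ := #X' * #Y * #Z' / N with hM
    have hM0 : 0 < M := by positivity
    rcases le_or_gt δ 0 with hd | hd
    · have : (1+1/2^12)*δ * #(TT X' Y Z') ≤ 0 := by
        refine mul_nonpos_of_nonpos_of_nonneg ?_ (by positivity)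
        linarith
      refine this.trans (by positivity)
    · calc (1+1/2^12)*δ * #(TT X' Y Z') ≤ (1+1/2^12)*δ * ((1 + 1/2^14) * (1 + 1/2^18) * M) := by gcongr
        _ = ((1+1/2^12) * (1 + 1/2^14) * (1 + 1/2^18)) * (δ * M) := by ring
        _ ≤ (2049/2048 * (1-1/2^14)) * (δ * M) := mul_le_mul_of_nonneg_right (by norm_num) (by positivity)
        _ = 2049/2048 * (((1-1/2^14) * δ) * M) := by ring
        _ ≤ _ := by gcongr
  · have h5 : δm * (#X' * #Y * #Z' / N) ≤ #A' := by
      have : 0 ≤ δm * (#X' * #Y * #Z' / N) := by positivity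
      linarith
    have e : δm = #A * N / (#X * #Y * #Z) := by rw [← hδ]; field_simp
    have h6 : (#A:ℝ) * #X' * #Z' ≤ #A' * (#X * #Z) := by
      have e2 : δm * (#X' * #Y * #Z' / N) = #A * #X' * #Z' / (#X * #Z) := by rw [e]; field_simp
      rw [e2, div_le_iff₀ (by positivity)] at h5
      exact h5
    refine le_of_mul_le_mul_right (a := (#X * #Z:ℝ)) ?_ (by positivity)
    calc (#X':ℝ) * #Y * (#X * #Z) = (#X * #Y) * #X' * #Z := by ring
      _ ≤ (#A * 2^g) * #X' * (#Z' * 2^t) := by gcongr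
      _ = (#A * #X' * #Z') * 2^(g+t) := by rw [pow_add]; ring
      _ ≤ (#A' * (#X * #Z)) * 2^(g+t) := by gcongr
      _ = _ := by ring

set_option maxHeartbeats 1000000 in
lemma core (X Y Z : Finset G) (A : Finset (G × G)) (δ : ℝ) (L g ℓ d : ℕ) (hst : State X Y Z A δ g ℓ) (hL1 : 1 ≤ L) (hL : 2/2^L ≤ δ) 
    (hsX : spr d (1/2^21) X) (hsY : spr d (1/2^21) Y) (hd : dAP (lA L g ℓ) 23 ≤ d) (hbig : (2:ℝ)^(2+2*L+3*ℓ+g) ≤ Fintype.card G) :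
    ∃ X Y Z : Finset G, ∃ A, State X Y Z A ((1+1/2^12)*δ) (g+tt L) (ℓ+qq L g+1) := by
  obtain ⟨hAT, hA0, hcf, hδA, hg, hX, hY⟩ := hst
  have hA : ∀ p ∈ A, p.1 ∈ X ∧ p.2 ∈ Y ∧ p.1 + p.2 ∈ Z := by
    intro p hp
    have := hAT hp
    simp only [TT, mem_filter, mem_product] at this
    tauto
  have hA' : ∀ p ∈ A.image Prod.swap, p.1 ∈ Y ∧ p.2 ∈ X ∧ p.1 + p.2 ∈ Z := by
    rintro ⟨y, x⟩ hp
    have h : (x, y) ∈ A := by simpa using hp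
    obtain ⟨a, b, c⟩ := hA _ h
    exact ⟨b, a, by rw [add_comm]; exact c⟩
  have hcf' : CFr (A.image Prod.swap) := by
    intro x y d a b c
    exact hcf y x d (by simpa using a) (by simpa using c) (by simpa using b)
  have hcA : #(A.image Prod.swap) = #A := card_image_of_injective _ Prod.swap_injective
  obtain ⟨p0, hp0⟩ := hA0
  obtain ⟨hx0, hy0, hz0⟩ := hA p0 hp0
  have hXp : (0:ℝ) < #X := by exact_mod_cast card_pos.2 ⟨_, hx0⟩
  have hYp : (0:ℝ) < #Y := by exact_mod_cast card_pos.2 ⟨_, hy0⟩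
  have hZp : (0:ℝ) < #Z := by exact_mod_cast card_pos.2 ⟨_, hz0⟩
  have hAp : (0:ℝ) < #A := by exact_mod_cast card_pos.2 ⟨_, hp0⟩
  set N : ℝ := ((Fintype.card G : ℕ) : ℝ) with hN
  have hN0 : 0 < N := by rw [hN]; exact_mod_cast Fintype.card_pos
  -- size of Z
  have hAXZ : (#A:ℝ) ≤ #X * #Z := by
    have : #A ≤ #(X ×ˢ Z) := by
      refine card_le_card_of_injOn (fun p => (p.1, p.1 + p.2)) (fun p hp => ?_) ?_
      · simp only [coe_product, Set.mem_prod, mem_coe]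
        exact ⟨(hA p hp).1, (hA p hp).2.2⟩
      · rintro ⟨x, y⟩ _ ⟨x', y'⟩ _ h
        simp only [Prod.mk.injEq] at h
        obtain ⟨rfl, h⟩ := h
        rw [add_left_cancel h]
    rw [card_product] at this
    exact_mod_cast this
  have hYZ : (#Y:ℝ) ≤ #Z * 2^g := by
    refine le_of_mul_le_mul_left (a := (#X:ℝ)) ?_ hXp
    refine hg.trans ?_
    rw [← mul_assoc]; gcongr
  have hZ : N ≤ #Z * 2^(g+ℓ) := by
    calc N ≤ (#Z * 2^g) * 2^ℓ := hY.trans (by gcongr)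
      _ = _ := by rw [mul_assoc, ← pow_add]
  -- parameters
  obtain ⟨k, hk⟩ : ∃ k, k = kk L := ⟨_, rfl⟩
  obtain ⟨p, hp⟩ : ∃ p, p = pp g := ⟨_, rfl⟩
  obtain ⟨s, hs⟩ : ∃ s, s = ss L g ℓ := ⟨_, rfl⟩
  obtain ⟨q, hq⟩ : ∃ q, q = qq L g := ⟨_, rfl⟩
  obtain ⟨t, ht⟩ : ∃ t, t = tt L := ⟨_, rfl⟩
  obtain ⟨R, hR⟩ : ∃ R, R = RR L := ⟨_, rfl⟩
  obtain ⟨ℓA, hℓA⟩ : ∃ ℓA, ℓA = lA L g ℓ := ⟨_, rfl⟩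
  rw [← hℓA] at hd
  rw [lA, ← hs, ← hR, ← ht] at hℓA
  rw [← ht, ← hq]
  have hk1 : 1 ≤ k := by rw [hk, kk]; omega
  have hpe : Even p := by rw [hp, pp]; exact ⟨g + 16, by ring⟩
  have hp32 : 32 + 2*g ≤ p := by rw [hp, pp]; omega
  have hqb : q + 1 ≤ (4*L+23)*(p+1) := by rw [hq, qq, ← hp]; ring_nf; nlinarith
  have hs' : s = 2^20 * ((p+1) * (2*(k*(4*L+23)+ℓ)+1)) := by rw [hs, ss, j0, ← hp, ← hk]; ring
  have hC0 : 1 * 23 ≤ k*(4*L+23) := Nat.mul_le_mul hk1 (by omega)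
  have hs25 : 2^25 ≤ s := by
    rw [hs']
    calc 2^25 = 2^20 * (32 * 1) := by norm_num
      _ ≤ _ := Nat.mul_le_mul_left _ (Nat.mul_le_mul (by omega) (by omega))
  have hsq : k*(q+1) ≤ s := by
    calc k*(q+1) ≤ k*((4*L+23)*(p+1)) := Nat.mul_le_mul_left _ hqb
      _ ≤ 1 * ((p+1) * (2*(k*(4*L+23)+ℓ)+1)) := by nlinarith
      _ ≤ s := by rw [hs']; exact Nat.mul_le_mul_right _ (by norm_num)
  have hp1s : 2^20 * (p+1) ≤ s := by
    rw [hs']; exact Nat.mul_le_mul_left _ (Nat.le_mul_of_pos_right _ (by omega))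
  have hsl : 2^14 * (ℓ+q+1) ≤ s := by
    have h1 : 2^20 * ℓ ≤ s := by
      rw [hs']
      exact Nat.mul_le_mul_left _ (by nlinarith)
    have h2 : 2^20 * (q+1) ≤ s := by
      rw [hs']
      refine Nat.mul_le_mul_left _ (hqb.trans ?_)
      rw [mul_comm]
      refine Nat.mul_le_mul_left _ ?_
      have := Nat.le_mul_of_pos_left (4*L+23) hk1
      omega
    omega
  have hrs : L*k ≤ s := by
    have h1 : L*k ≤ k*(4*L+23) := by nlinarith
    have h2 : k*(4*L+23) ≤ s := by
      rw [hs']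
      calc k*(4*L+23) ≤ 1 * (1 * (2*(k*(4*L+23)+ℓ)+1)) := by omega
        _ ≤ _ := Nat.mul_le_mul (by norm_num) (Nat.mul_le_mul_right _ (by omega))
    omega
  have hRe : R = k + L*k := by rw [hR, RR, ← hk]
  have hte : t = 2*k*(L+4) := by rw [ht, tt, ← hk]
  -- U bounds
  have hU : ∀ Y : Finset G, spr d (1/2^21) Y → N ≤ #Y * 2^ℓ → ∀ Z' : Finset G, N ≤ #Z' * 2^(g+ℓ+ℓ*R) ∨ N ≤ #Z' * 2^(g+ℓ+t) → Ubd s Y Z' := by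
    intro Y hsY hY Z' hZ'
    have : N ≤ #Z' * 2^(g+ℓ+ℓ*R+t) := by
      rcases hZ' with h | h
      · exact h.trans (tpm _ (by positivity) (by omega))
      · exact h.trans (tpm _ (by positivity) (by omega))
    refine lemU' Y Z' d s ℓA ℓ _ hsY hs25 hY this ?_ hd
    rw [hℓA]
    refine Nat.add_le_add_right (Nat.mul_le_mul_left _ ?_) _
    rw [mul_add]; omega
  have hMM : ∀ X Y : Finset G, N ≤ #X * 2^ℓ → N ≤ #Y * 2^ℓ → spr d (1/2^21) Y → MM X Z (nu Y) s R := by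
    intro X Y hX hY hsY j hj
    have hYp : (0:ℝ) < #Y := pos_of_mul_pos_left (hN0.trans_le hY) (by positivity)
    refine hostgrid X Y Z s ℓ R hX (card_pos.1 (by exact_mod_cast hYp)) (by omega) (by omega) (fun Z' hZ' => hU Y hsY hY Z' (Or.inl ?_)) j hj
    rw [← hN] at hZ'
    have h1 : (1/2^ℓ:ℝ) ≤ #Y / N := by
      rw [div_le_div_iff₀ (by positivity) hN0]; linarith
    have h2 : (1/2^ℓ:ℝ)^R * #Z ≤ #Z' := le_trans (by gcongr) hZ'
    rw [one_div_pow, ← pow_mul, one_div_mul_eq_div, div_le_iff₀ (by positivity)] at h2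
    calc N ≤ (#Z' * 2^(ℓ*R)) * 2^(g+ℓ) := hZ.trans (by gcongr)
      _ = _ := by rw [mul_assoc, ← pow_add]; congr 2; ring
  have hUself : ∀ Y : Finset G, spr d (1/2^21) Y → N ≤ #Y * 2^ℓ → Ubd s Y Y := by
    intro Y h1 h2
    exact hU Y h1 h2 Y (Or.inl (h2.trans (tpm _ (by positivity) (by omega))))
  have hsp' : s = 2^20 * (((p+1) * (2*(k*(4*L+23)+ℓ)+1) - 1) + 1) := by
    rw [hs', Nat.sub_add_cancel (Nat.mul_pos (by omega) (by omega))]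
  have hLw := lemLw X Y Z ⟨_, hx0⟩ ⟨_, hy0⟩ ((p+1) * (2*(k*(4*L+23)+ℓ)+1) - 1) (by
      obtain ⟨m, hm⟩ := hpe
      refine ⟨m * (2*(k*(4*L+23)+ℓ)+1) + (k*(4*L+23)+ℓ), ?_⟩
      rw [hm, Nat.sub_eq_iff_eq_add (Nat.mul_pos (by omega) (by omega))]; ring) (by omega) (hZ.trans (tpm _ (by positivity) (by
        have : (p+1) + 2*ℓ ≤ (p+1) * (2*(k*(4*L+23)+ℓ)+1) := by nlinarith
        omega))) (by rw [← hsp']; exact hUself X hsX hX) (by rw [← hsp']; exact hUself Y hsY hY)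
  rw [← card_TT', ← hN] at hLw
  set δm : ℝ := #A * N / (#X * #Y * #Z) with hδm
  have hδe : δm * (#X * #Y * #Z) = #A * N := by rw [hδm]; field_simp
  have hδ0 : 0 < δ := lt_of_lt_of_le (by positivity) hL
  have hδmδ : (1-1/2^14)*δ ≤ δm := by
    rw [hδm, le_div_iff₀ (by positivity)]
    have h1 := mul_le_mul_of_nonneg_left hLw hδ0.le
    have h2 := h1.trans hδA
    rw [← mul_div_assoc, ← mul_div_assoc, div_le_iff₀ hN0] at h2
    linarith
  have hLm : 1/2^L ≤ δm := by
    refine le_trans ?_ hδmδ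
    have : 1/2^L * 2 ≤ δ := by rw [one_div_mul_eq_div]; exact hL
    have h2 : (0:ℝ) < 1/2^L := by positivity
    linarith
  have hδm0 : 0 < δm := lt_of_lt_of_le (by positivity) hLm
  have hbig' : 4 * N^2 ≤ δm^2 * (#X * #Y * #Z) := by
    have h1 : N * N * N ≤ (#X * 2^ℓ) * (#Y * 2^ℓ) * (#Z * 2^(g+ℓ)) := by gcongr
    have h2 : N * N * N ≤ (#X * #Y * #Z) * 2^(3*ℓ+g) := by
      refine h1.trans (le_of_eq ?_)
      rw [show 3*ℓ+g = ℓ+ℓ+(g+ℓ) by ring, pow_add _ (ℓ+ℓ), pow_add]; ring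
    have h3 : (2:ℝ)^(2+2*L+3*ℓ+g) * (N * N) ≤ N * (N * N) := by gcongr
    have h4 : 4 * N^2 * 2^(2*L) ≤ #X * #Y * #Z := by
      refine le_of_mul_le_mul_right (a := (2:ℝ)^(3*ℓ+g)) ?_ (by positivity)
      refine le_trans (le_of_eq ?_) (h3.trans (le_trans (le_of_eq (by ring)) h2))
      rw [show 2+2*L+3*ℓ+g = 2 + 2*L + (3*ℓ+g) by ring, pow_add, pow_add]; ring
    have h5 : (1/2^L:ℝ)^2 ≤ δm^2 := by gcongr
    calc 4 * N^2 = (1/2^L:ℝ)^2 * (4 * N^2 * 2^(2*L)) := by rw [mul_comm 2 L, pow_mul]; field_simp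
      _ ≤ _ := by gcongr
  have hτ : 1/2^(L*k) ≤ δm^k := by
    rw [pow_mul, ← one_div_pow]; gcongr
  have h400 : 400 < δm * (67/66)^k := by
    have h1 : (2:ℝ)^(L+11) ≤ (67/66)^k := by
      rw [hk, kk, pow_mul]
      refine pow_le_pow_left₀ (by norm_num) ?_ _
      have := one_add_mul_le_pow (a := (1/66:ℝ)) (by norm_num) 66
      norm_num at this ⊢
    calc (400:ℝ) < 2^11 := by norm_num
      _ = 1/2^L * 2^(L+11) := by rw [pow_add]; field_simp
      _ ≤ _ := by gcongr
  have step := stepA X Y Z A hA ⟨_, hp0⟩ hcf δm hδe L g p (2^20 * j0 L ℓ) q k (L*k) s R t hLm hg (hMM X Y hX hY hsY) (hMM Y X hY hX hsX)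
    hbig' hk1 (Nat.le_mul_of_pos_left _ hL1) hrs (le_of_eq hRe.symm) hsq hτ h400 hpe (by omega) (by rw [j0]; omega) (by rw [hs, ss, ← hp])
    (by rw [hq, qq, ← hp]) (by omega) hte
  have hUt : ∀ Y : Finset G, spr d (1/2^21) Y → N ≤ #Y * 2^ℓ → ∀ Z' : Finset G, (#Z : ℝ) ≤ #Z' * 2^t → Ubd s Y Z' := by
    intro Y h1 h2 Z' hZ'
    refine hU Y h1 h2 Z' (Or.inr ?_)
    calc N ≤ (#Z' * 2^t) * 2^(g+ℓ) := hZ.trans (by gcongr)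
      _ = _ := by rw [mul_assoc, ← pow_add]; congr 2; ring
  rcases step with h | h
  · exact finish X Y Z A hA hcf δ δm hδm0 hδe hδmδ q t g ℓ s hg hX hY (hUt Y hsY hY) hsl ⟨_, hz0⟩ h
  · exact finish Y X Z (A.image Prod.swap) hA' hcf' δ δm hδm0 (by rw [hcA, ← hN, ← hδe]; ring) hδmδ q t g ℓ s (by rw [hcA]; linarith) hY hX (hUt X hsX hX) hsl ⟨_, hz0⟩ h

end CF

namespace CF
open Finset
open scoped Classical
set_option linter.unusedSectionVars false
set_option linter.unusedSimpArgs false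

lemma lA_mono {L g g' ℓ ℓ' : ℕ} (hg : g ≤ g') (hℓ : ℓ ≤ ℓ') : lA L g ℓ ≤ lA L g' ℓ' := by
  unfold lA ss pp j0; gcongr
lemma dAP_mono {a b : ℕ} (h : a ≤ b) : dAP a 23 ≤ dAP b 23 := by
  unfold dAP mAP; gcongr
lemma JJ_mono {g g' ℓ ℓ' : ℕ} (hg : g ≤ g') (hℓ : ℓ ≤ ℓ') : JJ g ℓ ≤ JJ g' ℓ' := by
  unfold JJ; gcongr
lemma qq_mono {L g g' : ℕ} (hg : g ≤ g') : qq L g ≤ qq L g' := by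
  unfold qq pp; gcongr

def aB (gB : ℕ) : ℕ := (gB+16)*(2*(gB+15)+6)
def DB (L gB ℓB : ℕ) : ℕ := (gB+16) * (dAP (lA L gB ℓB) 23 * JJ (gB+15) ℓB * (JJ (gB+15) ℓB + 2))

set_option maxHeartbeats 1000000 in
lemma iter (L gB ℓB : ℕ) (hL1 : 1 ≤ L) : ∀ i : ℕ, ∀ (G : Type) [AddCommGroup G] [Module (ZMod 2) G] [Fintype G] (X Y Z : Finset G) (A : Finset (G × G))
    (δ : ℝ) (g ℓ : ℕ), State X Y Z A δ g ℓ → 4/2^L ≤ δ → 1 < δ * (1+1/2^13)^i → g + i*(15+tt L) ≤ gB → ℓ + i*(aB gB + qq L gB + 1) ≤ ℓB →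
    (2:ℝ)^(i * DB L gB ℓB + (2+2*L+3*ℓB+gB)) ≤ Fintype.card G → False := by
  intro i
  induction i with
  | zero =>
    intro G _ _ _ X Y Z A δ g ℓ hst hL h1 _ _ _
    obtain ⟨hAT, hA0, _, hδA, _⟩ := hst
    have h2 : (#A:ℝ) ≤ #(TT X Y Z) := by exact_mod_cast card_le_card hAT
    have h3 : (0:ℝ) < #A := by exact_mod_cast hA0.card_pos
    simp only [pow_zero, mul_one] at h1
    nlinarith
  | succ i ih =>
    intro G _ _ _ X Y Z A δ g ℓ hst hL h1 hg hℓ hbig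
    have hδ0 : 0 < δ := lt_of_lt_of_le (by positivity) hL
    have e1 : (i+1)*(15+tt L) = i*(15+tt L) + 15 + tt L := by ring
    have e2 : (i+1)*(aB gB + qq L gB + 1) = i*(aB gB + qq L gB + 1) + aB gB + qq L gB + 1 := by ring
    have e3 : (i+1)*DB L gB ℓB = i*DB L gB ℓB + DB L gB ℓB := by ring
    rw [e1] at hg
    rw [e2] at hℓ
    rw [e3] at hbig
    have hg15 : g + 15 ≤ gB := by omega
    have hℓa : ℓ + aB gB ≤ ℓB := by omega
    obtain ⟨V, X1, Y1, Z1, A1, hst1, sX, sY, hcV⟩ := PR X Y Z A δ hδ0.le g ℓ (dAP (lA L gB ℓB) 23) (ℓ + aB gB) hst (by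
      refine Nat.add_le_add_left ?_ _
      unfold aB
      exact Nat.mul_le_mul (by omega) (by omega))
    have hcost : (g+16) * (dAP (lA L gB ℓB) 23 * JJ (g+15) (ℓ + aB gB) * (JJ (g+15) (ℓ + aB gB) + 2)) ≤ DB L gB ℓB := by
      have hJ : JJ (g+15) (ℓ + aB gB) ≤ JJ (gB+15) ℓB := JJ_mono (by omega) hℓa
      have hg' : g ≤ gB := by omega
      unfold DB
      gcongr
    have hV : (2:ℝ)^(i * DB L gB ℓB + (2+2*L+3*ℓB+gB)) ≤ Fintype.card V := by
      have h2 : (Fintype.card G : ℝ) ≤ Fintype.card V * 2^(DB L gB ℓB) := hcV.trans (tpm _ (by positivity) hcost)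
      refine le_of_mul_le_mul_right (a := (2:ℝ)^(DB L gB ℓB)) ?_ (by positivity)
      refine le_trans (le_of_eq ?_) (hbig.trans h2)
      rw [← pow_add]; congr 1; ring
    have hδ1 : 2/2^L ≤ (1-1/2^14)*δ := by
      have : (4/2^L:ℝ) = 2 * (2/2^L) := by ring
      have : (0:ℝ) < 2/2^L := by positivity
      linarith
    obtain ⟨X2, Y2, Z2, A2, hst2⟩ := core X1 Y1 Z1 A1 ((1-1/2^14)*δ) L (g+15) (ℓ + aB gB) _ hst1 hL1 hδ1 sX sY 
      (dAP_mono (lA_mono hg15 hℓa)) (le_trans (tp (by omega)) hV)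
    obtain ⟨b1, b2, b3, b4, b5, b6, b7⟩ := hst2
    have hq := qq_mono (L := L) hg15
    refine ih V X2 Y2 Z2 A2 ((1+1/2^13)*δ) (g+15+tt L) (ℓ + aB gB + qq L (g+15) + 1) ⟨b1, b2, b3, ?_, b5, b6, b7⟩ ?_ ?_ ?_ ?_ hV
    · refine le_trans ?_ b4
      gcongr ?_ * _
      have : (1 + 1/2^13:ℝ) ≤ (1+1/2^12) * (1-1/2^14) := by norm_num
      rw [← mul_assoc]
      gcongr
    · refine hL.trans ?_
      have : 0 ≤ 1/2^13*δ := by positivity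
      linarith
    · rw [pow_succ] at h1; linarith
    · omega
    · omega

/-- polynomially bounded -/
def PB (f : ℕ → ℕ) (k : ℕ) : Prop := ∃ C, ∀ L, 1 ≤ L → f L ≤ C * L^k

lemma PB.mono {f : ℕ → ℕ} {k k' : ℕ} (h : PB f k) (hk : k ≤ k') : PB f k' := by
  obtain ⟨C, hC⟩ := h
  exact ⟨C, fun L hL => (hC L hL).trans (Nat.mul_le_mul_left _ (Nat.pow_le_pow_right hL hk))⟩
lemma PB.const (c : ℕ) : PB (fun _ => c) 0 := ⟨c, fun L _ => by simp⟩
lemma PB.id : PB (fun L => L) 1 := ⟨1, fun L _ => by simp⟩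
lemma PB.add {f f' : ℕ → ℕ} {k k' : ℕ} (h : PB f k) (h' : PB f' k') : PB (fun L => f L + f' L) (max k k') := by
  obtain ⟨C, hC⟩ := h.mono (le_max_left k k')
  obtain ⟨C', hC'⟩ := h'.mono (le_max_right k k')
  exact ⟨C + C', fun L hL => by rw [add_mul]; exact Nat.add_le_add (hC L hL) (hC' L hL)⟩
lemma PB.mul {f f' : ℕ → ℕ} {k k' : ℕ} (h : PB f k) (h' : PB f' k') : PB (fun L => f L * f' L) (k + k') := by
  obtain ⟨C, hC⟩ := h
  obtain ⟨C', hC'⟩ := h'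
  exact ⟨C * C', fun L hL => (Nat.mul_le_mul (hC L hL) (hC' L hL)).trans (le_of_eq (by rw [pow_add]; ring))⟩

def gBf (L : ℕ) : ℕ := L + 2^13 * L * (15 + tt L)
def lBf (L : ℕ) : ℕ := 2^13 * L * (aB (gBf L) + qq L (gBf L) + 1)
def tot (L : ℕ) : ℕ := 2^13 * L * DB L (gBf L) (lBf L) + (2+2*L+3*lBf L+gBf L)

lemma tot_PB : PB tot 94 := by
  have c := PB.const
  have i := PB.id
  have hkk : PB kk 1 := by unfold kk; exact (c _).mul (i.add (c _))
  have htt : PB tt 2 := by unfold tt; exact ((c _).mul hkk).mul (i.add (c _))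
  have hgB : PB gBf 3 := by unfold gBf; exact i.add (((c _).mul i).mul ((c _).add htt))
  have haB : PB (fun L => aB (gBf L)) 6 := by
    unfold aB; exact (hgB.add (c _)).mul (((c 2).mul (hgB.add (c _))).add (c _))
  have hpp : PB (fun L => pp (gBf L)) 3 := by unfold pp; exact ((c 2).mul hgB).add (c _)
  have hqq : PB (fun L => qq L (gBf L)) 4 := by
    unfold qq; exact (c 2).mul (((((c 2).mul i).add (c _)).mul (hpp.add (c _))).add (c _))
  have hlB : PB lBf 7 := by
    unfold lBf; exact ((c _).mul i).mul ((haB.add hqq).add (c _))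
  have hj0 : PB (fun L => j0 L (lBf L)) 7 := by
    unfold j0; exact ((c 2).mul ((hkk.mul (((c 4).mul i).add (c _))).add hlB)).add (c _)
  have hss : PB (fun L => ss L (gBf L) (lBf L)) 10 := by
    unfold ss; exact (hpp.add (c _)).mul ((c _).mul hj0)
  have hRR : PB RR 2 := by unfold RR; exact hkk.add (i.mul hkk)
  have hlA : PB (fun L => lA L (gBf L) (lBf L)) 19 := by
    unfold lA; exact (hss.mul (((hlB.mul (hRR.add (c _))).add hgB).add htt)).add (c _)
  have hmAP : PB (fun L => mAP (lA L (gBf L) (lBf L)) 23) 57 := by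
    unfold mAP
    simp only [sq]
    exact (((c 64).mul ((hlA.add (c _)).mul (hlA.add (c _)))).mul (c _)).mul (((c 2).mul (hlA.add (c _))).add (c _))
  have hdAP : PB (fun L => dAP (lA L (gBf L) (lBf L)) 23) 76 := by
    unfold dAP; exact (c 8).mul ((hmAP.mul hlA).add (c _))
  have hJJ : PB (fun L => JJ (gBf L + 15) (lBf L)) 7 := by
    unfold JJ; exact (c _).mul (((hgB.add (c _)).add (c _)).add hlB)
  have hDB : PB (fun L => DB L (gBf L) (lBf L)) 93 := by
    unfold DB; exact (hgB.add (c _)).mul ((hdAP.mul hJJ).mul (hJJ.add (c _)))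
  unfold tot
  exact (((c _).mul i).mul hDB).add ((((c _).add ((c 2).mul i)).add ((c 3).mul hlB)).add hgB)

end CF

namespace CF
open Finset
open scoped Classical

lemma main1 : ∃ C : ℕ, 1 ≤ C ∧ ∀ L0 : ℕ, 1 ≤ L0 → ∀ n : ℕ, C * L0^94 ≤ n → ∀ A : Finset ((Fin n → ZMod 2) × (Fin n → ZMod 2)), CFr A →
    (#A:ℝ) ≤ ((2:ℝ)^n)^2 / 2^L0 := by
  obtain ⟨C0, hC0⟩ := tot_PB
  refine ⟨C0 * 3^94 + 1, by omega, fun L0 hL0 n hn A hA => ?_⟩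
  by_contra hcon
  push Not at hcon
  have hcG : Fintype.card (Fin n → ZMod 2) = 2^n := by simp [ZMod.card]
  have hcR : ((Fintype.card (Fin n → ZMod 2) : ℕ):ℝ) = 2^n := by rw [hcG]; push_cast; rfl
  have hT : TT (univ : Finset (Fin n → ZMod 2)) univ univ = univ := by
    ext p; simp [TT]
  have hTc : (#(TT (univ : Finset (Fin n → ZMod 2)) univ univ):ℝ) = (2^n)^2 := by
    rw [hT, card_univ, Fintype.card_prod, Nat.cast_mul, hcR]; ring
  have hA0 : (0:ℝ) < #A := lt_trans (by positivity) hcon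
  have htot : tot (L0+2) ≤ n := by
    refine (hC0 (L0+2) (by omega)).trans (le_trans ?_ hn)
    calc C0 * (L0+2)^94 ≤ C0 * (3*L0)^94 := Nat.mul_le_mul_left _ (Nat.pow_le_pow_left (by omega) _)
      _ = C0 * 3^94 * L0^94 := by rw [mul_pow]; ring
      _ ≤ _ := Nat.mul_le_mul_right _ (by omega)
  refine iter (L0+2) (gBf (L0+2)) (lBf (L0+2)) (by omega) (2^13*(L0+2)) (Fin n → ZMod 2) univ univ univ A (1/2^L0) L0 0 
    ⟨by rw [hT]; exact subset_univ _, card_pos.1 (by exact_mod_cast hA0), hA, ?_, ?_, ?_, ?_⟩ ?_ ?_ ?_ ?_ ?_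
  · rw [hTc, one_div_mul_eq_div]; exact hcon.le
  · rw [card_univ, hcR]
    rw [div_lt_iff₀ (by positivity)] at hcon
    linarith
  · rw [card_univ]; simp
  · rw [card_univ]; simp
  · rw [pow_add]; apply le_of_eq; field_simp; norm_num
  · have := bern (1/2^13) 13 rfl (L0+2)
    calc (1:ℝ) < 4 := by norm_num
      _ = 1/2^L0 * 2^(L0+2) := by rw [pow_add]; field_simp; norm_num
      _ ≤ _ := by gcongr
  · unfold gBf; omega
  · unfold lBf; omega
  · rw [hcR]; exact tp htot

lemma aux (C L n e f : ℕ) (hC : 1 ≤ C) (hL : 1 ≤ L) (he : e ≠ 0) (hef : e ≤ f) (h : n < C * (L+1)^e) : n ≤ (2*C*L)^f := by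
  have h0 : 0 < 2*C*L := Nat.mul_pos (by omega) hL
  calc n ≤ C * (L+1)^e := h.le
    _ ≤ C^e * (2*L)^e := Nat.mul_le_mul (Nat.le_self_pow he _) (Nat.pow_le_pow_left (by omega) _)
    _ = (2*C*L)^e := by rw [← mul_pow]; congr 1; ring
    _ ≤ (2*C*L)^f := Nat.pow_le_pow_right h0 hef

end CF

theorem CF.fin1 (C L : ℕ) (hC1 : 1 ≤ C) (t : ℝ) (hb : t ≤ ((2*C*L : ℕ):ℝ)) :
    1 / (4^C * (2*C)) * t ≤ L * Real.log 2 := by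
  have h4 : (4:ℝ) ≤ 4^C := by
    calc (4:ℝ) = 4^1 := by norm_num
      _ ≤ _ := pow_le_pow_right₀ (by norm_num) hC1
  have hC0 : (0:ℝ) < C := by exact_mod_cast hC1
  calc 1 / (4^C * (2*C)) * t ≤ 1 / (4^C * (2*C)) * ((2*C*L : ℕ):ℝ) :=
        mul_le_mul_of_nonneg_left hb (by positivity)
    _ = L * (1/4^C) := by push_cast; field_simp
    _ ≤ L * Real.log 2 := by
      refine mul_le_mul_of_nonneg_left ?_ (Nat.cast_nonneg L)
      have : (1:ℝ)/4^C ≤ 1/4 := one_div_le_one_div_of_le (by norm_num) h4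
      linarith [Real.log_two_gt_d9]

set_option maxHeartbeats 4000000 in
theorem CF.main2 :
    ∃ c : ℝ, 0 < c ∧ ∀ n : ℕ, 0 < n → ∀ A : Set ((Fin n → ZMod 2) × (Fin n → ZMod 2)),
          (∀ x y d : Fin n → ZMod 2, d ≠ 0 → ¬((x, y) ∈ A ∧ (x + d, y) ∈ A ∧ (x, y + d) ∈ A)) →
          (Nat.card ↥A : ℝ) ≤ ((2 : ℝ) ^ n) ^ 2 * Real.exp (-(c * Real.log ((2 : ℝ) ^ n) ^ ((1 : ℝ) / 178))) := by
  classical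
  obtain ⟨C, hC1, hC⟩ := CF.main1
  have hC0 : (0:ℝ) < C := by exact_mod_cast hC1
  refine ⟨1 / (4^C * (2*C)), by positivity, fun n hn A hA => ?_⟩
  set B : Finset ((Fin n → ZMod 2) × (Fin n → ZMod 2)) := A.toFinset with hB
  have hcard : Nat.card ↥A = B.card := by rw [Nat.card_eq_fintype_card, Set.toFinset_card]
  have hcf : CF.CFr B := by
    intro x y d h1 h2 h3
    by_contra hd
    exact hA x y d hd ⟨by simpa [hB] using h1, by simpa [hB] using h2, by simpa [hB] using h3⟩
  rw [hcard, Real.log_pow]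
  have hn1 : (1:ℝ) ≤ n := by exact_mod_cast hn
  have hlog0 : 0 < Real.log 2 := Real.log_pos (by norm_num)
  have hlog1 : Real.log 2 ≤ 1 := by linarith [Real.log_two_lt_d9]
  have hnl : (n:ℝ) * Real.log 2 ≤ n := mul_le_of_le_one_right (by positivity) hlog1
  have key : ∀ M : ℕ, n ≤ M^178 → ((n:ℝ) * Real.log 2)^((1:ℝ)/178) ≤ M := by
    intro M hM
    have h1 : (n:ℝ) * Real.log 2 ≤ (M:ℝ)^(178:ℕ) := hnl.trans (by exact_mod_cast hM)
    calc ((n:ℝ) * Real.log 2)^((1:ℝ)/178) ≤ ((M:ℝ)^(178:ℕ))^((1:ℝ)/178) := Real.rpow_le_rpow (by positivity) h1 (by norm_num)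
      _ = M := by
        rw [one_div]
        exact_mod_cast Real.pow_rpow_inv_natCast (n := 178) (Nat.cast_nonneg M) (by norm_num)
  by_cases hnC : C ≤ n
  · obtain ⟨L, hL, hLmax⟩ : ∃ L, C * L^94 ≤ n ∧ n < C * (L+1)^94 := by
      have hb : ∃ m, n < C * m^94 := ⟨n+1, by
        have h1 : n + 1 ≤ (n+1)^94 := Nat.le_self_pow (by norm_num) _
        have h2 : (n+1)^94 ≤ C * (n+1)^94 := Nat.le_mul_of_pos_left _ hC1
        omega⟩
      obtain ⟨m, hm⟩ : ∃ m, m = Nat.find hb := ⟨_, rfl⟩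
      have hs : n < C * m^94 := hm ▸ Nat.find_spec hb
      have hm0 : m ≠ 0 := by rintro rfl; simp at hs
      refine ⟨m-1, ?_, by rw [Nat.sub_add_cancel (by omega)]; exact hs⟩
      have := Nat.find_min hb (m := m-1) (by omega)
      omega
    have hL1 : 1 ≤ L := by
      by_contra h0
      have : L = 0 := by omega
      subst this
      simp at hLmax
      omega
    have h1 := hC L hL1 n hL B hcf
    refine h1.trans ?_
    rw [div_eq_mul_inv]
    refine mul_le_mul_of_nonneg_left ?_ (by positivity)
    have hb := key (2*C*L) (CF.aux C L n 94 178 hC1 hL1 (by norm_num) (by norm_num) hLmax)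
    have h2 : ((2:ℝ)^L)⁻¹ = Real.exp (-(L * Real.log 2)) := by
      rw [Real.exp_neg, mul_comm, Real.exp_mul, Real.exp_log (by norm_num), Real.rpow_natCast]
    rw [h2, Real.exp_le_exp, neg_le_neg_iff]
    exact CF.fin1 C L hC1 _ hb
  · push Not at hnC
    have hne : B ≠ Finset.univ := by
      intro h
      have := hcf 0 0 (fun _ => 1) (by rw [h]; simp) (by rw [h]; simp) (by rw [h]; simp)
      have h2 := congrFun this ⟨0, hn⟩
      simp at h2
    have hlt : B.card < (2^n)^2 := by
      obtain ⟨x, hx⟩ : ∃ x, x ∉ B := by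
        by_contra hh
        push Not at hh
        exact hne (Finset.eq_univ_of_forall hh)
      have := Finset.card_lt_univ_of_notMem hx
      refine this.trans_le (le_of_eq ?_)
      simp [ZMod.card]; ring
    have hle : (B.card:ℝ) ≤ ((2:ℝ)^n)^2 - 1 := by
      have : (B.card:ℝ) + 1 ≤ ((2:ℝ)^n)^2 := by exact_mod_cast hlt
      linarith
    refine hle.trans ?_
    have hb := key C (hnC.le.trans (Nat.le_self_pow (by norm_num) _))
    have h5 : 1 / (4^C * (2*C)) * ((n:ℝ) * Real.log 2)^((1:ℝ)/178) ≤ 1/((2:ℝ)^n)^2 := by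
      calc 1 / (4^C * (2*C)) * ((n:ℝ) * Real.log 2)^((1:ℝ)/178) ≤ 1 / (4^C * (2*C)) * (C:ℝ) := by gcongr
        _ = 1/4^C * (1/2) := by field_simp
        _ ≤ 1/4^C := by
          have : (0:ℝ) ≤ 1/4^C := by positivity
          linarith
        _ ≤ 1/4^n := by
          refine one_div_le_one_div_of_le (by positivity) (pow_le_pow_right₀ (by norm_num) hnC.le)
        _ = _ := by rw [← pow_mul, mul_comm n 2, pow_mul]; norm_num
    have h6 := Real.add_one_le_exp (-(1 / (4^C * (2*C)) * ((n:ℝ) * Real.log 2)^((1:ℝ)/178)))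
    have hp : (0:ℝ) < ((2:ℝ)^n)^2 := by positivity
    calc ((2:ℝ)^n)^2 - 1 = ((2:ℝ)^n)^2 * (-(1/((2:ℝ)^n)^2) + 1) := by field_simp; ring
      _ ≤ _ := by
        refine mul_le_mul_of_nonneg_left (le_trans ?_ h6) hp.le
        linarith

/-- Quasipolynomial bound for corner-free subsets of 𝔽₂ⁿ × 𝔽₂ⁿ
(Theorem 1.3 of the paper). -/
theorem corner_free_bound_F2 :
    ∃ c : ℝ, 0 < c ∧
      ∀ n : ℕ, 0 < n →
        ∀ A : Set ((Fin n → ZMod 2) × (Fin n → ZMod 2)),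
          (∀ x y d : Fin n → ZMod 2, d ≠ 0 →
            ¬((x, y) ∈ A ∧ (x + d, y) ∈ A ∧ (x, y + d) ∈ A)) →
          (Nat.card ↥A : ℝ) ≤
            ((2 : ℝ) ^ n) ^ 2 *
              Real.exp (-(c * Real.log ((2 : ℝ) ^ n) ^ ((1 : ℝ) / 178))) := by
  exact CF.main2
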